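/- Let h be a smooth solution of the Hele-Shaw equation on [0,T]. Then the Rayleigh–Taylor coefficient a = 1 − B satisfies the evolution equation ∂_t a − V·∇a + a·G(h)a + γ = 0, together with the identity γ = (1+|∇h|²)^{-1}·( G(h)(a² + |V|²) − 2a·G(h)a − 2V·G(h)V ). -/

import Mathlib

open MeasureTheory
open scoped Classical

noncomputable section

/-- ℤⁿ-periodicity for functions on ℝⁿ (model for functions on the torus 𝕋ⁿ = ℝⁿ/ℤⁿ). -/
def ZPeriodic (n : ℕ) (f : (Fin n → ℝ) → ℝ) : Prop :=
  ∀ (x : Fin n → ℝ) (k : Fin n → ℤ), f (x + fun i => (k i : ℝ)) = f x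

/-- ℤⁿ-periodicity in the horizontal variable for functions on ℝⁿ × ℝ. -/
def ZPeriodicE (n : ℕ) (φ : (Fin n → ℝ) × ℝ → ℝ) : Prop :=
  ∀ (x : Fin n → ℝ) (y : ℝ) (k : Fin n → ℤ), φ (x + fun i => (k i : ℝ), y) = φ (x, y)

/-- Fundamental cell of the torus 𝕋ⁿ. -/
def cell (n : ℕ) : Set (Fin n → ℝ) := Set.univ.pi fun _ => Set.Ico (0:ℝ) 1

/-- i-th partial derivative of a function on ℝⁿ. -/
def pdX (n : ℕ) (f : (Fin n → ℝ) → ℝ) (i : Fin n) (x : Fin n → ℝ) : ℝ :=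
  fderiv ℝ f x (Pi.single i 1)

/-- Directional derivative of a function on ℝⁿ × ℝ. -/
def pdE (n : ℕ) (φ : (Fin n → ℝ) × ℝ → ℝ) (v : (Fin n → ℝ) × ℝ)
    (p : (Fin n → ℝ) × ℝ) : ℝ := fderiv ℝ φ p v

def eX (n : ℕ) (i : Fin n) : (Fin n → ℝ) × ℝ := (Pi.single i 1, 0)
def eY (n : ℕ) : (Fin n → ℝ) × ℝ := (0, 1)

/-- Laplacian Δ_{x,y} on ℝⁿ × ℝ. -/
def lapE (n : ℕ) (φ : (Fin n → ℝ) × ℝ → ℝ) (p : (Fin n → ℝ) × ℝ) : ℝ :=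
  (∑ i, pdE n (pdE n φ (eX n i)) (eX n i) p) + pdE n (pdE n φ (eY n)) (eY n) p

/-- |∇_{x,y}φ|². -/
def gradSqE (n : ℕ) (φ : (Fin n → ℝ) × ℝ → ℝ) (p : (Fin n → ℝ) × ℝ) : ℝ :=
  (∑ i, (pdE n φ (eX n i) p)^2) + (pdE n φ (eY n) p)^2

/-- One periodic cell of the fluid domain Ω(h) = {y < h(x)}. -/
def fluidCell (n : ℕ) (h : (Fin n → ℝ) → ℝ) : Set ((Fin n → ℝ) × ℝ) :=
  {p | p.1 ∈ cell n ∧ p.2 < h p.1}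

/-- φ is the harmonic extension of ψ to Ω(h) = {y < h(x)}: it is harmonic in Ω(h),
has boundary value ψ, is periodic in x, and has square-integrable gradient. -/
structure IsHarmonicExt (n : ℕ) (h ψ : (Fin n → ℝ) → ℝ)
    (φ : (Fin n → ℝ) × ℝ → ℝ) : Prop where
  smooth : ContDiff ℝ (⊤ : ℕ∞) φ
  periodic : ZPeriodicE n φ
  harmonic : ∀ p : (Fin n → ℝ) × ℝ, p.2 < h p.1 → lapE n φ p = 0
  boundary : ∀ x, φ (x, h x) = ψ x
  gradL2 : IntegrableOn (gradSqE n φ) (fluidCell n h)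

/-- The Dirichlet-to-Neumann operator:
(G(h)ψ)(x) = ∂_yφ(x,h(x)) − ∇h(x)·∇_xφ(x,h(x)), where φ is the harmonic extension of ψ. -/
def DtN (n : ℕ) (h ψ : (Fin n → ℝ) → ℝ) : (Fin n → ℝ) → ℝ :=
  if H : ∃ φ, IsHarmonicExt n h ψ φ then
    fun x => pdE n H.choose (eY n) (x, h x)
      - ∑ i, pdX n h i x * pdE n H.choose (eX n i) (x, h x)
  else 0

/-- (B(h)ψ)(x) = ∂_yφ(x,h(x)). -/
def Bop (n : ℕ) (h ψ : (Fin n → ℝ) → ℝ) : (Fin n → ℝ) → ℝ :=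
  if H : ∃ φ, IsHarmonicExt n h ψ φ then
    fun x => pdE n H.choose (eY n) (x, h x)
  else 0

/-- (V(h)ψ)(x) = ∇_xφ(x,h(x)). -/
def Vop (n : ℕ) (h ψ : (Fin n → ℝ) → ℝ) : (Fin n → ℝ) → Fin n → ℝ :=
  if H : ∃ φ, IsHarmonicExt n h ψ φ then
    fun x i => pdE n H.choose (eX n i) (x, h x)
  else 0

/-- Divergence of a vector field on the torus. -/
def divX (n : ℕ) (W : (Fin n → ℝ) → Fin n → ℝ) (x : Fin n → ℝ) : ℝ :=
  ∑ i, pdX n (fun z => W z i) i x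

/-- h is a smooth solution of the Hele-Shaw equation ∂ₜh + G(h)h = 0 on [0,T]. -/
structure IsHeleShawSol (n : ℕ) (T : ℝ) (h : ℝ → (Fin n → ℝ) → ℝ) : Prop where
  smooth : ContDiff ℝ (⊤ : ℕ∞) (Function.uncurry h)
  periodic : ∀ t : ℝ, ZPeriodic n (h t)
  extension : ∀ t ∈ Set.Icc 0 T, ∃ φ, IsHarmonicExt n (h t) (h t) φ
  equation : ∀ t ∈ Set.Icc 0 T, ∀ x, deriv (fun s => h s x) t + DtN n (h t) (h t) x = 0

/-- B(t,x) = (B(h(t,·))h(t,·))(x). -/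
def HSB (n : ℕ) (h : ℝ → (Fin n → ℝ) → ℝ) (t : ℝ) (x : Fin n → ℝ) : ℝ :=
  Bop n (h t) (h t) x

/-- V(t,x) = (V(h(t,·))h(t,·))(x). -/
def HSV (n : ℕ) (h : ℝ → (Fin n → ℝ) → ℝ) (t : ℝ) (x : Fin n → ℝ) : Fin n → ℝ :=
  Vop n (h t) (h t) x

/-- The Rayleigh–Taylor coefficient a = 1 − B. -/
def HSa (n : ℕ) (h : ℝ → (Fin n → ℝ) → ℝ) (t : ℝ) (x : Fin n → ℝ) : ℝ :=
  1 - HSB n h t x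

/-- γ = (1+|∇h|²)⁻¹ ( G(h)(B²+|V|²) − 2B G(h)B − 2V·G(h)V ). -/
def HSgamma (n : ℕ) (h : ℝ → (Fin n → ℝ) → ℝ) (t : ℝ) (x : Fin n → ℝ) : ℝ :=
  (1 + ∑ i, (pdX n (h t) i x)^2)⁻¹ *
    ( DtN n (h t) (fun z => (HSB n h t z)^2 + ∑ i, (HSV n h t z i)^2) x
      - 2 * HSB n h t x * DtN n (h t) (fun z => HSB n h t z) x
      - 2 * ∑ i, HSV n h t x i * DtN n (h t) (fun z => HSV n h t z i) x )

/-- L(h)f = −V·∇f − ½(div V)f + √a G(h)(√a f). -/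
def Lop (n : ℕ) (h : ℝ → (Fin n → ℝ) → ℝ) (t : ℝ) (f : (Fin n → ℝ) → ℝ)
    (x : Fin n → ℝ) : ℝ :=
  - (∑ i, HSV n h t x i * pdX n f i x)
  - (1/2) * divX n (HSV n h t) x * f x
  + Real.sqrt (HSa n h t x) * DtN n (h t) (fun z => Real.sqrt (HSa n h t z) * f z) x




/-! ### Basic calculus -/

theorem pdE_contDiff {n : ℕ} {φ : (Fin n → ℝ) × ℝ → ℝ} (hφ : ContDiff ℝ (⊤ : ℕ∞) φ)
    (v : (Fin n → ℝ) × ℝ) : ContDiff ℝ (⊤ : ℕ∞) (pdE n φ v) := by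
  unfold pdE
  have h1 : ContDiff ℝ (⊤ : ℕ∞) (fderiv ℝ φ) := by
    apply hφ.fderiv_right
    exact le_of_eq rfl
  exact h1.clm_apply contDiff_const

theorem pdX_contDiff {n : ℕ} {f : (Fin n → ℝ) → ℝ} (hf : ContDiff ℝ (⊤ : ℕ∞) f)
    (i : Fin n) : ContDiff ℝ (⊤ : ℕ∞) (pdX n f i) := by
  unfold pdX
  have h1 : ContDiff ℝ (⊤ : ℕ∞) (fderiv ℝ f) := by
    apply hf.fderiv_right
    exact le_of_eq rfl
  exact h1.clm_apply contDiff_const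

theorem smooth_differentiable {E F : Type*} [NormedAddCommGroup E] [NormedSpace ℝ E]
    [NormedAddCommGroup F] [NormedSpace ℝ F] {f : E → F}
    (hf : ContDiff ℝ (⊤ : ℕ∞) f) : Differentiable ℝ f :=
  hf.differentiable (by simp)

/-- second directional derivatives commute -/
theorem fderiv_comm_dir {E : Type*} [NormedAddCommGroup E] [NormedSpace ℝ E] {f : E → ℝ}
    (hf : ContDiff ℝ (⊤ : ℕ∞) f) (u v p : E) :
    fderiv ℝ (fun q => fderiv ℝ f q u) p v = fderiv ℝ (fun q => fderiv ℝ f q v) p u := by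
  have h1 : ContDiff ℝ (⊤ : ℕ∞) (fderiv ℝ f) := by
    apply hf.fderiv_right
    exact le_of_eq rfl
  have hd : DifferentiableAt ℝ (fderiv ℝ f) p := (smooth_differentiable h1) p
  have e : ∀ w : E, fderiv ℝ (fun q => fderiv ℝ f q w) p = (fderiv ℝ (fderiv ℝ f) p).flip w := by
    intro w
    have := hd.hasFDerivAt.clm_apply (hasFDerivAt_const w p)
    rw [this.fderiv]
    ext z
    simp
  rw [e u, e v]
  have hs : IsSymmSndFDerivAt ℝ f p := by
    apply ContDiffAt.isSymmSndFDerivAt (n := ((⊤ : ℕ∞) : WithTop ℕ∞)) hf.contDiffAt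
    rw [minSmoothness_of_isRCLikeNormedField]
    exact WithTop.coe_le_coe.2 (le_top : (2:ℕ∞) ≤ ⊤)
  simpa using hs v u

theorem pdE_comm {n : ℕ} {φ : (Fin n → ℝ) × ℝ → ℝ} (hφ : ContDiff ℝ (⊤ : ℕ∞) φ)
    (u v : (Fin n → ℝ) × ℝ) : pdE n (pdE n φ u) v = pdE n (pdE n φ v) u := by
  funext p
  exact fderiv_comm_dir hφ u v p

theorem pdE_add {n : ℕ} {f g : (Fin n → ℝ) × ℝ → ℝ} (hf : ContDiff ℝ (⊤ : ℕ∞) f)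
    (hg : ContDiff ℝ (⊤ : ℕ∞) g) (v : (Fin n → ℝ) × ℝ) :
    pdE n (fun p => f p + g p) v = fun p => pdE n f v p + pdE n g v p := by
  funext p
  unfold pdE
  rw [fderiv_fun_add (smooth_differentiable hf p) (smooth_differentiable hg p)]
  rfl

theorem pdE_sub {n : ℕ} {f g : (Fin n → ℝ) × ℝ → ℝ} (hf : ContDiff ℝ (⊤ : ℕ∞) f)
    (hg : ContDiff ℝ (⊤ : ℕ∞) g) (v : (Fin n → ℝ) × ℝ) :
    pdE n (fun p => f p - g p) v = fun p => pdE n f v p - pdE n g v p := by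
  funext p
  unfold pdE
  rw [fderiv_fun_sub (smooth_differentiable hf p) (smooth_differentiable hg p)]
  rfl

theorem pdE_const_mul {n : ℕ} {f : (Fin n → ℝ) × ℝ → ℝ} (hf : ContDiff ℝ (⊤ : ℕ∞) f)
    (c : ℝ) (v : (Fin n → ℝ) × ℝ) :
    pdE n (fun p => c * f p) v = fun p => c * pdE n f v p := by
  funext p
  unfold pdE
  rw [fderiv_const_mul (smooth_differentiable hf p)]
  rfl

theorem pdE_mul {n : ℕ} {f g : (Fin n → ℝ) × ℝ → ℝ} (hf : ContDiff ℝ (⊤ : ℕ∞) f)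
    (hg : ContDiff ℝ (⊤ : ℕ∞) g) (v : (Fin n → ℝ) × ℝ) :
    pdE n (fun p => f p * g p) v = fun p => f p * pdE n g v p + g p * pdE n f v p := by
  funext p
  unfold pdE
  rw [fderiv_fun_mul (smooth_differentiable hf p) (smooth_differentiable hg p)]
  rfl

theorem pdE_const {n : ℕ} (c : ℝ) (v : (Fin n → ℝ) × ℝ) :
    pdE n (fun _ => c) v = fun _ => 0 := by
  funext p
  unfold pdE
  simp

theorem lapE_add {n : ℕ} {f g : (Fin n → ℝ) × ℝ → ℝ} (hf : ContDiff ℝ (⊤ : ℕ∞) f)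
    (hg : ContDiff ℝ (⊤ : ℕ∞) g) (p : (Fin n → ℝ) × ℝ) :
    lapE n (fun p => f p + g p) p = lapE n f p + lapE n g p := by
  unfold lapE
  simp only [pdE_add hf hg]
  simp only [pdE_add (pdE_contDiff hf _) (pdE_contDiff hg _), Finset.sum_add_distrib]
  ring

theorem lapE_sub {n : ℕ} {f g : (Fin n → ℝ) × ℝ → ℝ} (hf : ContDiff ℝ (⊤ : ℕ∞) f)
    (hg : ContDiff ℝ (⊤ : ℕ∞) g) (p : (Fin n → ℝ) × ℝ) :
    lapE n (fun p => f p - g p) p = lapE n f p - lapE n g p := by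
  unfold lapE
  simp only [pdE_sub hf hg]
  simp only [pdE_sub (pdE_contDiff hf _) (pdE_contDiff hg _), Finset.sum_sub_distrib]
  ring

theorem lapE_const_mul {n : ℕ} {f : (Fin n → ℝ) × ℝ → ℝ} (hf : ContDiff ℝ (⊤ : ℕ∞) f)
    (c : ℝ) (p : (Fin n → ℝ) × ℝ) :
    lapE n (fun p => c * f p) p = c * lapE n f p := by
  unfold lapE
  simp only [pdE_const_mul hf]
  simp only [pdE_const_mul (pdE_contDiff hf _), mul_add, Finset.mul_sum]

theorem lapE_const {n : ℕ} (c : ℝ) (p : (Fin n → ℝ) × ℝ) :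
    lapE n (fun _ => c) p = 0 := by
  unfold lapE
  simp [pdE_const]

theorem lapE_contDiff {n : ℕ} {φ : (Fin n → ℝ) × ℝ → ℝ} (hφ : ContDiff ℝ (⊤ : ℕ∞) φ) :
    ContDiff ℝ (⊤ : ℕ∞) (lapE n φ) := by
  unfold lapE
  apply ContDiff.add
  · apply ContDiff.sum
    intro i _
    exact pdE_contDiff (pdE_contDiff hφ _) _
  · exact pdE_contDiff (pdE_contDiff hφ _) _

theorem pdE_sum {n : ℕ} {ι : Type*} (s : Finset ι) {f : ι → (Fin n → ℝ) × ℝ → ℝ}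
    (hf : ∀ i, ContDiff ℝ (⊤ : ℕ∞) (f i)) (v : (Fin n → ℝ) × ℝ) :
    pdE n (fun p => ∑ i ∈ s, f i p) v = fun p => ∑ i ∈ s, pdE n (f i) v p := by
  funext p
  unfold pdE
  rw [fderiv_fun_sum (fun i _ => smooth_differentiable (hf i) p)]
  simp

/-- derivative commutes with laplacian -/
theorem lapE_pdE {n : ℕ} {φ : (Fin n → ℝ) × ℝ → ℝ} (hφ : ContDiff ℝ (⊤ : ℕ∞) φ)
    (v : (Fin n → ℝ) × ℝ) : lapE n (pdE n φ v) = pdE n (lapE n φ) v := by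
  have e1 : ∀ u, pdE n (pdE n (pdE n φ v) u) u = pdE n (pdE n (pdE n φ u) u) v := by
    intro u
    rw [pdE_comm hφ v u, pdE_comm (pdE_contDiff hφ u) v u]
  have : lapE n φ = fun p => (∑ i, pdE n (pdE n φ (eX n i)) (eX n i) p)
      + pdE n (pdE n φ (eY n)) (eY n) p := rfl
  rw [this, pdE_add _ (pdE_contDiff (pdE_contDiff hφ _) _),
    pdE_sum _ (fun i => pdE_contDiff (pdE_contDiff hφ _) _)]
  · funext p
    unfold lapE
    simp only [e1]
  · exact ContDiff.sum fun i _ => pdE_contDiff (pdE_contDiff hφ _) _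

theorem hasDerivAt_line {n : ℕ} {φ : (Fin n → ℝ) × ℝ → ℝ} (hφ : ContDiff ℝ (⊤ : ℕ∞) φ)
    (p v : (Fin n → ℝ) × ℝ) (r : ℝ) :
    HasDerivAt (fun r : ℝ => φ (p + r • v)) (pdE n φ v (p + r • v)) r := by
  have h1 : HasDerivAt (fun r : ℝ => p + r • v) v r := by
    simpa using ((hasDerivAt_id r).smul_const v).const_add p
  exact ((smooth_differentiable hφ (p + r • v)).hasFDerivAt.comp_hasDerivAt r h1)

theorem hasDerivAt_y {n : ℕ} {φ : (Fin n → ℝ) × ℝ → ℝ} (hφ : ContDiff ℝ (⊤ : ℕ∞) φ)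
    (x : Fin n → ℝ) (y : ℝ) :
    HasDerivAt (fun r : ℝ => φ (x, r)) (pdE n φ (eY n) (x, y)) y := by
  have := hasDerivAt_line hφ (x, 0) (eY n) y
  simpa [eY] using this

theorem pdX_graph {n : ℕ} {φ : (Fin n → ℝ) × ℝ → ℝ} {h : (Fin n → ℝ) → ℝ}
    (hφ : ContDiff ℝ (⊤ : ℕ∞) φ) (hh : ContDiff ℝ (⊤ : ℕ∞) h) (i : Fin n) (x : Fin n → ℝ) :
    pdX n (fun x => φ (x, h x)) i x
      = pdE n φ (eX n i) (x, h x) + pdX n h i x * pdE n φ (eY n) (x, h x) := by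
  have h1 : HasFDerivAt (fun x => (x, h x))
      ((ContinuousLinearMap.id ℝ (Fin n → ℝ)).prod (fderiv ℝ h x)) x :=
    (hasFDerivAt_id x).prodMk (smooth_differentiable hh x).hasFDerivAt
  have h2 := (smooth_differentiable hφ (x, h x)).hasFDerivAt.comp x h1
  unfold pdX pdE
  have h3 : fderiv ℝ (fun x => φ (x, h x)) x = _ := h2.fderiv
  rw [h3]
  simp only [ContinuousLinearMap.comp_apply, ContinuousLinearMap.prod_apply,
    ContinuousLinearMap.id_apply]
  have : ((Pi.single i (1:ℝ) : Fin n → ℝ), (fderiv ℝ h x) (Pi.single i 1))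
      = eX n i + ((fderiv ℝ h x) (Pi.single i 1)) • eY n := by
    simp [eX, eY]
  rw [this, map_add, map_smul]
  rfl

theorem graph_contDiff {n : ℕ} {φ : (Fin n → ℝ) × ℝ → ℝ} {h : (Fin n → ℝ) → ℝ}
    (hφ : ContDiff ℝ (⊤ : ℕ∞) φ) (hh : ContDiff ℝ (⊤ : ℕ∞) h) :
    ContDiff ℝ (⊤ : ℕ∞) (fun x => φ (x, h x)) :=
  hφ.comp (contDiff_id.prodMk hh)

/-! ### Periodicity -/

theorem ZPeriodicE.pdE {n : ℕ} {φ : (Fin n → ℝ) × ℝ → ℝ} (hp : ZPeriodicE n φ)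
    (v : (Fin n → ℝ) × ℝ) : ZPeriodicE n (pdE n φ v) := by
  intro x y k
  unfold _root_.pdE
  have e : φ = fun p => φ (p + ((fun i => (k i : ℝ)), (0:ℝ))) := by
    funext p
    obtain ⟨x', y'⟩ := p
    simp only [Prod.mk_add_mk, add_zero]
    exact (hp x' y' k).symm
  conv_rhs => rw [e]
  rw [fderiv_comp_add_right]
  simp only [Prod.mk_add_mk, add_zero]

theorem ZPeriodic.pdX {n : ℕ} {f : (Fin n → ℝ) → ℝ} (hp : ZPeriodic n f)
    (i : Fin n) : ZPeriodic n (pdX n f i) := by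
  intro x k
  unfold _root_.pdX
  have e : f = fun p => f (p + (fun i => (k i : ℝ))) := by
    funext p
    exact (hp p k).symm
  conv_rhs => rw [e]
  rw [fderiv_comp_add_right]

theorem ZPeriodicE.lapE {n : ℕ} {φ : (Fin n → ℝ) × ℝ → ℝ} (hp : ZPeriodicE n φ) :
    ZPeriodicE n (lapE n φ) := by
  intro x y k
  unfold _root_.lapE
  congr 1
  · exact Finset.sum_congr rfl fun i _ => ((hp.pdE _).pdE _) x y k
  · exact ((hp.pdE _).pdE _) x y k

theorem ZPeriodicE.graph {n : ℕ} {φ : (Fin n → ℝ) × ℝ → ℝ} {h : (Fin n → ℝ) → ℝ}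
    (hp : ZPeriodicE n φ) (hh : ZPeriodic n h) : ZPeriodic n (fun x => φ (x, h x)) := by
  intro x k
  simp only [hh x k]
  exact hp x (h x) k

/-- closed unit cube -/
def cubeX (n : ℕ) : Set (Fin n → ℝ) := Set.univ.pi fun _ => Set.Icc (0:ℝ) 1

theorem cubeX_compact (n : ℕ) : IsCompact (cubeX n) :=
  isCompact_univ_pi fun _ => isCompact_Icc

theorem exists_cube_rep {n : ℕ} (x : Fin n → ℝ) :
    ∃ k : Fin n → ℤ, (x + fun i => (k i : ℝ)) ∈ cubeX n := by
  refine ⟨fun i => -⌊x i⌋, ?_⟩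
  intro i _
  have h1 := Int.floor_le (x i)
  have h2 := Int.lt_floor_add_one (x i)
  simp only [Pi.add_apply, Int.cast_neg, Set.mem_Icc]
  constructor <;> linarith

theorem periodic_bounded {n : ℕ} {P : Type*} [TopologicalSpace P] {f : (Fin n → ℝ) → P → ℝ}
    (hf : Continuous (Function.uncurry f)) {K : Set P} (hK : IsCompact K)
    (hp : ∀ p ∈ K, ZPeriodic n (fun x => f x p)) :
    ∃ C : ℝ, 0 ≤ C ∧ ∀ x, ∀ p ∈ K, |f x p| ≤ C := by
  obtain ⟨C, hC⟩ := ((cubeX_compact n).prod hK).exists_bound_of_continuousOn hf.continuousOn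
  refine ⟨max C 0, le_max_right _ _, fun x p hpK => ?_⟩
  obtain ⟨k, hk⟩ := exists_cube_rep x
  have := hC (x + fun i => (k i : ℝ), p) ⟨hk, hpK⟩
  have h2 := hp p hpK x k
  simp only [Function.uncurry, Real.norm_eq_abs] at this
  simp only at h2
  rw [h2] at this
  exact this.trans (le_max_left _ _)

theorem periodic_bounded' {n : ℕ} {f : (Fin n → ℝ) → ℝ}
    (hf : Continuous f) (hp : ZPeriodic n f) :
    ∃ C : ℝ, 0 ≤ C ∧ ∀ x, |f x| ≤ C := by
  obtain ⟨C, h0, hC⟩ := periodic_bounded (P := Unit) (f := fun x _ => f x)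
    (by exact hf.comp continuous_fst) isCompact_univ (fun _ _ => hp)
  exact ⟨C, h0, fun x => hC x () trivial⟩



/-! ### Truncated convolution and weighted norms -/

def nk {n : ℕ} (k : Fin n → ℤ) : ℝ := ∑ i, |(k i : ℝ)|

theorem nk_nonneg {n : ℕ} (k : Fin n → ℤ) : 0 ≤ nk k :=
  Finset.sum_nonneg fun _ _ => abs_nonneg _

theorem nk_neg {n : ℕ} (k : Fin n → ℤ) : nk (-k) = nk k := by
  simp [nk]

theorem nk_add_le {n : ℕ} (k l : Fin n → ℤ) : nk (k + l) ≤ nk k + nk l := by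
  unfold nk
  rw [← Finset.sum_add_distrib]
  apply Finset.sum_le_sum
  intro i _
  simpa using abs_add_le (k i : ℝ) (l i : ℝ)

theorem abs_le_nk {n : ℕ} (k : Fin n → ℤ) (i : Fin n) : |(k i : ℝ)| ≤ nk k :=
  Finset.single_le_sum (f := fun i => |(k i : ℝ)|) (fun _ _ => abs_nonneg _) (Finset.mem_univ i)

def ipK {n : ℕ} (K : Finset (Fin n → ℤ)) (ρ : (Fin n → ℤ) → ℝ) (f g : (Fin n → ℤ) → ℂ) : ℝ :=
  ∑ k ∈ K, ρ k ^ 2 * (starRingEnd ℂ (f k) * g k).re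

def nrmK {n : ℕ} (K : Finset (Fin n → ℤ)) (ρ : (Fin n → ℤ) → ℝ) (f : (Fin n → ℤ) → ℂ) : ℝ :=
  ∑ k ∈ K, ρ k ^ 2 * ‖f k‖ ^ 2

def convK {n : ℕ} (K : Finset (Fin n → ℤ)) (b : (Fin n → ℤ) → ℂ) (f : (Fin n → ℤ) → ℂ)
    (k : Fin n → ℤ) : ℂ := ∑ l ∈ K, b (k - l) * f l

theorem nrmK_nonneg {n : ℕ} (K : Finset (Fin n → ℤ)) (ρ : (Fin n → ℤ) → ℝ)
    (f : (Fin n → ℤ) → ℂ) : 0 ≤ nrmK K ρ f :=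
  Finset.sum_nonneg fun _ _ => by positivity

theorem ipK_self {n : ℕ} (K : Finset (Fin n → ℤ)) (ρ : (Fin n → ℤ) → ℝ)
    (f : (Fin n → ℤ) → ℂ) : ipK K ρ f f = nrmK K ρ f := by
  unfold ipK nrmK
  apply Finset.sum_congr rfl
  intro k _
  rw [← Complex.normSq_eq_conj_mul_self, Complex.ofReal_re, Complex.normSq_eq_norm_sq]

theorem ipK_comm {n : ℕ} (K : Finset (Fin n → ℤ)) (ρ : (Fin n → ℤ) → ℝ)
    (f g : (Fin n → ℤ) → ℂ) : ipK K ρ f g = ipK K ρ g f := by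
  unfold ipK
  apply Finset.sum_congr rfl
  intro k _
  simp only [Complex.mul_re, Complex.conj_re, Complex.conj_im]
  ring

theorem re_conj_mul_le (a b : ℂ) : |(starRingEnd ℂ a * b).re| ≤ ‖a‖ * ‖b‖ := by
  calc _ ≤ ‖starRingEnd ℂ a * b‖ := Complex.abs_re_le_norm _
    _ = _ := by simp

theorem ipK_le {n : ℕ} (K : Finset (Fin n → ℤ)) (ρ : (Fin n → ℤ) → ℝ)
    (f g : (Fin n → ℤ) → ℂ) {r : ℝ} (hr : 0 < r) :
    |ipK K ρ f g| ≤ r * nrmK K ρ f + (1 / (4 * r)) * nrmK K ρ g := by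
  unfold ipK nrmK
  rw [Finset.mul_sum, Finset.mul_sum, ← Finset.sum_add_distrib]
  refine (Finset.abs_sum_le_sum_abs _ _).trans (Finset.sum_le_sum fun k _ => ?_)
  rw [abs_mul, abs_of_nonneg (sq_nonneg (ρ k))]
  have h1 := re_conj_mul_le (f k) (g k)
  have h2 : ‖f k‖ * ‖g k‖ ≤ r * ‖f k‖ ^ 2 + (1 / (4 * r)) * ‖g k‖ ^ 2 := by
    have : r * ‖f k‖ ^ 2 + (1 / (4 * r)) * ‖g k‖ ^ 2 - ‖f k‖ * ‖g k‖
        = r * (‖f k‖ - ‖g k‖ / (2 * r)) ^ 2 := by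
      field_simp
      ring
    have h3 : 0 ≤ r * (‖f k‖ - ‖g k‖ / (2 * r)) ^ 2 := by positivity
    linarith
  calc _ ≤ ρ k ^ 2 * (r * ‖f k‖ ^ 2 + (1 / (4 * r)) * ‖g k‖ ^ 2) :=
        mul_le_mul_of_nonneg_left (h1.trans h2) (sq_nonneg _)
    _ = _ := by ring

theorem ipK_congr {n : ℕ} {K : Finset (Fin n → ℤ)} (ρ : (Fin n → ℤ) → ℝ)
    {f f' g g' : (Fin n → ℤ) → ℂ} (hf : ∀ k ∈ K, f k = f' k) (hg : ∀ k ∈ K, g k = g' k) :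
    ipK K ρ f g = ipK K ρ f' g' :=
  Finset.sum_congr rfl fun k hk => by rw [hf k hk, hg k hk]

theorem nrmK_congr {n : ℕ} {K : Finset (Fin n → ℤ)} (ρ : (Fin n → ℤ) → ℝ)
    {f f' : (Fin n → ℤ) → ℂ} (hf : ∀ k ∈ K, f k = f' k) :
    nrmK K ρ f = nrmK K ρ f' :=
  Finset.sum_congr rfl fun k hk => by rw [hf k hk]

theorem ipK_sub_right {n : ℕ} (K : Finset (Fin n → ℤ)) (ρ : (Fin n → ℤ) → ℝ)
    (f g g' : (Fin n → ℤ) → ℂ) :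
    ipK K ρ f (fun k => g k - g' k) = ipK K ρ f g - ipK K ρ f g' := by
  unfold ipK
  rw [← Finset.sum_sub_distrib]
  exact Finset.sum_congr rfl fun k _ => by rw [mul_sub, Complex.sub_re]; ring

theorem ipK_add_right {n : ℕ} (K : Finset (Fin n → ℤ)) (ρ : (Fin n → ℤ) → ℝ)
    (f g g' : (Fin n → ℤ) → ℂ) :
    ipK K ρ f (fun k => g k + g' k) = ipK K ρ f g + ipK K ρ f g' := by
  unfold ipK
  rw [← Finset.sum_add_distrib]
  exact Finset.sum_congr rfl fun k _ => by rw [mul_add, Complex.add_re]; ring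

theorem ipK_neg_right {n : ℕ} (K : Finset (Fin n → ℤ)) (ρ : (Fin n → ℤ) → ℝ)
    (f g : (Fin n → ℤ) → ℂ) :
    ipK K ρ f (fun k => - g k) = - ipK K ρ f g := by
  unfold ipK
  rw [← Finset.sum_neg_distrib]
  exact Finset.sum_congr rfl fun k _ => by rw [mul_neg, Complex.neg_re]; ring

theorem ipK_sum_right {n : ℕ} (K : Finset (Fin n → ℤ)) (ρ : (Fin n → ℤ) → ℝ)
    {ι : Type*} (s : Finset ι) (f : (Fin n → ℤ) → ℂ) (g : ι → (Fin n → ℤ) → ℂ) :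
    ipK K ρ f (fun k => ∑ i ∈ s, g i k) = ∑ i ∈ s, ipK K ρ f (g i) := by
  unfold ipK
  rw [Finset.sum_comm]
  exact Finset.sum_congr rfl fun k _ => by rw [Finset.mul_sum, Complex.re_sum, Finset.mul_sum]

theorem ipK_skew {n : ℕ} (K : Finset (Fin n → ℤ)) (ρ : (Fin n → ℤ) → ℝ)
    (f g : (Fin n → ℤ) → ℂ) (c : (Fin n → ℤ) → ℝ) :
    ipK K ρ f (fun k => (c k * Complex.I) * g k) = - ipK K ρ (fun k => (c k * Complex.I) * f k) g := by
  unfold ipK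
  rw [← Finset.sum_neg_distrib]
  refine Finset.sum_congr rfl fun k _ => ?_
  simp only [Complex.mul_re, Complex.mul_im, Complex.conj_re, Complex.conj_im, map_mul,
    Complex.ofReal_re, Complex.ofReal_im, Complex.I_re, Complex.I_im, Complex.conj_ofReal, Complex.conj_I, Complex.neg_re, Complex.neg_im]
  ring

/-- finite shifted sums are bounded by the bound of all finite sums -/
theorem sum_shift_le {n : ℕ} {a : (Fin n → ℤ) → ℝ} {S : ℝ}
    (ha : ∀ s : Finset (Fin n → ℤ), ∑ m ∈ s, a m ≤ S) (K : Finset (Fin n → ℤ)) (k : Fin n → ℤ) :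
    ∑ l ∈ K, a (k - l) ≤ S := by
  have := ha (K.image fun l => k - l)
  rwa [Finset.sum_image (by intro x _ y _ h; simpa using h)] at this

theorem sum_shift_le' {n : ℕ} {a : (Fin n → ℤ) → ℝ} {S : ℝ}
    (ha : ∀ s : Finset (Fin n → ℤ), ∑ m ∈ s, a m ≤ S) (K : Finset (Fin n → ℤ)) (l : Fin n → ℤ) :
    ∑ k ∈ K, a (k - l) ≤ S := by
  have := ha (K.image fun k => k - l)
  rwa [Finset.sum_image (by intro x _ y _ h; simpa using h)] at this

theorem schur_bilin {n : ℕ} {a : (Fin n → ℤ) → ℝ} {S : ℝ} (h0 : ∀ m, 0 ≤ a m)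
    (ha : ∀ s : Finset (Fin n → ℤ), ∑ m ∈ s, a m ≤ S) (K : Finset (Fin n → ℤ))
    (F G : (Fin n → ℤ) → ℝ) :
    ∑ k ∈ K, ∑ l ∈ K, a (k - l) * (F l * G k)
      ≤ S / 2 * (∑ l ∈ K, F l ^ 2 + ∑ k ∈ K, G k ^ 2) := by
  calc _ ≤ ∑ k ∈ K, ∑ l ∈ K, (a (k - l) * F l ^ 2 / 2 + a (k - l) * G k ^ 2 / 2) := by
        refine Finset.sum_le_sum fun k _ => Finset.sum_le_sum fun l _ => ?_
        nlinarith [h0 (k - l), sq_nonneg (F l - G k), mul_nonneg (h0 (k - l)) (sq_nonneg (F l - G k))]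
    _ = ∑ l ∈ K, (∑ k ∈ K, a (k - l)) * (F l ^ 2 / 2)
        + ∑ k ∈ K, (∑ l ∈ K, a (k - l)) * (G k ^ 2 / 2) := by
        simp only [Finset.sum_add_distrib, Finset.sum_mul]
        congr 1
        · rw [Finset.sum_comm]
          exact Finset.sum_congr rfl fun _ _ => Finset.sum_congr rfl fun _ _ => by ring
        · exact Finset.sum_congr rfl fun _ _ => Finset.sum_congr rfl fun _ _ => by ring
    _ ≤ ∑ l ∈ K, S * (F l ^ 2 / 2) + ∑ k ∈ K, S * (G k ^ 2 / 2) := by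
        gcongr with l _ k _
        · exact sum_shift_le' ha K l
        · exact sum_shift_le ha K k
    _ = _ := by
        rw [← Finset.mul_sum, ← Finset.mul_sum, ← Finset.sum_div, ← Finset.sum_div]; ring

theorem schur_norm {n : ℕ} {a : (Fin n → ℤ) → ℝ} {S : ℝ} (h0 : ∀ m, 0 ≤ a m)
    (ha : ∀ s : Finset (Fin n → ℤ), ∑ m ∈ s, a m ≤ S) (K : Finset (Fin n → ℤ))
    (F : (Fin n → ℤ) → ℝ) :
    ∑ k ∈ K, (∑ l ∈ K, a (k - l) * F l) ^ 2 ≤ S ^ 2 * ∑ l ∈ K, F l ^ 2 := by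
  have hS : 0 ≤ S := by simpa using ha ∅
  have key : ∀ k, (∑ l ∈ K, a (k - l) * F l) ^ 2 ≤ S * ∑ l ∈ K, a (k - l) * F l ^ 2 := by
    intro k
    calc _ ≤ (∑ l ∈ K, a (k - l)) * ∑ l ∈ K, a (k - l) * F l ^ 2 := by
          apply Finset.sum_sq_le_sum_mul_sum_of_sq_eq_mul
          · intro l _; exact h0 _
          · intro l _; exact mul_nonneg (h0 _) (sq_nonneg _)
          · intro l _; ring
      _ ≤ _ := by
          gcongr
          · exact Finset.sum_nonneg fun l _ => mul_nonneg (h0 _) (sq_nonneg _)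
          · exact sum_shift_le ha K k
  calc _ ≤ ∑ k ∈ K, S * ∑ l ∈ K, a (k - l) * F l ^ 2 := Finset.sum_le_sum fun k _ => key k
    _ = S * ∑ l ∈ K, (∑ k ∈ K, a (k - l)) * F l ^ 2 := by
        rw [← Finset.mul_sum, Finset.sum_comm]
        simp only [Finset.sum_mul]
    _ ≤ S * ∑ l ∈ K, S * F l ^ 2 := by
        gcongr with l _
        exact sum_shift_le' ha K l
    _ = _ := by rw [← Finset.mul_sum]; ring

theorem convK_norm {n : ℕ} {b : (Fin n → ℤ) → ℂ} {ρ τ : (Fin n → ℤ) → ℝ} {S : ℝ}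
    (hρ : ∀ k, 0 < ρ k) (hρτ : ∀ k l, ρ k ≤ τ (k - l) * ρ l) (hτ : ∀ m, 1 ≤ τ m)
    (ha : ∀ s : Finset (Fin n → ℤ), ∑ m ∈ s, ‖b m‖ * τ m ≤ S) (K : Finset (Fin n → ℤ))
    (f : (Fin n → ℤ) → ℂ) : nrmK K ρ (convK K b f) ≤ S ^ 2 * nrmK K ρ f := by
  have h0 : ∀ m, 0 ≤ ‖b m‖ * τ m := fun m => mul_nonneg (norm_nonneg _) (by linarith [hτ m])
  have := schur_norm h0 ha K (fun l => ρ l * ‖f l‖)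
  unfold nrmK
  simp only [mul_pow] at this
  refine le_trans (Finset.sum_le_sum fun k _ => ?_) this
  rw [← mul_pow]
  apply pow_le_pow_left₀ (by have := hρ k; positivity)
  unfold convK
  calc ρ k * ‖∑ l ∈ K, b (k - l) * f l‖ ≤ ρ k * ∑ l ∈ K, ‖b (k - l)‖ * ‖f l‖ := by
        apply mul_le_mul_of_nonneg_left _ (hρ k).le
        refine (norm_sum_le _ _).trans (le_of_eq (Finset.sum_congr rfl fun l _ => norm_mul _ _))
    _ ≤ _ := by
        rw [Finset.mul_sum]
        refine Finset.sum_le_sum fun l _ => ?_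
        have := mul_le_mul_of_nonneg_right (hρτ k l) (by positivity : 0 ≤ ‖b (k - l)‖ * ‖f l‖)
        linarith

theorem weight_diff {r t T : ℝ} (hr : 0 < r) (ht : 0 < t) (hT : 1 ≤ T) (h1 : r ≤ T * t)
    (h2 : t ≤ T * r) : |r ^ 2 - t ^ 2| ≤ 2 * (T - 1) * (r * t) := by
  rw [abs_le]
  constructor <;> nlinarith [mul_pos hr ht, mul_le_mul_of_nonneg_left h1 hr.le, mul_le_mul_of_nonneg_left h2 ht.le, mul_le_mul_of_nonneg_left h1 ht.le, mul_le_mul_of_nonneg_left h2 hr.le,mul_nonneg hr.le (sub_nonneg.2 h1), mul_nonneg ht.le (sub_nonneg.2 h2), mul_nonneg ht.le (sub_nonneg.2 h1), mul_nonneg hr.le (sub_nonneg.2 h2)]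

theorem convK_symm {n : ℕ} {b : (Fin n → ℤ) → ℂ} {ρ τ : (Fin n → ℤ) → ℝ} {η : ℝ}
    (hb : ∀ m, b (-m) = starRingEnd ℂ (b m))
    (hρ : ∀ k, 0 < ρ k) (hρτ : ∀ k l, ρ k ≤ τ (k - l) * ρ l) (hτ : ∀ m, 1 ≤ τ m)
    (hτn : ∀ m, τ (-m) = τ m)
    (ha : ∀ s : Finset (Fin n → ℤ), ∑ m ∈ s, ‖b m‖ * (τ m - 1) ≤ η) (K : Finset (Fin n → ℤ))
    (f g : (Fin n → ℤ) → ℂ) :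
    |ipK K ρ (convK K b f) g - ipK K ρ f (convK K b g)| ≤ η * (nrmK K ρ f + nrmK K ρ g) := by
  have e1 : ipK K ρ (convK K b f) g
      = ∑ k ∈ K, ∑ l ∈ K, ρ k ^ 2 * (starRingEnd ℂ (b (k - l) * f l) * g k).re := by
    unfold ipK convK
    refine Finset.sum_congr rfl fun k _ => ?_
    rw [map_sum, Finset.sum_mul, Complex.re_sum, Finset.mul_sum]
  have e2 : ipK K ρ f (convK K b g)
      = ∑ k ∈ K, ∑ l ∈ K, ρ l ^ 2 * (starRingEnd ℂ (b (k - l) * f l) * g k).re := by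
    unfold ipK convK
    rw [Finset.sum_comm]
    refine Finset.sum_congr rfl fun k _ => ?_
    rw [Finset.mul_sum, Complex.re_sum, Finset.mul_sum]
    refine Finset.sum_congr rfl fun l _ => ?_
    rw [map_mul, ← hb (l - k)]
    congr 2
    rw [neg_sub]; ring
  rw [e1, e2, ← Finset.sum_sub_distrib]
  simp only [← Finset.sum_sub_distrib, ← sub_mul]
  have h0 : ∀ m, 0 ≤ ‖b m‖ * (τ m - 1) := fun m => mul_nonneg (norm_nonneg _) (by linarith [hτ m])
  have := schur_bilin h0 ha K (fun l => ρ l * ‖f l‖) (fun k => ρ k * ‖g k‖)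
  simp only [mul_pow] at this
  have h3 : ∑ k ∈ K, ∑ l ∈ K, |(ρ k ^ 2 - ρ l ^ 2) * (starRingEnd ℂ (b (k - l) * f l) * g k).re|
      ≤ ∑ k ∈ K, ∑ l ∈ K, 2 * (‖b (k - l)‖ * (τ (k - l) - 1) * (ρ l * ‖f l‖ * (ρ k * ‖g k‖))) := by
    refine Finset.sum_le_sum fun k _ => Finset.sum_le_sum fun l _ => ?_
    rw [abs_mul]
    have h4 := weight_diff (hρ k) (hρ l) (hτ (k - l)) (hρτ k l)
      (by have := hρτ l k; rwa [← neg_sub, hτn] at this)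
    have h5 := re_conj_mul_le (b (k - l) * f l) (g k)
    rw [norm_mul] at h5
    calc _ ≤ (2 * (τ (k - l) - 1) * (ρ k * ρ l)) * (‖b (k - l)‖ * ‖f l‖ * ‖g k‖) :=
          mul_le_mul h4 h5 (abs_nonneg _) ((abs_nonneg _).trans h4)
      _ = _ := by ring
  calc _ ≤ ∑ k ∈ K, ∑ l ∈ K, |(ρ k ^ 2 - ρ l ^ 2) * (starRingEnd ℂ (b (k - l) * f l) * g k).re| := by
        refine (Finset.abs_sum_le_sum_abs _ _).trans (Finset.sum_le_sum fun k _ => ?_)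
        exact Finset.abs_sum_le_sum_abs _ _
    _ ≤ _ := h3
    _ = 2 * ∑ k ∈ K, ∑ l ∈ K, (‖b (k - l)‖ * (τ (k - l) - 1) * (ρ l * ‖f l‖ * (ρ k * ‖g k‖))) := by
        simp only [Finset.mul_sum]
    _ ≤ 2 * (η / 2 * (nrmK K ρ f + nrmK K ρ g)) := by
        unfold nrmK
        gcongr
    _ = _ := by ring

theorem nrmK_sub_le {n : ℕ} (K : Finset (Fin n → ℤ)) (ρ : (Fin n → ℤ) → ℝ)
    (f g : (Fin n → ℤ) → ℂ) :
    nrmK K ρ (fun k => f k - g k) ≤ 2 * (nrmK K ρ f + nrmK K ρ g) := by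
  unfold nrmK
  rw [← Finset.sum_add_distrib, Finset.mul_sum]
  refine Finset.sum_le_sum fun k _ => ?_
  have h1 := norm_sub_le (f k) (g k)
  have h2 : ‖f k - g k‖ ^ 2 ≤ 2 * (‖f k‖ ^ 2 + ‖g k‖ ^ 2) := by
    have := pow_le_pow_left₀ (norm_nonneg _) h1 2
    nlinarith [sq_nonneg (‖f k‖ - ‖g k‖)]
  nlinarith [mul_le_mul_of_nonneg_left h2 (sq_nonneg (ρ k))]

theorem nrmK_add_le {n : ℕ} (K : Finset (Fin n → ℤ)) (ρ : (Fin n → ℤ) → ℝ)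
    (f g : (Fin n → ℤ) → ℂ) :
    nrmK K ρ (fun k => f k + g k) ≤ 2 * (nrmK K ρ f + nrmK K ρ g) := by
  have := nrmK_sub_le K ρ f (fun k => - g k)
  simpa [nrmK] using this

theorem nrmK_sum_le {n : ℕ} (K : Finset (Fin n → ℤ)) (ρ : (Fin n → ℤ) → ℝ)
    {ι : Type*} [Fintype ι] (f : ι → (Fin n → ℤ) → ℂ) :
    nrmK K ρ (fun k => ∑ i, f i k) ≤ Fintype.card ι * ∑ i, nrmK K ρ (f i) := by
  unfold nrmK
  rw [Finset.sum_comm, Finset.mul_sum]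
  refine Finset.sum_le_sum fun k _ => ?_
  have h1 : ‖∑ i, f i k‖ ^ 2 ≤ Fintype.card ι * ∑ i, ‖f i k‖ ^ 2 := by
    calc _ ≤ (∑ i, ‖f i k‖) ^ 2 := pow_le_pow_left₀ (norm_nonneg _) (norm_sum_le _ _) 2
      _ ≤ _ := by simpa using sq_sum_le_card_mul_sum_sq (s := Finset.univ) (f := fun i => ‖f i k‖)
  rw [← Finset.mul_sum]
  nlinarith [mul_le_mul_of_nonneg_left h1 (sq_nonneg (ρ k))]



/-! ### Static energy relations -/

def cP {n : ℕ} (i : Fin n) (k : Fin n → ℤ) : ℝ := 2 * Real.pi * (k i : ℝ)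

def opP {n : ℕ} (i : Fin n) (f : (Fin n → ℤ) → ℂ) (k : Fin n → ℤ) : ℂ :=
  ((cP i k : ℝ) * Complex.I) * f k

structure GalW {n : ℕ} (b : Fin n → (Fin n → ℤ) → ℂ) (ρ τ : (Fin n → ℤ) → ℝ) (A η : ℝ) : Prop where
  hb : ∀ i m, b i (-m) = starRingEnd ℂ (b i m)
  hρ : ∀ k, 0 < ρ k
  hρτ : ∀ k l, ρ k ≤ τ (k - l) * ρ l
  hτ : ∀ m, 1 ≤ τ m
  hτn : ∀ m, τ (-m) = τ m
  hA : ∀ i, ∀ s : Finset (Fin n → ℤ), ∑ m ∈ s, ‖b i m‖ * τ m ≤ A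
  hη : ∀ i, ∀ s : Finset (Fin n → ℤ), ∑ m ∈ s, ‖b i m‖ * (τ m - 1) ≤ η
  hη0 : 0 ≤ η
  hη1 : η ≤ 1 / 8
  hη2 : n * η ≤ 1 / 8

structure GalPt {n : ℕ} (K : Finset (Fin n → ℤ)) (b : Fin n → (Fin n → ℤ) → ℂ)
    (v w q q1 : (Fin n → ℤ) → ℂ) (d : Fin n → (Fin n → ℤ) → ℂ) : Prop where
  ed : ∀ i, ∀ k ∈ K, d i k = opP i v k - convK K (b i) w k
  eq : ∀ k ∈ K, q k = w k - ∑ i, convK K (b i) (d i) k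
  eq1 : ∀ k ∈ K, q1 k = - ∑ i, opP i (d i) k

def EnK {n : ℕ} (K : Finset (Fin n → ℤ)) (ρ : (Fin n → ℤ) → ℝ) (w : (Fin n → ℤ) → ℂ)
    (d : Fin n → (Fin n → ℤ) → ℂ) : ℝ := nrmK K ρ w + ∑ i, nrmK K ρ (d i)

theorem EnK_nonneg {n : ℕ} (K : Finset (Fin n → ℤ)) (ρ : (Fin n → ℤ) → ℝ) (w : (Fin n → ℤ) → ℂ)
    (d : Fin n → (Fin n → ℤ) → ℂ) : 0 ≤ EnK K ρ w d :=
  add_nonneg (nrmK_nonneg _ _ _) (Finset.sum_nonneg fun _ _ => nrmK_nonneg _ _ _)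

section
variable {n : ℕ} {K : Finset (Fin n → ℤ)} {b : Fin n → (Fin n → ℤ) → ℂ}
    {v w q q1 : (Fin n → ℤ) → ℂ} {d : Fin n → (Fin n → ℤ) → ℂ} {ρ τ : (Fin n → ℤ) → ℝ} {A η : ℝ}

theorem GalPt.err (hW : GalW b ρ τ A η) (K : Finset (Fin n → ℤ)) (w : (Fin n → ℤ) → ℂ)
    (d : Fin n → (Fin n → ℤ) → ℂ) :
    |∑ i, (ipK K ρ (convK K (b i) w) (d i) - ipK K ρ w (convK K (b i) (d i)))|
      ≤ 1 / 8 * EnK K ρ w d := by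
  have h1 : ∀ i, |ipK K ρ (convK K (b i) w) (d i) - ipK K ρ w (convK K (b i) (d i))|
      ≤ η * (nrmK K ρ w + nrmK K ρ (d i)) := fun i =>
    convK_symm (hW.hb i) hW.hρ hW.hρτ hW.hτ hW.hτn (hW.hη i) K w (d i)
  calc _ ≤ ∑ i, η * (nrmK K ρ w + nrmK K ρ (d i)) :=
        (Finset.abs_sum_le_sum_abs _ _).trans (Finset.sum_le_sum fun i _ => h1 i)
    _ = (n * η) * nrmK K ρ w + η * ∑ i, nrmK K ρ (d i) := by
        rw [← Finset.mul_sum, Finset.sum_add_distrib]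
        simp
        ring
    _ ≤ 1 / 8 * nrmK K ρ w + 1 / 8 * ∑ i, nrmK K ρ (d i) := by
        have h2 := nrmK_nonneg K ρ w
        have h3 : 0 ≤ ∑ i, nrmK K ρ (d i) := Finset.sum_nonneg fun _ _ => nrmK_nonneg _ _ _
        have := hW.hη1
        have := hW.hη2
        gcongr
    _ = _ := by unfold EnK; ring

theorem GalPt.wq (hG : GalPt K b v w q q1 d) (ρ : (Fin n → ℤ) → ℝ) (f : (Fin n → ℤ) → ℂ) :
    ipK K ρ f q = ipK K ρ f w - ∑ i, ipK K ρ f (convK K (b i) (d i)) := by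
  rw [ipK_congr ρ (fun _ _ => rfl) hG.eq, ipK_sub_right, ipK_sum_right]

theorem GalPt.vq1 (hG : GalPt K b v w q q1 d) (ρ : (Fin n → ℤ) → ℝ) (f : (Fin n → ℤ) → ℂ) :
    ipK K ρ f q1 = ∑ i, ipK K ρ (opP i f) (d i) := by
  rw [ipK_congr ρ (fun _ _ => rfl) hG.eq1, ipK_neg_right, ipK_sum_right, ← Finset.sum_neg_distrib]
  refine Finset.sum_congr rfl fun i _ => ?_
  have := ipK_skew K ρ f (d i) (cP i)
  unfold opP
  rw [this, neg_neg]

theorem GalPt.pv (hG : GalPt K b v w q q1 d) (ρ : (Fin n → ℤ) → ℝ) (f : (Fin n → ℤ) → ℂ)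
    (i : Fin n) :
    ipK K ρ f (d i) = ipK K ρ f (opP i v) - ipK K ρ f (convK K (b i) w) := by
  rw [ipK_congr ρ (fun _ _ => rfl) (hG.ed i), ipK_sub_right]

theorem GalPt.energy (hG : GalPt K b v w q q1 d) (hW : GalW b ρ τ A η) :
    7 / 8 * EnK K ρ w d ≤ ipK K ρ w q + ipK K ρ v q1 := by
  have h := GalPt.err hW K w d
  rw [hG.wq, hG.vq1, ipK_self]
  have e : ∀ i, ipK K ρ (opP i v) (d i) = nrmK K ρ (d i) + ipK K ρ (convK K (b i) w) (d i) := by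
    intro i
    have := hG.pv ρ (d i) i
    rw [ipK_self] at this
    rw [ipK_comm K ρ (opP i v), ipK_comm K ρ (convK K (b i) w)]
    linarith
  simp only [e]
  rw [Finset.sum_add_distrib]
  rw [Finset.sum_sub_distrib] at h
  have := (abs_le.1 h).1
  have e2 : EnK K ρ w d = nrmK K ρ w + ∑ i, nrmK K ρ (d i) := rfl
  linarith

theorem GalPt.elliptic (hG : GalPt K b v w q q1 d) (hW : GalW b ρ τ A η) :
    EnK K ρ w d ≤ 2 * (nrmK K ρ q + ∑ i, nrmK K ρ (opP i v)) := by
  have h := GalPt.err hW K w d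
  have h1 := hG.wq ρ w
  rw [ipK_self] at h1
  have h2 : ∀ i, nrmK K ρ (d i) = ipK K ρ (d i) (opP i v) - ipK K ρ (convK K (b i) w) (d i) := by
    intro i
    have := hG.pv ρ (d i) i
    rw [ipK_self] at this
    rw [this, ipK_comm K ρ (convK K (b i) w)]
  have h3 := (abs_le.1 (ipK_le K ρ w q (r := 1 / 4) (by norm_num))).2
  have h4 : ∑ i, ipK K ρ (d i) (opP i v) ≤ ∑ i, (1 / 4 * nrmK K ρ (d i) + nrmK K ρ (opP i v)) := by
    refine Finset.sum_le_sum fun i _ => ?_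
    have := (abs_le.1 (ipK_le K ρ (d i) (opP i v) (r := 1 / 4) (by norm_num))).2
    norm_num at this ⊢
    exact this
  rw [Finset.sum_add_distrib, ← Finset.mul_sum] at h4
  have h5 : ∑ i, nrmK K ρ (d i) = ∑ i, ipK K ρ (d i) (opP i v)
      - ∑ i, ipK K ρ (convK K (b i) w) (d i) := by
    rw [← Finset.sum_sub_distrib]; exact Finset.sum_congr rfl fun i _ => h2 i
  rw [Finset.sum_sub_distrib] at h
  have h6 := (abs_le.1 h).1
  have e2 : EnK K ρ w d = nrmK K ρ w + ∑ i, nrmK K ρ (d i) := rfl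
  norm_num at h3
  have h7 := EnK_nonneg K ρ w d
  have h8 := nrmK_nonneg K ρ q
  have h9 : 0 ≤ ∑ i, nrmK K ρ (opP i v) := Finset.sum_nonneg fun _ _ => nrmK_nonneg _ _ _
  linarith

theorem GalW.conv (hW : GalW b ρ τ A η) (K : Finset (Fin n → ℤ)) (f : (Fin n → ℤ) → ℂ) (i : Fin n) :
    nrmK K ρ (convK K (b i) f) ≤ A ^ 2 * nrmK K ρ f :=
  convK_norm hW.hρ hW.hρτ hW.hτ (hW.hA i) K f

theorem GalPt.q_le (hG : GalPt K b v w q q1 d) (hW : GalW b ρ τ A η) :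
    nrmK K ρ q ≤ 2 * (1 + n * A ^ 2) * EnK K ρ w d := by
  rw [nrmK_congr ρ hG.eq]
  have h1 := nrmK_sub_le K ρ w (fun k => ∑ i, convK K (b i) (d i) k)
  have h2 := nrmK_sum_le K ρ (fun i => convK K (b i) (d i))
  have h3 : ∑ i, nrmK K ρ (convK K (b i) (d i)) ≤ A ^ 2 * ∑ i, nrmK K ρ (d i) := by
    rw [Finset.mul_sum]
    exact Finset.sum_le_sum fun i _ => hW.conv K (d i) i
  rw [Fintype.card_fin] at h2
  have h4 := mul_le_mul_of_nonneg_left h3 (Nat.cast_nonneg (α := ℝ) n)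
  have e2 : EnK K ρ w d = nrmK K ρ w + ∑ i, nrmK K ρ (d i) := rfl
  have h5 := nrmK_nonneg K ρ w
  have h6 : 0 ≤ ∑ i, nrmK K ρ (d i) := Finset.sum_nonneg fun _ _ => nrmK_nonneg _ _ _
  have h7 : 0 ≤ (n : ℝ) * A ^ 2 := by positivity
  rw [e2]
  nlinarith [mul_nonneg h7 h5]

theorem GalPt.Pv_le (hG : GalPt K b v w q q1 d) (hW : GalW b ρ τ A η) :
    ∑ i, nrmK K ρ (opP i v) ≤ 2 * (1 + n * A ^ 2) * EnK K ρ w d := by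
  have h1 : ∀ i, nrmK K ρ (opP i v) ≤ 2 * (nrmK K ρ (d i) + A ^ 2 * nrmK K ρ w) := by
    intro i
    have e : nrmK K ρ (opP i v) = nrmK K ρ (fun k => d i k + convK K (b i) w k) :=
      nrmK_congr ρ fun k hk => by rw [hG.ed i k hk]; ring
    rw [e]
    refine (nrmK_add_le K ρ _ _).trans ?_
    have := hW.conv K w i
    linarith
  calc _ ≤ ∑ i, 2 * (nrmK K ρ (d i) + A ^ 2 * nrmK K ρ w) := Finset.sum_le_sum fun i _ => h1 i
    _ = 2 * (∑ i, nrmK K ρ (d i) + n * A ^ 2 * nrmK K ρ w) := by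
        rw [← Finset.mul_sum, Finset.sum_add_distrib]; simp; ring
    _ ≤ _ := by
        have e2 : EnK K ρ w d = nrmK K ρ w + ∑ i, nrmK K ρ (d i) := rfl
        have h5 := nrmK_nonneg K ρ w
        have h6 : 0 ≤ ∑ i, nrmK K ρ (d i) := Finset.sum_nonneg fun _ _ => nrmK_nonneg _ _ _
        have h7 : 0 ≤ (n : ℝ) * A ^ 2 := by positivity
        rw [e2]
        nlinarith [mul_nonneg h7 h6]

theorem norm_sq_le_opP (v : (Fin n → ℤ) → ℂ) (k : Fin n → ℤ) (hk : k ≠ 0) :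
    ‖v k‖ ^ 2 ≤ ∑ i, ‖opP i v k‖ ^ 2 := by
  obtain ⟨i, hi⟩ : ∃ i, k i ≠ 0 := by
    by_contra hc
    push Not at hc
    exact hk (funext hc)
  have h1 : ‖opP i v k‖ ^ 2 ≤ ∑ i, ‖opP i v k‖ ^ 2 :=
    Finset.single_le_sum (f := fun i => ‖opP i v k‖ ^ 2) (fun _ _ => sq_nonneg _) (Finset.mem_univ i)
  refine le_trans ?_ h1
  apply pow_le_pow_left₀ (norm_nonneg _)
  unfold opP cP
  rw [norm_mul, norm_mul, Complex.norm_I, mul_one, Complex.norm_real, Real.norm_eq_abs, abs_mul]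
  have h2 : (1:ℝ) ≤ |(k i : ℝ)| := by
    have := Int.one_le_abs hi
    exact_mod_cast this
  have h3 : (1:ℝ) ≤ |2 * Real.pi| := by
    rw [abs_of_pos (by positivity)]; linarith [Real.pi_gt_three]
  have : 1 ≤ |2 * Real.pi| * |(k i : ℝ)| := by nlinarith
  nlinarith [norm_nonneg (v k)]

theorem GalPt.vq_le (hG : GalPt K b v w q q1 d) (hW : GalW b ρ τ A η)
    (hq0 : (0 : Fin n → ℤ) ∈ K → q 0 = 0) :
    |ipK K ρ v q| ≤ 2 * (1 + n * A ^ 2) * EnK K ρ w d := by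
  have h1 : |ipK K ρ v q| ≤ 1 / 2 * (∑ i, nrmK K ρ (opP i v) + nrmK K ρ q) := by
    unfold ipK nrmK
    rw [Finset.sum_comm, ← Finset.sum_add_distrib, Finset.mul_sum]
    refine (Finset.abs_sum_le_sum_abs _ _).trans (Finset.sum_le_sum fun k hk => ?_)
    rw [abs_mul, abs_of_nonneg (sq_nonneg (ρ k)), ← Finset.mul_sum]
    have h2 := re_conj_mul_le (v k) (q k)
    have h3 : ‖v k‖ * ‖q k‖ ≤ 1 / 2 * (∑ i, ‖opP i v k‖ ^ 2 + ‖q k‖ ^ 2) := by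
      by_cases hk0 : k = 0
      · subst hk0
        rw [hq0 hk]
        simp
        positivity
      · have := norm_sq_le_opP v k hk0
        nlinarith [sq_nonneg (‖v k‖ - ‖q k‖)]
    nlinarith [mul_le_mul_of_nonneg_left (h2.trans h3) (sq_nonneg (ρ k))]
  have := hG.q_le hW
  have := hG.Pv_le hW
  linarith

theorem GalPt.psi_le (hG : GalPt K b v w q q1 d) (hW : GalW b ρ τ A η) (ψ : (Fin n → ℤ) → ℂ)
    {c : ℝ} (hc : 0 < c) :
    c * (|ipK K ρ ψ q| + |ipK K ρ ψ q1|) ≤ 1 / 8 * EnK K ρ w d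
      + (8 * (1 + n * A ^ 2) * nrmK K ρ ψ + 4 * ∑ i, nrmK K ρ (opP i ψ)) * c ^ 2 := by
  set C := 2 * (1 + n * A ^ 2) with hC
  have hC0 : 0 < C := by positivity
  have h1 := ipK_le K ρ ψ q (r := 4 * C * c) (by positivity)
  have h2 := hG.q_le hW
  have h3 : c * |ipK K ρ ψ q| ≤ 4 * C * nrmK K ρ ψ * c ^ 2 + 1 / 16 * EnK K ρ w d := by
    have h4 := mul_le_mul_of_nonneg_left h1 hc.le
    have h5 : c * (1 / (4 * (4 * C * c)) * nrmK K ρ q) ≤ 1 / 16 * EnK K ρ w d := by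
      have : c * (1 / (4 * (4 * C * c)) * nrmK K ρ q) = (1 / (16 * C)) * nrmK K ρ q := by
        field_simp; ring
      rw [this]
      calc _ ≤ (1 / (16 * C)) * (C * EnK K ρ w d) := by gcongr
        _ = _ := by field_simp
    nlinarith
  have h6 : c * |ipK K ρ ψ q1| ≤ 4 * (∑ i, nrmK K ρ (opP i ψ)) * c ^ 2
      + 1 / 16 * EnK K ρ w d := by
    rw [hG.vq1]
    have h7 : |∑ i, ipK K ρ (opP i ψ) (d i)| ≤
        ∑ i, (4 * c * nrmK K ρ (opP i ψ) + 1 / (4 * (4 * c)) * nrmK K ρ (d i)) :=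
      (Finset.abs_sum_le_sum_abs _ _).trans (Finset.sum_le_sum fun i _ =>
        ipK_le K ρ _ _ (by positivity))
    rw [Finset.sum_add_distrib, ← Finset.mul_sum, ← Finset.mul_sum] at h7
    have h8 := mul_le_mul_of_nonneg_left h7 hc.le
    have h9 : c * (1 / (4 * (4 * c)) * ∑ i, nrmK K ρ (d i)) ≤ 1 / 16 * EnK K ρ w d := by
      have : c * (1 / (4 * (4 * c)) * ∑ i, nrmK K ρ (d i)) = 1 / 16 * ∑ i, nrmK K ρ (d i) := by
        field_simp; ring
      rw [this]
      have := nrmK_nonneg K ρ w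
      unfold EnK
      linarith
    nlinarith
  nlinarith

end

/-! ### Scalar lemmas -/

theorem hasDerivAt_expw (δ z : ℝ) :
    HasDerivAt (fun z => Real.exp (-2 * δ * z)) (-2 * δ * Real.exp (-2 * δ * z)) z := by
  have : HasDerivAt (fun z => -2 * δ * z) (-2 * δ) z := by
    simpa using (hasDerivAt_id z).const_mul (-2 * δ)
  have h2 := this.exp
  rwa [mul_comm (Real.exp _)] at h2

theorem scalarA {R δ β : ℝ} (hR : 0 < R) (hδ : 0 < δ) (hδ1 : δ ≤ 1 / 2) (hβ : 0 ≤ β)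
    {a a' b b' e : ℝ → ℝ} (ha : ∀ z, HasDerivAt a (a' z) z) (hb : ∀ z, HasDerivAt b (b' z) z)
    (he : Continuous e) 
    (h1 : ∀ z, 7 / 8 * e z ≤ a' z) (h2 : ∀ z, 2 * δ * |a z| ≤ 1 / 8 * e z)
    (h3 : ∀ z, ∀ c > 0, c * (|b z| + |b' z|) ≤ 1 / 8 * e z + β * c ^ 2)
    (hab : a 0 = b 0) (haR : a (-R) = 0) (hbR : b (-R) = 0) :
    ∫ z in (-R)..0, Real.exp (-2 * δ * z) * e z ≤ 2 * β := by
  set I : ℝ → ℝ := fun z => ∫ u in (-R)..z, Real.exp (-2 * δ * u) * e u with hI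
  have hcont : Continuous fun u => Real.exp (-2 * δ * u) * e u := by fun_prop
  have hId : ∀ z, HasDerivAt I (Real.exp (-2 * δ * z) * e z) z := fun z =>
    intervalIntegral.integral_hasDerivAt_right (hcont.intervalIntegrable _ _)
      (hcont.stronglyMeasurableAtFilter _ _) hcont.continuousAt
  set H : ℝ → ℝ := fun z => Real.exp (-2 * δ * z) * (a z - Real.exp z * b z) - 1 / 2 * I z
    + β * Real.exp z with hH
  have hHd : ∀ z, HasDerivAt H (-2 * δ * Real.exp (-2 * δ * z) * (a z - Real.exp z * b z)
      + Real.exp (-2 * δ * z) * (a' z - (Real.exp z * b z + Real.exp z * b' z))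
      - 1 / 2 * (Real.exp (-2 * δ * z) * e z) + β * Real.exp z) z := fun z =>
    (((hasDerivAt_expw δ z).mul ((ha z).sub ((Real.hasDerivAt_exp z).mul (hb z)))).sub
      ((hId z).const_mul (1 / 2))).add ((Real.hasDerivAt_exp z).const_mul β)
  have he0 : ∀ z, 0 ≤ e z := by
    intro z
    have := h2 z
    have : 0 ≤ 2 * δ * |a z| := by positivity
    linarith
  have hmono : MonotoneOn H (Set.Icc (-R) 0) := by
    apply monotoneOn_of_deriv_nonneg (convex_Icc _ _)
    · exact fun z _ => (hHd z).continuousAt.continuousWithinAt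
    · exact fun z _ => (hHd z).differentiableAt.differentiableWithinAt
    · intro z hz
      rw [interior_Icc] at hz
      rw [(hHd z).deriv]
      set X := Real.exp (-2 * δ * z) with hX
      set Y := Real.exp z with hY
      have hX0 : 0 < X := Real.exp_pos _
      have hY0 : 0 < Y := Real.exp_pos _
      have hXY : X * Y ^ 2 ≤ Y := by
        have : X * Y ^ 2 = Real.exp (-2 * δ * z + (z + z)) := by
          rw [Real.exp_add, Real.exp_add, hX, hY]; ring
        rw [this, hY]
        apply Real.exp_le_exp.2
        nlinarith [hz.2]
      have g1 := h1 z
      have g2 := h2 z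
      have g3 := h3 z Y hY0
      have g4 : 2 * δ * a z ≤ 1 / 8 * e z := by
        refine le_trans ?_ g2
        have := le_abs_self (a z)
        gcongr
      have g5 : (1 - 2 * δ) * b z + b' z ≤ |b z| + |b' z| := by
        have i1 := le_abs_self (b z)
        have i2 := le_abs_self (b' z)
        have i3 := abs_nonneg (b z)
        have : (1 - 2 * δ) * b z ≤ (1 - 2 * δ) * |b z| := by
          apply mul_le_mul_of_nonneg_left i1; linarith
        nlinarith
      have g6 : Y * ((1 - 2 * δ) * b z + b' z) ≤ 1 / 8 * e z + β * Y ^ 2 :=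
        (mul_le_mul_of_nonneg_left g5 hY0.le).trans g3
      have g7 : 0 ≤ X * (a' z - 2 * δ * a z - Y * ((1 - 2 * δ) * b z + b' z) - 1 / 2 * e z
          + β * Y ^ 2) := by
        apply mul_nonneg hX0.le
        have := he0 z
        linarith
      have g8 := mul_le_mul_of_nonneg_left hXY hβ
      nlinarith
  have hle := hmono (Set.left_mem_Icc.2 (by linarith)) (Set.right_mem_Icc.2 (by linarith))
    (by linarith : -R ≤ 0)
  simp only [hH, haR, hbR, hab, hI, intervalIntegral.integral_same] at hle
  simp only [sub_zero, mul_zero, zero_sub, Real.exp_zero, mul_one, one_mul, sub_self, zero_add, neg_zero] at hle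
  have : 0 < Real.exp (-R) := Real.exp_pos _
  nlinarith [mul_nonneg hβ this.le]

theorem scalarLeft {R δ : ℝ} (hR : 0 < R) (hδ : 0 < δ) {f f' e : ℝ → ℝ}
    (hf : ∀ z, HasDerivAt f (f' z) z) (he : Continuous e) (hf0 : ∀ z, 0 ≤ f z)
    (hfe : ∀ z, f' z ≤ e z) (he0 : ∀ z, 0 ≤ e z) (hfR : f (-R) = 0) {z : ℝ}
    (hz : z ∈ Set.Icc (-R) 0) :
    Real.exp (-2 * δ * z) * f z ≤ ∫ z in (-R)..0, Real.exp (-2 * δ * z) * e z := by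
  set I : ℝ → ℝ := fun z => ∫ u in (-R)..z, Real.exp (-2 * δ * u) * e u with hI
  have hcont : Continuous fun u => Real.exp (-2 * δ * u) * e u := by fun_prop
  have hId : ∀ z, HasDerivAt I (Real.exp (-2 * δ * z) * e z) z := fun z =>
    intervalIntegral.integral_hasDerivAt_right (hcont.intervalIntegrable _ _)
      (hcont.stronglyMeasurableAtFilter _ _) hcont.continuousAt
  have hHd : ∀ z, HasDerivAt (fun z => I z - Real.exp (-2 * δ * z) * f z)
      (Real.exp (-2 * δ * z) * e z - (-2 * δ * Real.exp (-2 * δ * z) * f z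
        + Real.exp (-2 * δ * z) * f' z)) z := fun z =>
    (hId z).sub ((hasDerivAt_expw δ z).mul (hf z))
  have hmono : Monotone (fun z => I z - Real.exp (-2 * δ * z) * f z) := by
    apply monotone_of_deriv_nonneg
    · exact fun z => (hHd z).differentiableAt
    · intro z
      rw [(hHd z).deriv]
      have hX0 : 0 < Real.exp (-2 * δ * z) := Real.exp_pos _
      have := mul_le_mul_of_nonneg_left (hfe z) hX0.le
      have : 0 ≤ δ * (Real.exp (-2 * δ * z) * f z) :=
        mul_nonneg hδ.le (mul_nonneg hX0.le (hf0 z))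
      nlinarith
  have h1 := hmono hz.1
  simp only [hI, hfR, intervalIntegral.integral_same, mul_zero, sub_zero] at h1
  have h2 : I z ≤ I 0 := by
    have : Monotone I := by
      apply monotone_of_deriv_nonneg
      · exact fun z => (hId z).differentiableAt
      · intro z
        rw [(hId z).deriv]
        exact mul_nonneg (Real.exp_pos _).le (he0 z)
    exact this hz.2
  simp only [hI] at h2
  linarith

theorem scalarRight {R δ : ℝ} (hR : 0 < R) {f f' e : ℝ → ℝ}
    (hf : ∀ z, HasDerivAt f (f' z) z) (he : Continuous e)
    (hfe : ∀ z, 2 * δ * f z - f' z ≤ e z) (he0 : ∀ z, 0 ≤ e z) {z : ℝ}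
    (hz : z ∈ Set.Icc (-R) 0) :
    Real.exp (-2 * δ * z) * f z ≤ f 0 + ∫ z in (-R)..0, Real.exp (-2 * δ * z) * e z := by
  set I : ℝ → ℝ := fun z => ∫ u in (-R)..z, Real.exp (-2 * δ * u) * e u with hI
  have hcont : Continuous fun u => Real.exp (-2 * δ * u) * e u := by fun_prop
  have hId : ∀ z, HasDerivAt I (Real.exp (-2 * δ * z) * e z) z := fun z =>
    intervalIntegral.integral_hasDerivAt_right (hcont.intervalIntegrable _ _)
      (hcont.stronglyMeasurableAtFilter _ _) hcont.continuousAt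
  have hHd : ∀ z, HasDerivAt (fun z => I z + Real.exp (-2 * δ * z) * f z)
      (Real.exp (-2 * δ * z) * e z + (-2 * δ * Real.exp (-2 * δ * z) * f z
        + Real.exp (-2 * δ * z) * f' z)) z := fun z =>
    (hId z).add ((hasDerivAt_expw δ z).mul (hf z))
  have hmono : Monotone (fun z => I z + Real.exp (-2 * δ * z) * f z) := by
    apply monotone_of_deriv_nonneg
    · exact fun z => (hHd z).differentiableAt
    · intro z
      rw [(hHd z).deriv]
      have hX0 : 0 < Real.exp (-2 * δ * z) := Real.exp_pos _
      have := mul_le_mul_of_nonneg_left (hfe z) hX0.le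
      nlinarith
  have h1 := hmono hz.2
  have h2 : I (-R) ≤ I z := by
    have : Monotone I := by
      apply monotone_of_deriv_nonneg
      · exact fun z => (hId z).differentiableAt
      · intro z
        rw [(hId z).deriv]
        exact mul_nonneg (Real.exp_pos _).le (he0 z)
    exact this hz.1
  simp only [hI, intervalIntegral.integral_same] at h2 h1
  simp only [mul_zero, Real.exp_zero, one_mul] at h1
  linarith



/-! ### Rapid decay -/

def om {n : ℕ} (k : Fin n → ℤ) : ℝ := 1 + nk k

theorem om_one_le {n : ℕ} (k : Fin n → ℤ) : 1 ≤ om k := by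
  unfold om; linarith [nk_nonneg k]

theorem om_pos {n : ℕ} (k : Fin n → ℤ) : 0 < om k := by linarith [om_one_le k]

def Rapid {n : ℕ} (f : (Fin n → ℤ) → ℂ) : Prop :=
  ∀ s : ℕ, ∃ C : ℝ, 0 ≤ C ∧ ∀ k, om k ^ s * ‖f k‖ ≤ C

theorem int_sum_bound : ∃ S : ℝ, 0 ≤ S ∧ ∀ s : Finset ℤ, ∑ m ∈ s, ((1 + |(m:ℝ)|) ^ 2)⁻¹ ≤ S := by
  have h1 : Summable (fun m : ℤ => 1 / (m:ℝ) ^ 2) := Real.summable_one_div_int_pow.2 (by norm_num)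
  have h2 : Summable (fun m : ℤ => if m = 0 then (1:ℝ) else 0) :=
    summable_of_ne_finset_zero (s := {0}) (by intro b hb; simp at hb; simp [hb])
  have h3 := h1.add h2
  have hnn : ∀ m : ℤ, 0 ≤ 1 / (m:ℝ) ^ 2 + (if m = 0 then (1:ℝ) else 0) := by
    intro m
    have : (0:ℝ) ≤ if m = 0 then (1:ℝ) else 0 := by split_ifs <;> norm_num
    positivity
  refine ⟨_, tsum_nonneg hnn, fun s => le_trans (Finset.sum_le_sum fun m _ => ?_)
    (h3.sum_le_tsum s fun m _ => hnn m)⟩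
  by_cases hm : m = 0
  · simp [hm]
  · simp only [hm, if_false, add_zero, one_div]
    have : 0 < (m:ℝ) ^ 2 := by positivity
    apply inv_anti₀ this
    rw [← sq_abs (m:ℝ)]
    exact pow_le_pow_left₀ (abs_nonneg _) (by linarith) 2

theorem om_sum_bound (n : ℕ) : ∃ S : ℝ, 0 ≤ S ∧ ∀ s : Finset (Fin n → ℤ),
    ∑ k ∈ s, (om k ^ (2 * n))⁻¹ ≤ S := by
  obtain ⟨S, hS0, hS⟩ := int_sum_bound
  refine ⟨S ^ n, by positivity, fun s => ?_⟩
  have h1 : ∀ k : Fin n → ℤ, (om k ^ (2 * n))⁻¹ ≤ ∏ i, ((1 + |(k i:ℝ)|) ^ 2)⁻¹ := by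
    intro k
    rw [Finset.prod_inv_distrib]
    apply inv_anti₀
    · exact Finset.prod_pos fun i _ => by positivity
    · calc ∏ i, (1 + |(k i:ℝ)|) ^ 2 ≤ ∏ _i : Fin n, (om k) ^ 2 := by
            apply Finset.prod_le_prod
            · intro i _; positivity
            · intro i _
              apply pow_le_pow_left₀ (by positivity)
              unfold om
              linarith [abs_le_nk k i]
        _ = _ := by simp [pow_mul]
  calc _ ≤ ∑ k ∈ s, ∏ i, ((1 + |(k i:ℝ)|) ^ 2)⁻¹ := Finset.sum_le_sum fun k _ => h1 k
    _ ≤ ∑ k ∈ Fintype.piFinset (fun i => (s.image fun k => k i : Finset ℤ)), ∏ i, ((1 + |(k i:ℝ)|) ^ 2)⁻¹ := by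
        apply Finset.sum_le_sum_of_subset_of_nonneg
        · intro k hk
          rw [Fintype.mem_piFinset]
          intro i
          exact Finset.mem_image_of_mem _ hk
        · intro k _ _
          exact Finset.prod_nonneg fun i _ => by positivity
    _ = ∏ i, ∑ m ∈ (s.image (fun k => k i) : Finset ℤ), ((1 + |(m:ℝ)|) ^ 2)⁻¹ :=
        (Finset.prod_univ_sum (fun i => (s.image fun k => k i : Finset ℤ))
          (fun _ (m : ℤ) => ((1 + |(m:ℝ)|) ^ 2)⁻¹)).symm
    _ ≤ ∏ _i : Fin n, S := by
        apply Finset.prod_le_prod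
        · intro i _; exact Finset.sum_nonneg fun _ _ => by positivity
        · intro i _; exact hS _
    _ = _ := by simp

theorem Rapid.sum {n : ℕ} {f : (Fin n → ℤ) → ℂ} (hf : Rapid f) (s : ℕ) :
    ∃ C : ℝ, 0 ≤ C ∧ ∀ K : Finset (Fin n → ℤ), ∑ k ∈ K, ‖f k‖ * om k ^ s ≤ C := by
  obtain ⟨S, hS0, hS⟩ := om_sum_bound n
  obtain ⟨C, hC0, hC⟩ := hf (s + 2 * n)
  refine ⟨C * S, by positivity, fun K => ?_⟩
  calc _ ≤ ∑ k ∈ K, C * (om k ^ (2 * n))⁻¹ := by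
        refine Finset.sum_le_sum fun k _ => ?_
        have := hC k
        have hp : 0 < om k ^ (2 * n) := pow_pos (om_pos k) _
        rw [pow_add] at this
        rw [← div_eq_mul_inv, le_div_iff₀ hp]
        linarith
    _ ≤ _ := by
        rw [← Finset.mul_sum]
        exact mul_le_mul_of_nonneg_left (hS K) hC0

theorem Rapid.nrm {n : ℕ} {f : (Fin n → ℤ) → ℂ} (hf : Rapid f) (s : ℕ) :
    ∃ C : ℝ, 0 ≤ C ∧ ∀ K : Finset (Fin n → ℤ), nrmK K (fun k => om k ^ s) f ≤ C := by
  obtain ⟨C, hC0, hC⟩ := hf.sum s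
  obtain ⟨D, hD0, hD⟩ := hf s
  refine ⟨D * C, by positivity, fun K => ?_⟩
  unfold nrmK
  calc _ ≤ ∑ k ∈ K, D * (‖f k‖ * om k ^ s) := by
        refine Finset.sum_le_sum fun k _ => ?_
        have h2 : 0 ≤ ‖f k‖ * om k ^ s := mul_nonneg (norm_nonneg _) (pow_pos (om_pos k) _).le
        have := mul_le_mul_of_nonneg_right (hD k) h2
        calc _ = om k ^ s * ‖f k‖ * (‖f k‖ * om k ^ s) := by ring
          _ ≤ _ := this
    _ ≤ _ := by
        rw [← Finset.mul_sum]
        exact mul_le_mul_of_nonneg_left (hC K) hD0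

def rho {n : ℕ} (ε : ℝ) (s : ℕ) (k : Fin n → ℤ) : ℝ := (1 + ε * nk k) ^ s

theorem one_add_pow_aux {ε t : ℝ} (h0 : 0 ≤ ε) (h1 : ε ≤ 1) (ht : 0 ≤ t) (s : ℕ) :
    (1 + ε * t) ^ s - 1 ≤ ε * ((1 + t) ^ s - 1) := by
  induction s with
  | zero => simp
  | succ s ih =>
    have hX : 0 ≤ (1 + t) ^ s - 1 := by
      have := one_le_pow₀ (by linarith : 1 ≤ 1 + t) (n := s)
      linarith
    have h2 : (1 + ε * t) ^ (s + 1) ≤ (1 + ε * t) * (1 + ε * ((1 + t) ^ s - 1)) := by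
      rw [pow_succ, mul_comm]
      apply mul_le_mul_of_nonneg_left _ (by positivity)
      linarith
    have h3 : ε * ε * (t * ((1 + t) ^ s - 1)) ≤ ε * (t * ((1 + t) ^ s - 1)) := by
      apply mul_le_mul_of_nonneg_right _ (by positivity)
      nlinarith
    rw [pow_succ (1 + t)]
    nlinarith

theorem exists_GalW {n : ℕ} {b : Fin n → (Fin n → ℤ) → ℂ}
    (hb : ∀ i m, b i (-m) = starRingEnd ℂ (b i m)) (hr : ∀ i, Rapid (b i)) :
    ∃ A : ℝ, 0 ≤ A ∧ ∀ s : ℕ, ∃ ε : ℝ, 0 < ε ∧ ε ≤ 1 ∧ ∃ η, GalW b (rho ε s) (rho ε s) A η := by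
  have hB : ∀ s : ℕ, ∃ C : ℝ, 0 ≤ C ∧ ∀ i, ∀ K : Finset (Fin n → ℤ),
      ∑ k ∈ K, ‖b i k‖ * om k ^ s ≤ C := by
    intro s
    choose C hC0 hC using fun i => (hr i).sum s
    refine ⟨∑ i, C i, Finset.sum_nonneg fun i _ => hC0 i, fun i K => (hC i K).trans ?_⟩
    exact Finset.single_le_sum (fun i _ => hC0 i) (Finset.mem_univ i)
  obtain ⟨B0, hB00, hB0⟩ := hB 0
  refine ⟨B0 + 1, by linarith, fun s => ?_⟩
  obtain ⟨B, hBp, hBs⟩ := hB s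
  set ε := 1 / (1 + 8 * (n + 1) * B) with hε
  have hden : 1 ≤ 1 + 8 * (n + 1) * B := by
    have : 0 ≤ 8 * ((n:ℝ) + 1) * B := by positivity
    linarith
  have hε0 : 0 < ε := by positivity
  have hε1 : ε ≤ 1 := by
    rw [hε, div_le_one (by linarith)]; exact hden
  have hεB : (n + 1) * (ε * B) ≤ 1 / 8 := by
    rw [hε]
    have : ((n:ℝ) + 1) * (1 / (1 + 8 * (n + 1) * B) * B) = ((n + 1) * B) / (1 + 8 * (n + 1) * B) := by
      ring
    rw [this, div_le_iff₀ (by linarith)]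
    nlinarith
  have hη0 : 0 ≤ ε * B := by positivity
  have hηs : ∀ i, ∀ K : Finset (Fin n → ℤ), ∑ m ∈ K, ‖b i m‖ * (rho ε s m - 1) ≤ ε * B := by
    intro i K
    calc _ ≤ ∑ m ∈ K, ε * (‖b i m‖ * om m ^ s) := by
          refine Finset.sum_le_sum fun m _ => ?_
          have := one_add_pow_aux hε0.le hε1 (nk_nonneg m) s
          unfold rho om
          have h3 := mul_le_mul_of_nonneg_left this (norm_nonneg (b i m))
          have h4 : 0 ≤ ε * ‖b i m‖ := by positivity
          nlinarith
      _ ≤ _ := by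
          rw [← Finset.mul_sum]
          exact mul_le_mul_of_nonneg_left (hBs i K) hε0.le
  have hbase : ∀ k : Fin n → ℤ, 1 ≤ 1 + ε * nk k := fun k => by
    have := mul_nonneg hε0.le (nk_nonneg k); linarith
  have hn0 : (0:ℝ) ≤ n := Nat.cast_nonneg n
  refine ⟨ε, hε0, hε1, ε * B, hb, ?_, ?_, ?_, ?_, ?_, hηs, hη0, by nlinarith, by nlinarith⟩
  · intro k
    exact pow_pos (by linarith [hbase k]) _
  · intro k l
    unfold rho
    rw [← mul_pow]
    apply pow_le_pow_left₀ (by linarith [hbase k])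
    have h1 : nk k ≤ nk (k - l) + nk l := by
      have := nk_add_le (k - l) l
      simpa using this
    have h2 : ε * nk k ≤ ε * (nk (k - l) + nk l) := mul_le_mul_of_nonneg_left h1 hε0.le
    have h3 : 0 ≤ (ε * nk (k - l)) * (ε * nk l) :=
      mul_nonneg (mul_nonneg hε0.le (nk_nonneg _)) (mul_nonneg hε0.le (nk_nonneg _))
    nlinarith
  · intro m
    exact one_le_pow₀ (hbase m)
  · intro m
    unfold rho
    rw [nk_neg]
  · intro i K
    have h1 := hηs i K
    have h2 := hB0 i K
    simp only [pow_zero, mul_one] at h2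
    simp only [mul_sub, mul_one, Finset.sum_sub_distrib] at h1
    nlinarith

theorem nrmK_mono {n : ℕ} (K : Finset (Fin n → ℤ)) {ρ ρ' : (Fin n → ℤ) → ℝ} {W : ℝ}
    (h : ∀ k, ρ k ^ 2 ≤ W * ρ' k ^ 2) (f : (Fin n → ℤ) → ℂ) :
    nrmK K ρ f ≤ W * nrmK K ρ' f := by
  unfold nrmK
  rw [Finset.mul_sum]
  refine Finset.sum_le_sum fun k _ => ?_
  rw [← mul_assoc]
  exact mul_le_mul_of_nonneg_right (h k) (sq_nonneg _)

theorem rho_le_om {n : ℕ} {ε : ℝ} (h0 : 0 < ε) (h1 : ε ≤ 1) (s : ℕ) (k : Fin n → ℤ) :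
    rho ε s k ^ 2 ≤ 1 * (om k ^ s) ^ 2 := by
  rw [one_mul]
  unfold rho om
  have := nk_nonneg k
  have h3 : ε * nk k ≤ nk k := by nlinarith
  have h4 : 0 ≤ 1 + ε * nk k := by positivity
  gcongr

theorem om_le_rho {n : ℕ} {ε : ℝ} (h0 : 0 < ε) (h1 : ε ≤ 1) (s : ℕ) (k : Fin n → ℤ) :
    (om k ^ s) ^ 2 ≤ ((ε⁻¹) ^ s) ^ 2 * rho ε s k ^ 2 := by
  unfold rho om
  rw [← mul_pow, ← mul_pow]
  have := nk_nonneg k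
  have h3 : 1 ≤ ε⁻¹ := (one_le_inv₀ h0).2 h1
  have h4 : 1 + nk k ≤ ε⁻¹ * (1 + ε * nk k) := by
    have : ε⁻¹ * (1 + ε * nk k) = ε⁻¹ + nk k := by field_simp
    rw [this]
    linarith
  gcongr

theorem opP_norm_le {n : ℕ} (i : Fin n) (f : (Fin n → ℤ) → ℂ) (k : Fin n → ℤ) :
    ‖opP i f k‖ ≤ 2 * Real.pi * om k * ‖f k‖ := by
  unfold opP cP
  rw [norm_mul, norm_mul, Complex.norm_I, mul_one, Complex.norm_real, Real.norm_eq_abs, abs_mul,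
    abs_of_pos Real.two_pi_pos]
  have : |(k i : ℝ)| ≤ om k := by
    unfold om; linarith [abs_le_nk k i]
  gcongr

theorem Rapid.opP {n : ℕ} {f : (Fin n → ℤ) → ℂ} (hf : Rapid f) (i : Fin n) :
    Rapid (opP i f) := by
  intro s
  obtain ⟨C, hC0, hC⟩ := hf (s + 1)
  refine ⟨2 * Real.pi * C, by positivity, fun k => ?_⟩
  have h1 := opP_norm_le i f k
  have h2 := mul_le_mul_of_nonneg_left h1 (pow_pos (om_pos k) s).le
  have h3 := mul_le_mul_of_nonneg_left (hC k) Real.two_pi_pos.le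
  rw [pow_succ] at h3
  nlinarith

theorem nrmK_opP_le {n : ℕ} (K : Finset (Fin n → ℤ)) (s : ℕ) (i : Fin n) (f : (Fin n → ℤ) → ℂ) :
    nrmK K (fun k => om k ^ s) (opP i f)
      ≤ (2 * Real.pi) ^ 2 * nrmK K (fun k => om k ^ (s + 1)) f := by
  unfold nrmK
  rw [Finset.mul_sum]
  refine Finset.sum_le_sum fun k _ => ?_
  have h1 := pow_le_pow_left₀ (norm_nonneg _) (opP_norm_le i f k) 2
  have h2 := mul_le_mul_of_nonneg_left h1 (sq_nonneg (om k ^ s))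
  calc _ ≤ _ := h2
    _ = _ := by rw [pow_succ]; ring

theorem om_pow_mono {n : ℕ} (K : Finset (Fin n → ℤ)) (s : ℕ) (f : (Fin n → ℤ) → ℂ) :
    nrmK K (fun k => om k ^ s) f ≤ nrmK K (fun k => om k ^ (s + 1)) f := by
  have := nrmK_mono K (ρ := fun k => om k ^ s) (ρ' := fun k => om k ^ (s + 1)) (W := 1) ?_ f
  · simpa using this
  · intro k
    rw [one_mul]
    have h1 := om_one_le k
    have : om k ^ s ≤ om k ^ (s + 1) := pow_le_pow_right₀ h1 (Nat.le_succ s)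
    have h2 : 0 ≤ om k ^ s := (pow_pos (om_pos k) s).le
    exact pow_le_pow_left₀ h2 this 2



/-! ### Galerkin solutions: uniform bounds -/

structure IsGal {n : ℕ} (K : Finset (Fin n → ℤ)) (R : ℝ) (b : Fin n → (Fin n → ℤ) → ℂ)
    (ψ : (Fin n → ℤ) → ℂ) (v q : ℕ → ℝ → (Fin n → ℤ) → ℂ)
    (d : Fin n → ℕ → ℝ → (Fin n → ℤ) → ℂ) : Prop where
  hv : ∀ j k z, HasDerivAt (fun z => v j z k) (v (j + 1) z k) z
  hq : ∀ j k z, HasDerivAt (fun z => q j z k) (q (j + 1) z k) z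
  hd : ∀ i j k z, HasDerivAt (fun z => d i j z k) (d i (j + 1) z k) z
  pt : ∀ j z, GalPt K b (v j z) (v (j + 1) z) (q j z) (q (j + 1) z) (fun i => d i j z)
  bv : ∀ k ∈ K, v 0 0 k = ψ k
  bq : ∀ k ∈ K, q 0 (-R) k = 0

theorem ipK_hasDerivAt {n : ℕ} (K : Finset (Fin n → ℤ)) (ρ : (Fin n → ℤ) → ℝ)
    {f g f' g' : ℝ → (Fin n → ℤ) → ℂ} (z : ℝ)
    (hf : ∀ k, HasDerivAt (fun z => f z k) (f' z k) z)
    (hg : ∀ k, HasDerivAt (fun z => g z k) (g' z k) z) :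
    HasDerivAt (fun z => ipK K ρ (f z) (g z)) (ipK K ρ (f' z) (g z) + ipK K ρ (f z) (g' z)) z := by
  have hre : ∀ {F : ℝ → ℂ} {F' : ℂ}, HasDerivAt F F' z → HasDerivAt (fun z => (F z).re) F'.re z :=
    fun h => (Complex.reCLM.hasFDerivAt.comp_hasDerivAt z h)
  have him : ∀ {F : ℝ → ℂ} {F' : ℂ}, HasDerivAt F F' z → HasDerivAt (fun z => (F z).im) F'.im z :=
    fun h => (Complex.imCLM.hasFDerivAt.comp_hasDerivAt z h)
  unfold ipK
  rw [← Finset.sum_add_distrib]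
  apply HasDerivAt.fun_sum
  intro k _
  have h1 := (((hre (hf k)).mul (hre (hg k))).add ((him (hf k)).mul (him (hg k)))).const_mul (ρ k ^ 2)
  have e : (fun z => ρ k ^ 2 * ((starRingEnd ℂ) (f z k) * g z k).re)
      = fun z => ρ k ^ 2 * ((f z k).re * (g z k).re + (f z k).im * (g z k).im) := by
    funext z
    simp [Complex.mul_re]
  rw [e]
  refine HasDerivAt.congr_deriv h1 ?_
  simp [Complex.mul_re]
  ring

theorem nrmK_hasDerivAt {n : ℕ} (K : Finset (Fin n → ℤ)) (ρ : (Fin n → ℤ) → ℝ)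
    {f f' : ℝ → (Fin n → ℤ) → ℂ} (z : ℝ)
    (hf : ∀ k, HasDerivAt (fun z => f z k) (f' z k) z) :
    HasDerivAt (fun z => nrmK K ρ (f z)) (2 * ipK K ρ (f z) (f' z)) z := by
  have h := ipK_hasDerivAt K ρ z hf hf
  simp only [ipK_self] at h
  convert h using 1
  rw [ipK_comm K ρ (f' z)]; ring

theorem nrmK_continuous {n : ℕ} (K : Finset (Fin n → ℤ)) (ρ : (Fin n → ℤ) → ℝ)
    {f f' : ℝ → (Fin n → ℤ) → ℂ} 
    (hf : ∀ z k, HasDerivAt (fun z => f z k) (f' z k) z) :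
    Continuous (fun z => nrmK K ρ (f z)) :=
  continuous_iff_continuousAt.2 fun z => (nrmK_hasDerivAt K ρ z (hf z)).continuousAt

section
variable {n : ℕ} {K : Finset (Fin n → ℤ)} {R : ℝ} {b : Fin n → (Fin n → ℤ) → ℂ}
    {ψ : (Fin n → ℤ) → ℂ} {v q : ℕ → ℝ → (Fin n → ℤ) → ℂ}
    {d : Fin n → ℕ → ℝ → (Fin n → ℤ) → ℂ} {ρ τ : (Fin n → ℤ) → ℝ} {A η : ℝ}

theorem IsGal.q0 (hG : IsGal K R b ψ v q d) (h0 : (0 : Fin n → ℤ) ∈ K) (z : ℝ) : q 0 z 0 = 0 := by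
  have h1 : ∀ z, q 1 z 0 = 0 := by
    intro z
    have := (hG.pt 0 z).eq1 0 h0
    rw [this]
    simp [opP, cP]
  have h2 := is_const_of_deriv_eq_zero (f := fun z => q 0 z 0)
    (fun z => (hG.hq 0 0 z).differentiableAt) (fun z => by rw [(hG.hq 0 0 z).deriv]; exact h1 z)
    z (-R)
  rw [h2, hG.bq 0 h0]

theorem IsGal.En_cont (hG : IsGal K R b ψ v q d) (ρ : (Fin n → ℤ) → ℝ) (j : ℕ) :
    Continuous fun z => EnK K ρ (v (j + 1) z) (fun i => d i j z) := by
  unfold EnK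
  apply Continuous.add
  · exact nrmK_continuous K ρ (fun z k => hG.hv (j + 1) k z)
  · exact continuous_finsetSum _ fun i _ => nrmK_continuous K ρ (fun z k => hG.hd i j k z)

theorem IsGal.integral_le (hG : IsGal K R b ψ v q d) (hR : 0 < R) (hW : GalW b ρ τ A η) :
    ∫ z in (-R)..0, Real.exp (-2 * (1 / (32 * (1 + n * A ^ 2))) * z)
        * EnK K ρ (v 1 z) (fun i => d i 0 z)
      ≤ 2 * (8 * (1 + n * A ^ 2) * nrmK K ρ ψ + 4 * ∑ i, nrmK K ρ (opP i ψ)) := by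
  have hA : 1 ≤ 1 + n * A ^ 2 := by
    have : 0 ≤ (n:ℝ) * A ^ 2 := by positivity
    linarith
  refine scalarA hR (by positivity) (δ := 1 / (32 * (1 + n * A ^ 2)))
    (e := fun z => EnK K ρ (v 1 z) (fun i => d i 0 z))
    (a := fun z => ipK K ρ (v 0 z) (q 0 z)) (b := fun z => ipK K ρ ψ (q 0 z))
    (a' := fun z => ipK K ρ (v 1 z) (q 0 z) + ipK K ρ (v 0 z) (q 1 z))
    (b' := fun z => ipK K ρ ψ (q 1 z)) ?_ ?_ ?_ ?_ ?_ ?_ ?_ ?_ ?_ ?_ ?_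
  · rw [div_le_div_iff₀ (by positivity) (by norm_num)]
    linarith
  · have h1 := nrmK_nonneg K ρ ψ
    have h2 : 0 ≤ ∑ i, nrmK K ρ (opP i ψ) := Finset.sum_nonneg fun _ _ => nrmK_nonneg _ _ _
    exact add_nonneg (mul_nonneg (by linarith) h1) (mul_nonneg (by norm_num) h2)
  · exact fun z => ipK_hasDerivAt K ρ (f := v 0) (g := q 0) (f' := v 1) (g' := q 1) z
      (fun k => hG.hv 0 k z) (fun k => hG.hq 0 k z)
  · intro z
    have := ipK_hasDerivAt K ρ (f := fun _ => ψ) (f' := fun _ _ => 0) (g := q 0) (g' := q 1) z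
      (fun k => hasDerivAt_const z (ψ k)) (fun k => hG.hq 0 k z)
    convert this using 1
    simp [ipK]
  · exact hG.En_cont ρ 0
  · exact fun z => (hG.pt 0 z).energy hW
  · intro z
    have h1 := (hG.pt 0 z).vq_le hW (fun h0 => hG.q0 h0 z)
    have h2 : 0 < 1 + n * A ^ 2 := by linarith
    calc 2 * (1 / (32 * (1 + n * A ^ 2))) * |ipK K ρ (v 0 z) (q 0 z)|
        ≤ 2 * (1 / (32 * (1 + n * A ^ 2))) * (2 * (1 + n * A ^ 2)
          * EnK K ρ (v 1 z) (fun i => d i 0 z)) := by gcongr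
      _ = _ := by field_simp; ring
  · exact fun z c hc => (hG.pt 0 z).psi_le hW ψ hc
  · exact ipK_congr ρ hG.bv (fun _ _ => rfl)
  · rw [ipK_congr (g' := fun _ => 0) ρ (fun _ _ => rfl) hG.bq]
    simp [ipK]
  · rw [ipK_congr (g' := fun _ => 0) ρ (fun _ _ => rfl) hG.bq]
    simp [ipK]

theorem EnK_mono (K : Finset (Fin n → ℤ)) {ρ ρ' : (Fin n → ℤ) → ℝ} {W : ℝ}
    (h : ∀ k, ρ k ^ 2 ≤ W * ρ' k ^ 2) (w : (Fin n → ℤ) → ℂ) (d : Fin n → (Fin n → ℤ) → ℂ) :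
    EnK K ρ w d ≤ W * EnK K ρ' w d := by
  unfold EnK
  rw [mul_add, Finset.mul_sum]
  exact add_le_add (nrmK_mono K h w) (Finset.sum_le_sum fun i _ => nrmK_mono K h (d i))

theorem nrmK_opP_sum_le (K : Finset (Fin n → ℤ)) (s : ℕ) (f : Fin n → (Fin n → ℤ) → ℂ) :
    nrmK K (fun k => om k ^ s) (fun k => - ∑ i, opP i (f i) k)
      ≤ n * ((2 * Real.pi) ^ 2 * ∑ i, nrmK K (fun k => om k ^ (s + 1)) (f i)) := by
  have e : nrmK K (fun k => om k ^ s) (fun k => - ∑ i, opP i (f i) k)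
      = nrmK K (fun k => om k ^ s) (fun k => ∑ i, opP i (f i) k) := by
    simp [nrmK]
  rw [e]
  have h := nrmK_sum_le K (fun k => om k ^ s) (fun i => opP i (f i))
  rw [Fintype.card_fin] at h
  refine h.trans (mul_le_mul_of_nonneg_left ?_ (Nat.cast_nonneg n))
  rw [Finset.mul_sum]
  exact Finset.sum_le_sum fun i _ => nrmK_opP_le K s i (f i)

/-- elliptic estimate in polynomial weights -/
theorem elliptic_om (hb : ∀ i m, b i (-m) = starRingEnd ℂ (b i m)) (hr : ∀ i, Rapid (b i)) (s : ℕ) :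
    ∃ C : ℝ, 0 ≤ C ∧ ∀ (K : Finset (Fin n → ℤ)) (v w q q1 : (Fin n → ℤ) → ℂ)
      (d : Fin n → (Fin n → ℤ) → ℂ), GalPt K b v w q q1 d →
      EnK K (fun k => om k ^ s) w d ≤ C * (nrmK K (fun k => om k ^ s) q
        + ∑ i, nrmK K (fun k => om k ^ s) (opP i v)) := by
  obtain ⟨A, hA, hall⟩ := exists_GalW hb hr
  obtain ⟨ε, h0, h1, η, hW⟩ := hall s
  refine ⟨((ε⁻¹) ^ s) ^ 2 * 2, by positivity, fun K v w q q1 d hG => ?_⟩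
  have h2 := EnK_mono K (om_le_rho h0 h1 s) w d
  have h3 := hG.elliptic hW
  have h4 := nrmK_mono K (rho_le_om h0 h1 s) q
  have h5 : ∑ i, nrmK K (rho ε s) (opP i v) ≤ ∑ i, nrmK K (fun k => om k ^ s) (opP i v) :=
    Finset.sum_le_sum fun i _ => by
      have := nrmK_mono K (rho_le_om h0 h1 s) (opP i v)
      rwa [one_mul] at this
  refine h2.trans ?_
  rw [mul_assoc]
  apply mul_le_mul_of_nonneg_left _ (by positivity)
  rw [one_mul] at h4
  linarith

theorem gal_bounds_zero (hb : ∀ i m, b i (-m) = starRingEnd ℂ (b i m)) (hr : ∀ i, Rapid (b i))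
    (hψ : Rapid ψ) :
    ∃ δ : ℝ, 0 < δ ∧ ∀ s : ℕ, ∃ C : ℝ, 0 ≤ C ∧ ∀ (K : Finset (Fin n → ℤ)) (R : ℝ)
      (v q : ℕ → ℝ → (Fin n → ℤ) → ℂ) (d : Fin n → ℕ → ℝ → (Fin n → ℤ) → ℂ), 0 < R →
      IsGal K R b ψ v q d → ∀ z ∈ Set.Icc (-R) 0,
        nrmK K (fun k => om k ^ s) (q 0 z) + ∑ i, nrmK K (fun k => om k ^ s) (opP i (v 0 z))
          ≤ C * Real.exp (2 * δ * z) := by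
  obtain ⟨A, hA, hall⟩ := exists_GalW hb hr
  have hA1 : 1 ≤ 1 + n * A ^ 2 := by
    have : 0 ≤ (n:ℝ) * A ^ 2 := by positivity
    linarith
  set δ := 1 / (32 * (1 + n * A ^ 2)) with hδ
  have hδ0 : 0 < δ := by positivity
  have hδ1 : 2 * δ ≤ 1 := by
    rw [hδ, mul_one_div, div_le_one (by positivity)]
    linarith
  refine ⟨δ, hδ0, fun s => ?_⟩
  obtain ⟨ε, h0, h1, η, hW⟩ := hall (s + 1)
  obtain ⟨Ψ, hΨ0, hΨ⟩ := hψ.nrm (s + 1)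
  choose Ψi hΨi0 hΨi using fun i => (hψ.opP i).nrm (s + 1)
  set W := ((ε⁻¹) ^ (s + 1)) ^ 2 with hWdef
  have hW0 : 0 ≤ W := by positivity
  set C1 := 2 * (1 + n * A ^ 2) with hC1
  have hC10 : 0 ≤ C1 := by positivity
  set π2 := (2 * Real.pi) ^ 2 with hπ2
  have hπ0 : 0 ≤ π2 := by positivity
  set β := 8 * (1 + n * A ^ 2) * Ψ + 4 * ∑ i, Ψi i with hβ
  have hβ0 : 0 ≤ β := by
    have : 0 ≤ ∑ i, Ψi i := Finset.sum_nonneg fun i _ => hΨi0 i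
    positivity
  set D1 := W * C1 + n * (π2 * W) with hD1
  set D2 := 2 * (W * C1) + π2 * W with hD2
  have hD10 : 0 ≤ D1 := by positivity
  have hD20 : 0 ≤ D2 := by positivity
  refine ⟨D1 * (2 * β) + ∑ i, (Ψi i + D2 * (2 * β)), ?_, ?_⟩
  · have : 0 ≤ ∑ i, (Ψi i + D2 * (2 * β)) :=
      Finset.sum_nonneg fun i _ => add_nonneg (hΨi0 i) (by positivity)
    positivity
  intro K R v q d hR hG z hz
  set e : ℝ → ℝ := fun z => EnK K (rho ε (s + 1)) (v 1 z) (fun i => d i 0 z) with he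
  have hec : Continuous e := hG.En_cont _ 0
  have he0 : ∀ z, 0 ≤ e z := fun z => EnK_nonneg _ _ _ _
  have hup : ∀ f : (Fin n → ℤ) → ℂ, nrmK K (fun k => om k ^ (s + 1)) f ≤ W * nrmK K (rho ε (s + 1)) f :=
    fun f => nrmK_mono K (om_le_rho h0 h1 (s + 1)) f
  have hintg : ∫ z in (-R)..0, Real.exp (-2 * δ * z) * e z ≤ 2 * β := by
    refine (hG.integral_le hR hW).trans ?_
    have h2 : nrmK K (rho ε (s + 1)) ψ ≤ Ψ := by
      have := nrmK_mono K (rho_le_om h0 h1 (s + 1)) ψ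
      rw [one_mul] at this
      exact this.trans (hΨ K)
    have h3 : ∑ i, nrmK K (rho ε (s + 1)) (opP i ψ) ≤ ∑ i, Ψi i :=
      Finset.sum_le_sum fun i _ => by
        have := nrmK_mono K (rho_le_om h0 h1 (s + 1)) (opP i ψ)
        rw [one_mul] at this
        exact this.trans (hΨi i K)
    rw [hβ]
    gcongr
  have hintD : ∀ D : ℝ, 0 ≤ D → ∫ z in (-R)..0, Real.exp (-2 * δ * z) * (D * e z) ≤ D * (2 * β) := by
    intro D hD
    have : (fun z => Real.exp (-2 * δ * z) * (D * e z)) = fun z => D * (Real.exp (-2 * δ * z) * e z) := by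
      funext z; ring
    rw [this, intervalIntegral.integral_const_mul]
    exact mul_le_mul_of_nonneg_left hintg hD
  have hde : ∀ z, ∑ i, nrmK K (rho ε (s + 1)) (d i 0 z) ≤ e z := fun z => by
    have := nrmK_nonneg K (rho ε (s + 1)) (v 1 z)
    simp only [he, EnK]; linarith
  have hwe : ∀ z, nrmK K (rho ε (s + 1)) (v 1 z) ≤ e z := fun z => by
    have : 0 ≤ ∑ i, nrmK K (rho ε (s + 1)) (d i 0 z) := Finset.sum_nonneg fun _ _ => nrmK_nonneg _ _ _
    simp only [he, EnK]; linarith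
  have hqe : ∀ z, nrmK K (fun k => om k ^ s) (q 0 z) ≤ W * C1 * e z := by
    intro z
    refine (om_pow_mono K s _).trans ((hup _).trans ?_)
    rw [mul_assoc]
    exact mul_le_mul_of_nonneg_left ((hG.pt 0 z).q_le hW) hW0
  have hPe : ∀ z i, nrmK K (fun k => om k ^ s) (opP i (v 0 z)) ≤ W * C1 * e z := by
    intro z i
    refine (om_pow_mono K s _).trans ((hup _).trans ?_)
    rw [mul_assoc]
    refine mul_le_mul_of_nonneg_left ?_ hW0
    refine le_trans ?_ ((hG.pt 0 z).Pv_le hW)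
    exact Finset.single_le_sum (f := fun i => nrmK K (rho ε (s + 1)) (opP i (v 0 z)))
      (fun _ _ => nrmK_nonneg _ _ _) (Finset.mem_univ i)
  have hq1e : ∀ z, nrmK K (fun k => om k ^ s) (q 1 z) ≤ n * (π2 * W) * e z := by
    intro z
    rw [nrmK_congr _ (hG.pt 0 z).eq1]
    refine (nrmK_opP_sum_le K s _).trans ?_
    rw [mul_assoc, mul_assoc]
    refine mul_le_mul_of_nonneg_left (mul_le_mul_of_nonneg_left ?_ hπ0) (Nat.cast_nonneg n)
    calc _ ≤ ∑ i, W * nrmK K (rho ε (s + 1)) (d i 0 z) := Finset.sum_le_sum fun i _ => hup _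
      _ ≤ _ := by
        rw [← Finset.mul_sum]
        exact mul_le_mul_of_nonneg_left (hde z) hW0
  have hPw : ∀ z i, nrmK K (fun k => om k ^ s) (opP i (v 1 z)) ≤ π2 * W * e z := by
    intro z i
    refine (nrmK_opP_le K s i _).trans ?_
    rw [mul_assoc]
    refine mul_le_mul_of_nonneg_left ((hup _).trans ?_) hπ0
    exact mul_le_mul_of_nonneg_left (hwe z) hW0
  have hexp : Real.exp (-2 * δ * z) * Real.exp (2 * δ * z) = 1 := by
    rw [← Real.exp_add]; simp
  have hconv : ∀ {X Y : ℝ}, Real.exp (-2 * δ * z) * X ≤ Y → X ≤ Y * Real.exp (2 * δ * z) := by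
    intro X Y h
    have := mul_le_mul_of_nonneg_right h (Real.exp_pos (2 * δ * z)).le
    calc X = Real.exp (-2 * δ * z) * X * Real.exp (2 * δ * z) := by
          rw [mul_right_comm, hexp, one_mul]
      _ ≤ _ := this
  have hQ : nrmK K (fun k => om k ^ s) (q 0 z) ≤ D1 * (2 * β) * Real.exp (2 * δ * z) := by
    apply hconv
    refine le_trans (scalarLeft hR hδ0 (f := fun z => nrmK K (fun k => om k ^ s) (q 0 z))
      (e := fun z => D1 * e z)
      (fun z => nrmK_hasDerivAt K _ z (fun k => hG.hq 0 k z)) (continuous_const.mul hec)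
      (fun z => nrmK_nonneg _ _ _) ?_ (fun z => mul_nonneg hD10 (he0 z)) ?_ hz) (hintD D1 hD10)
    · intro z
      have h2 := (abs_le.1 (ipK_le K (fun k => om k ^ s) (q 0 z) (q 1 z) (r := 1 / 2) (by norm_num))).2
      have h3 := hqe z
      have h4 := hq1e z
      norm_num at h2
      simp only [zero_add]
      rw [hD1, add_mul]
      linarith
    · have : ∀ k ∈ K, q 0 (-R) k = (fun _ => (0:ℂ)) k := hG.bq
      rw [nrmK_congr _ this]
      simp [nrmK]
  have hP : ∀ i, nrmK K (fun k => om k ^ s) (opP i (v 0 z))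
      ≤ (Ψi i + D2 * (2 * β)) * Real.exp (2 * δ * z) := by
    intro i
    apply hconv
    have hder : ∀ z, HasDerivAt (fun z => nrmK K (fun k => om k ^ s) (opP i (v 0 z)))
        (2 * ipK K (fun k => om k ^ s) (opP i (v 0 z)) (opP i (v 1 z))) z := fun z =>
      nrmK_hasDerivAt K _ (f := fun z => opP i (v 0 z)) (f' := fun z => opP i (v 1 z)) z
        (fun k => (hG.hv 0 k z).const_mul _)
    have h5 := scalarRight hR (δ := δ) (e := fun z => D2 * e z) hder (continuous_const.mul hec) ?_
      (fun z => mul_nonneg hD20 (he0 z)) hz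
    · refine h5.trans (add_le_add ?_ (hintD D2 hD20))
      have : ∀ k ∈ K, opP i (v 0 0) k = opP i ψ k := fun k hk => by
        unfold opP; rw [hG.bv k hk]
      rw [nrmK_congr _ this]
      exact (om_pow_mono K s _).trans (hΨi i K)
    · intro z
      have h2 := (abs_le.1 (ipK_le K (fun k => om k ^ s) (opP i (v 0 z)) (opP i (v 1 z))
        (r := 1 / 2) (by norm_num))).1
      have h3 := hPe z i
      have h4 := hPw z i
      have h6 := nrmK_nonneg K (fun k => om k ^ s) (opP i (v 0 z))
      have h7 : 2 * δ * nrmK K (fun k => om k ^ s) (opP i (v 0 z))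
          ≤ nrmK K (fun k => om k ^ s) (opP i (v 0 z)) := by nlinarith
      norm_num at h2
      rw [hD2, add_mul]
      linarith
  rw [add_mul, Finset.sum_mul]
  exact add_le_add hQ (Finset.sum_le_sum fun i _ => hP i)

theorem gal_bounds (hb : ∀ i m, b i (-m) = starRingEnd ℂ (b i m)) (hr : ∀ i, Rapid (b i))
    (hψ : Rapid ψ) :
    ∃ δ : ℝ, 0 < δ ∧ ∀ j s : ℕ, ∃ C : ℝ, 0 ≤ C ∧ ∀ (K : Finset (Fin n → ℤ)) (R : ℝ)
      (v q : ℕ → ℝ → (Fin n → ℤ) → ℂ) (d : Fin n → ℕ → ℝ → (Fin n → ℤ) → ℂ), 0 < R →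
      IsGal K R b ψ v q d → ∀ z ∈ Set.Icc (-R) 0,
        EnK K (fun k => om k ^ s) (v (j + 1) z) (fun i => d i j z) ≤ C * Real.exp (2 * δ * z) ∧
        nrmK K (fun k => om k ^ s) (q j z) ≤ C * Real.exp (2 * δ * z) := by
  obtain ⟨δ, hδ, h0⟩ := gal_bounds_zero hb hr hψ
  refine ⟨δ, hδ, ?_⟩
  have key : ∀ j s : ℕ, ∃ C : ℝ, 0 ≤ C ∧ ∀ (K : Finset (Fin n → ℤ)) (R : ℝ)
      (v q : ℕ → ℝ → (Fin n → ℤ) → ℂ) (d : Fin n → ℕ → ℝ → (Fin n → ℤ) → ℂ), 0 < R →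
      IsGal K R b ψ v q d → ∀ z ∈ Set.Icc (-R) 0,
        nrmK K (fun k => om k ^ s) (q j z) + ∑ i, nrmK K (fun k => om k ^ s) (opP i (v j z))
          ≤ C * Real.exp (2 * δ * z) := by
    intro j
    induction j with
    | zero => exact h0
    | succ j ih =>
      intro s
      obtain ⟨C, hC0, hC⟩ := ih (s + 1)
      obtain ⟨D, hD0, hD⟩ := elliptic_om hb hr (s + 1)
      refine ⟨2 * (n * ((2 * Real.pi) ^ 2 * (D * C))), by positivity, ?_⟩
      intro K R v q d hR hG z hz
      have h1 := hD K _ _ _ _ _ (hG.pt j z)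
      have h2 := mul_le_mul_of_nonneg_left (hC K R v q d hR hG z hz) hD0
      have h3 := h1.trans h2
      have h4 : nrmK K (fun k => om k ^ (s + 1)) (v (j + 1) z)
          ≤ EnK K (fun k => om k ^ (s + 1)) (v (j + 1) z) (fun i => d i j z) := by
        have : 0 ≤ ∑ i, nrmK K (fun k => om k ^ (s + 1)) (d i j z) :=
          Finset.sum_nonneg fun _ _ => nrmK_nonneg _ _ _
        unfold EnK; linarith
      have h5 : ∑ i, nrmK K (fun k => om k ^ (s + 1)) (d i j z)
          ≤ EnK K (fun k => om k ^ (s + 1)) (v (j + 1) z) (fun i => d i j z) := by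
        have := nrmK_nonneg K (fun k => om k ^ (s + 1)) (v (j + 1) z)
        unfold EnK; linarith
      have h6 : nrmK K (fun k => om k ^ s) (q (j + 1) z)
          ≤ n * ((2 * Real.pi) ^ 2 * (D * (C * Real.exp (2 * δ * z)))) := by
        rw [nrmK_congr _ (hG.pt j z).eq1]
        refine (nrmK_opP_sum_le K s _).trans ?_
        exact mul_le_mul_of_nonneg_left (mul_le_mul_of_nonneg_left (h5.trans h3) (by positivity))
          (Nat.cast_nonneg n)
      have h7 : ∑ i, nrmK K (fun k => om k ^ s) (opP i (v (j + 1) z))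
          ≤ n * ((2 * Real.pi) ^ 2 * (D * (C * Real.exp (2 * δ * z)))) := by
        calc _ ≤ ∑ _i : Fin n, ((2 * Real.pi) ^ 2 * (D * (C * Real.exp (2 * δ * z)))) := by
              refine Finset.sum_le_sum fun i _ => (nrmK_opP_le K s i _).trans ?_
              exact mul_le_mul_of_nonneg_left (h4.trans h3) (by positivity)
          _ = _ := by simp
      calc _ ≤ _ := add_le_add h6 h7
        _ = _ := by ring
  intro j s
  obtain ⟨C, hC0, hC⟩ := key j s
  obtain ⟨D, hD0, hD⟩ := elliptic_om hb hr s
  refine ⟨D * C + C, by positivity, fun K R v q d hR hG z hz => ?_⟩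
  have h1 := hC K R v q d hR hG z hz
  have h2 := (hD K _ _ _ _ _ (hG.pt j z)).trans (mul_le_mul_of_nonneg_left h1 hD0)
  have hE := Real.exp_pos (2 * δ * z)
  have h3 : 0 ≤ ∑ i, nrmK K (fun k => om k ^ s) (opP i (v j z)) :=
    Finset.sum_nonneg fun _ _ => nrmK_nonneg _ _ _
  have h4 : 0 ≤ C * Real.exp (2 * δ * z) := by positivity
  have h5 : 0 ≤ D * C * Real.exp (2 * δ * z) := by positivity
  constructor
  · rw [add_mul]; linarith
  · rw [add_mul]; linarith

end



/-! ### Galerkin solutions: existence -/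

section
variable {n : ℕ} (K : Finset (Fin n → ℤ)) (b : Fin n → (Fin n → ℤ) → ℂ)

def galExt : (K → ℂ) →ₗ[ℝ] ((Fin n → ℤ) → ℂ) where
  toFun f k := if h : k ∈ K then f ⟨k, h⟩ else 0
  map_add' f g := by funext k; by_cases h : k ∈ K <;> simp [h]
  map_smul' c f := by funext k; by_cases h : k ∈ K <;> simp [h]

theorem galExt_mem (f : K → ℂ) (k : K) : galExt K f k = f k := by
  simp [galExt, k.2]

def galM (i : Fin n) : (K → ℂ) →ₗ[ℝ] (K → ℂ) where
  toFun f k := convK K (b i) (galExt K f) k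
  map_add' f g := by
    funext k
    simp [convK, mul_add, Finset.sum_add_distrib]
  map_smul' c f := by
    funext k
    simp only [convK, map_smul, Pi.smul_apply, RingHom.id_apply, Finset.smul_sum]
    exact Finset.sum_congr rfl fun l _ => by simp; ring

def galP (i : Fin n) : (K → ℂ) →ₗ[ℝ] (K → ℂ) where
  toFun f k := opP i (galExt K f) k
  map_add' f g := by funext k; simp [opP, mul_add]
  map_smul' c f := by funext k; simp [opP]; ring

def galS : (K → ℂ) →ₗ[ℝ] (K → ℂ) := LinearMap.id + ∑ i, (galM K b i).comp (galM K b i)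

variable {b}

theorem galS_inj (hb : ∀ i m, b i (-m) = starRingEnd ℂ (b i m)) (hr : ∀ i, Rapid (b i)) :
    Function.Injective (galS K b) := by
  rw [injective_iff_map_eq_zero]
  intro f hf
  obtain ⟨C, hC0, hC⟩ := elliptic_om hb hr 0
  have h1 := hC K 0 (galExt K f) 0 (fun k => - ∑ i, opP i (galExt K (-galM K b i f)) k)
    (fun i => galExt K (-galM K b i f)) ⟨?_, ?_, ?_⟩
  · have h2 : EnK K (fun k => om k ^ 0) (galExt K f) (fun i => galExt K (-galM K b i f)) ≤ 0 := by
      refine h1.trans (le_of_eq ?_)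
      simp [nrmK, opP]
    have h3 : nrmK K (fun k => om k ^ 0) (galExt K f) ≤ 0 := by
      refine le_trans ?_ h2
      unfold EnK
      have : 0 ≤ ∑ i, nrmK K (fun k => om k ^ 0) (galExt K (-galM K b i f)) :=
        Finset.sum_nonneg fun _ _ => nrmK_nonneg _ _ _
      linarith
    funext k
    have h4 := Finset.single_le_sum (f := fun k => (om k ^ 0) ^ 2 * ‖galExt K f k‖ ^ 2) (s := K)
      (fun i _ => by positivity) k.2
    have h5 : ‖galExt K f k‖ ^ 2 ≤ 0 := by
      have := h4.trans h3
      simpa using this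
    have h6 : ‖galExt K f k‖ = 0 := by
      have := sq_nonneg ‖galExt K f k‖
      exact pow_eq_zero_iff (two_ne_zero) |>.1 (le_antisymm h5 this)
    rw [galExt_mem] at h6
    simpa using h6
  · intro i k hk
    have := galExt_mem K (-galM K b i f) ⟨k, hk⟩
    simp only at this
    rw [this]
    simp [opP, galM]
  · intro k hk
    have h := congrFun hf ⟨k, hk⟩
    simp only [galS, LinearMap.add_apply, LinearMap.id_apply, LinearMap.sum_apply,
      LinearMap.comp_apply, Pi.add_apply, Finset.sum_apply, Pi.zero_apply] at h
    have e := galExt_mem K f ⟨k, hk⟩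
    simp only at e
    rw [e]
    simp only [Pi.zero_apply]
    have : ∀ i, convK K (b i) (galExt K (-galM K b i f)) k = - galM K b i (galM K b i f) ⟨k, hk⟩ := by
      intro i
      simp [galM, convK]
    simp only [this, Finset.sum_neg_distrib, sub_neg_eq_add]
    exact h.symm
  · intro k hk
    rfl

variable (b) in
def galSe (hi : Function.Injective (galS K b)) : (K → ℂ) ≃ₗ[ℝ] (K → ℂ) :=
  LinearEquiv.ofInjectiveEndo (galS K b) hi

variable (hi : Function.Injective (galS K b))

def galw : ((K → ℂ) × (K → ℂ)) →ₗ[ℝ] (K → ℂ) :=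
  (galSe K b hi).symm.toLinearMap.comp
    (LinearMap.snd ℝ _ _ + ∑ i, ((galM K b i).comp (galP K i)).comp (LinearMap.fst ℝ _ _))

def gald (i : Fin n) : ((K → ℂ) × (K → ℂ)) →ₗ[ℝ] (K → ℂ) :=
  (galP K i).comp (LinearMap.fst ℝ _ _) - (galM K b i).comp (galw K hi)

def galG : ((K → ℂ) × (K → ℂ)) →ₗ[ℝ] ((K → ℂ) × (K → ℂ)) :=
  (galw K hi).prod (- ∑ i, (galP K i).comp (gald K hi i))

def galL : ((K → ℂ) × (K → ℂ)) →L[ℝ] ((K → ℂ) × (K → ℂ)) := (galG K hi).toContinuousLinearMap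

theorem galS_w (y : (K → ℂ) × (K → ℂ)) :
    galS K b (galw K hi y) = y.2 + ∑ i, galM K b i (galP K i y.1) := by
  have : galS K b (galw K hi y) = galSe K b hi (galw K hi y) := rfl
  rw [this]
  simp [galw]

theorem gal_pt (y : (K → ℂ) × (K → ℂ)) :
    GalPt K b (galExt K y.1) (galExt K (galG K hi y).1) (galExt K y.2) (galExt K (galG K hi y).2)
      (fun i => galExt K (gald K hi i y)) := by
  refine ⟨?_, ?_, ?_⟩
  · intro i k hk
    have := galExt_mem K (gald K hi i y) ⟨k, hk⟩
    simp only at this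
    rw [this]
    rfl
  · intro k hk
    have h := congrFun (galS_w K hi y) ⟨k, hk⟩
    simp only [galS, LinearMap.add_apply, LinearMap.id_apply, LinearMap.sum_apply,
      LinearMap.comp_apply, Pi.add_apply, Finset.sum_apply] at h
    have e := galExt_mem K y.2 ⟨k, hk⟩
    have e' := galExt_mem K (galG K hi y).1 ⟨k, hk⟩
    simp only at e e'
    rw [e, e']
    have : ∀ i, convK K (b i) (galExt K (gald K hi i y)) k
        = galM K b i (galP K i y.1) ⟨k, hk⟩ - galM K b i (galM K b i (galw K hi y)) ⟨k, hk⟩ := by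
      intro i
      have : convK K (b i) (galExt K (gald K hi i y)) k = galM K b i (gald K hi i y) ⟨k, hk⟩ := rfl
      rw [this]
      simp [gald]
    simp only [this, Finset.sum_sub_distrib]
    have e3 : (galG K hi y).1 = galw K hi y := rfl
    rw [e3]
    linear_combination -h
  · intro k hk
    have := galExt_mem K (galG K hi y).2 ⟨k, hk⟩
    simp only at this
    rw [this]
    simp [galG, galP]

def galY (y0 : (K → ℂ) × (K → ℂ)) (z : ℝ) : (K → ℂ) × (K → ℂ) :=
  NormedSpace.exp (z • galL K hi) y0

theorem galY_deriv (y0 : (K → ℂ) × (K → ℂ)) (z : ℝ) :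
    HasDerivAt (galY K hi y0) (galG K hi (galY K hi y0 z)) z := by
  have h := hasDerivAt_exp_smul_const' (galL K hi) z
  have h2 := h.clm_apply (hasDerivAt_const z y0)
  simp only [map_zero, add_zero] at h2
  exact h2

theorem galY_zero (y0 : (K → ℂ) × (K → ℂ)) : galY K hi y0 0 = y0 := by
  have h : (0 : ℝ) • galL K hi = 0 := zero_smul ℝ (galL K hi)
  unfold galY
  rw [h, NormedSpace.exp_zero]
  rfl

theorem galY_smul (c : ℝ) (y0 : (K → ℂ) × (K → ℂ)) (z : ℝ) :
    galY K hi (c • y0) z = c • galY K hi y0 z := by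
  simp [galY]

theorem galY_isGal (R : ℝ) (ψ : (Fin n → ℤ) → ℂ) (y0 : (K → ℂ) × (K → ℂ))
    (h1 : ∀ k : K, y0.1 k = ψ k) (h2 : (galY K hi y0 (-R)).2 = 0) :
    IsGal K R b ψ (fun j z => galExt K (((galG K hi) ^ j) (galY K hi y0 z)).1)
      (fun j z => galExt K (((galG K hi) ^ j) (galY K hi y0 z)).2)
      (fun i j z => galExt K (gald K hi i (((galG K hi) ^ j) (galY K hi y0 z)))) := by
  have key : ∀ (L : ((K → ℂ) × (K → ℂ)) →ₗ[ℝ] (K → ℂ)) (j : ℕ) (k : Fin n → ℤ) (z : ℝ),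
      HasDerivAt (fun z => galExt K (L (((galG K hi) ^ j) (galY K hi y0 z))) k)
        (galExt K (L (((galG K hi) ^ (j + 1)) (galY K hi y0 z))) k) z := by
    intro L j k z
    let Lk : ((K → ℂ) × (K → ℂ)) →L[ℝ] ℂ :=
      ((LinearMap.proj k).comp ((galExt K).comp (L.comp ((galG K hi) ^ j)))).toContinuousLinearMap
    have := Lk.hasFDerivAt.comp_hasDerivAt z (galY_deriv K hi y0 z)
    rw [pow_succ]
    exact this
  refine ⟨fun j k z => key (LinearMap.fst ℝ _ _) j k z, fun j k z => key (LinearMap.snd ℝ _ _) j k z,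
    fun i j k z => key (gald K hi i) j k z, ?_, ?_, ?_⟩
  · intro j z
    have := gal_pt K hi (((galG K hi) ^ j) (galY K hi y0 z))
    rw [pow_succ']
    exact this
  · intro k hk
    have := galExt_mem K y0.1 ⟨k, hk⟩
    simp only [pow_zero, galY_zero]
    exact this.trans (h1 ⟨k, hk⟩)
  · intro k hk
    simp [h2]

def galBV (R : ℝ) : ((K → ℂ) × (K → ℂ)) →ₗ[ℝ] ((K → ℂ) × (K → ℂ)) :=
  (LinearMap.fst ℝ _ _).prod ((LinearMap.snd ℝ _ _).comp
    (NormedSpace.exp ((-R) • galL K hi) : ((K → ℂ) × (K → ℂ)) →L[ℝ] ((K → ℂ) × (K → ℂ))).toLinearMap)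

theorem rapid_zero : Rapid (0 : (Fin n → ℤ) → ℂ) := fun s => ⟨0, le_refl _, fun k => by simp⟩

theorem gal_exists (hb : ∀ i m, b i (-m) = starRingEnd ℂ (b i m)) (hr : ∀ i, Rapid (b i))
    {R : ℝ} (hR : 0 < R) (ψ : (Fin n → ℤ) → ℂ) :
    ∃ v q d, IsGal K R b ψ v q d := by
  have hi := galS_inj K hb hr
  have hinj : Function.Injective (galBV K hi R) := by
    rw [injective_iff_map_eq_zero]
    intro y hy
    have h1 : y.1 = 0 := congrArg Prod.fst hy
    have h2 : (galY K hi y (-R)).2 = 0 := congrArg Prod.snd hy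
    obtain ⟨δ, hδ, hC⟩ := gal_bounds hb hr (rapid_zero (n := n))
    obtain ⟨C, hC0, hC⟩ := hC 0 0
    have h3 : ∀ c : ℝ, c ^ 2 * nrmK K (fun k => om k ^ 0) (galExt K y.2) ≤ C := by
      intro c
      have hG := galY_isGal K hi R 0 (c • y) (by simp [h1]) (by rw [galY_smul]; simp [h2])
      have := (hC K R _ _ _ hR hG 0 ⟨by linarith, le_refl _⟩).2
      simp only [pow_zero, galY_zero] at this
      refine le_trans (le_of_eq ?_) (this.trans (by simp))
      simp [nrmK, Finset.mul_sum, mul_pow]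
    have h4 : nrmK K (fun k => om k ^ 0) (galExt K y.2) = 0 := by
      by_contra hne
      have hpos : 0 < nrmK K (fun k => om k ^ 0) (galExt K y.2) :=
        lt_of_le_of_ne (nrmK_nonneg _ _ _) (Ne.symm hne)
      have := h3 (Real.sqrt ((C + 1) / nrmK K (fun k => om k ^ 0) (galExt K y.2)))
      rw [Real.sq_sqrt (by positivity), div_mul_cancel₀ _ hne] at this
      linarith
    refine Prod.ext h1 ?_
    funext k
    have h5 := (Finset.sum_eq_zero_iff_of_nonneg (fun i _ => by positivity)).1 h4 k k.2
    simp only [pow_zero, one_pow, one_mul] at h5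
    have h6 : ‖galExt K y.2 k‖ = 0 := pow_eq_zero_iff (two_ne_zero) |>.1 h5
    rw [galExt_mem] at h6
    simpa using h6
  obtain ⟨y0, hy0⟩ := LinearMap.injective_iff_surjective.1 hinj (fun k => ψ k, 0)
  exact ⟨_, _, _, galY_isGal K hi R ψ y0 (fun k => congrFun (congrArg Prod.fst hy0) k)
    (congrArg Prod.snd hy0)⟩

end


/-! ### Limit of Galerkin solutions on the half line -/

def kbox (n N : ℕ) : Finset (Fin n → ℤ) := Fintype.piFinset fun _ => Finset.Icc (-(N:ℤ)) N

theorem mem_kbox_eventually {n : ℕ} (k : Fin n → ℤ) :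
    ∀ᶠ N in (Filter.hyperfilter ℕ : Filter ℕ), k ∈ kbox n N := by
  have h : ∀ᶠ N in Filter.atTop, k ∈ kbox n N := by
    filter_upwards [Filter.eventually_ge_atTop (∑ i, (k i).natAbs)] with N hN
    simp only [kbox, Fintype.mem_piFinset, Finset.mem_Icc]
    intro i
    have h1 : (k i).natAbs ≤ ∑ i, (k i).natAbs :=
      Finset.single_le_sum (f := fun i => (k i).natAbs) (fun _ _ => Nat.zero_le _) (Finset.mem_univ i)
    omega
  exact (Filter.hyperfilter_le_cofinite.trans_eq Nat.cofinite_eq_atTop) h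

theorem mem_Icc_eventually {z : ℝ} (hz : z ≤ 0) :
    ∀ᶠ N : ℕ in (Filter.hyperfilter ℕ : Filter ℕ), z ∈ Set.Icc (-((N:ℝ) + 1)) 0 := by
  have h : ∀ᶠ N : ℕ in Filter.atTop, z ∈ Set.Icc (-((N:ℝ) + 1)) 0 := by
    obtain ⟨M, hM⟩ := exists_nat_ge (-z)
    filter_upwards [Filter.eventually_ge_atTop M] with N hN
    have : (M:ℝ) ≤ N := by exact_mod_cast hN
    exact ⟨by linarith, hz⟩
  exact (Filter.hyperfilter_le_cofinite.trans_eq Nat.cofinite_eq_atTop) h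

theorem ulim_exists (u : ℕ → ℂ) (C : ℝ)
    (h : ∀ᶠ N in (Filter.hyperfilter ℕ : Filter ℕ), ‖u N‖ ≤ C) :
    ∃ l, Filter.Tendsto u (Filter.hyperfilter ℕ) (nhds l) := by
  have := (isCompact_closedBall (0:ℂ) C).ultrafilter_le_nhds ((Filter.hyperfilter ℕ).map u) (by
    rw [Filter.le_principal_iff, Ultrafilter.coe_map]
    exact Filter.mem_map.2 (h.mono fun N hN => by simpa using hN))
  obtain ⟨l, _, hl⟩ := this
  exact ⟨l, hl⟩

theorem taylor_ineq {f f' f'' : ℝ → ℂ} (h1 : ∀ z, HasDerivAt f (f' z) z)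
    (h2 : ∀ z, HasDerivAt f' (f'' z) z) {a b C : ℝ} (hC : ∀ z ∈ Set.Icc a b, ‖f'' z‖ ≤ C)
    {x y : ℝ} (hx : x ∈ Set.Icc a b) (hy : y ∈ Set.Icc a b) :
    ‖f y - f x - (y - x) • f' x‖ ≤ C * ‖y - x‖ * ‖y - x‖ := by
  have hsub : Set.uIcc x y ⊆ Set.Icc a b := Set.uIcc_subset_Icc hx hy
  have hconv : Convex ℝ (Set.uIcc x y) := convex_uIcc x y
  have hC0 : 0 ≤ C := le_trans (norm_nonneg _) (hC x hx)
  have hl : ∀ z ∈ Set.uIcc x y, ‖f' z - f' x‖ ≤ C * ‖y - x‖ := by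
    intro z hz
    have := Convex.norm_image_sub_le_of_norm_hasDerivWithin_le (f := f') (f' := f'') (s := Set.uIcc x y)
      (fun w _ => (h2 w).hasDerivWithinAt) (fun w hw => hC w (hsub hw)) hconv
      Set.left_mem_uIcc hz
    refine this.trans (mul_le_mul_of_nonneg_left ?_ hC0)
    rw [Real.norm_eq_abs, Real.norm_eq_abs]
    exact Set.abs_sub_left_of_mem_uIcc hz
  have hg : ∀ z, HasDerivAt (fun z => f z - f x - (z - x) • f' x) (f' z - f' x) z := by
    intro z
    have := ((h1 z).sub_const (f x)).sub (((hasDerivAt_id z).sub_const x).smul_const (f' x))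
    exact this.congr_deriv (by simp)
  have := Convex.norm_image_sub_le_of_norm_hasDerivWithin_le
    (f := fun z => f z - f x - (z - x) • f' x) (f' := fun z => f' z - f' x) (s := Set.uIcc x y)
      (fun w _ => (hg w).hasDerivWithinAt) hl hconv Set.left_mem_uIcc Set.right_mem_uIcc
  simpa using this

structure HalfArr {n : ℕ} (δ : ℝ) (G : ℕ → ℝ → (Fin n → ℤ) → ℂ) : Prop where
  der : ∀ j k z, z ≤ 0 → HasDerivWithinAt (fun z => G j z k) (G (j + 1) z k) (Set.Iic 0) z
  bd : ∀ j s, ∃ C : ℝ, 0 ≤ C ∧ ∀ k z, z ≤ 0 → om k ^ s * ‖G j z k‖ ≤ C * Real.exp (δ * z)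

def FamBd {n : ℕ} (δ : ℝ) (g : ℕ → ℕ → ℝ → (Fin n → ℤ) → ℂ) : Prop :=
  ∀ j s, ∃ C : ℝ, 0 ≤ C ∧ ∀ N, ∀ k ∈ kbox n N, ∀ z ∈ Set.Icc (-((N:ℝ) + 1)) 0,
      om k ^ s * ‖g N j z k‖ ≤ C * Real.exp (δ * z)

theorem lim_arr {n : ℕ} {δ : ℝ} (hδ : 0 ≤ δ) {g : ℕ → ℕ → ℝ → (Fin n → ℤ) → ℂ}
    (hder : ∀ N j k z, HasDerivAt (fun z => g N j z k) (g N (j + 1) z k) z)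
    (hbd : FamBd δ g) :
    ∃ G, HalfArr δ G ∧ ∀ j z k, z ≤ 0 →
      Filter.Tendsto (fun N => g N j z k) (Filter.hyperfilter ℕ) (nhds (G j z k)) := by
  have hex : ∀ j z k, ∃ l, z ≤ 0 →
      Filter.Tendsto (fun N => g N j z k) (Filter.hyperfilter ℕ) (nhds l) := by
    intro j z k
    by_cases hz : z ≤ 0
    · obtain ⟨C, hC0, hC⟩ := hbd j 0
      obtain ⟨l, hl⟩ := ulim_exists (fun N => g N j z k) (C * Real.exp (δ * z)) (by
        filter_upwards [mem_kbox_eventually k, mem_Icc_eventually hz] with N h1 h2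
        simpa using hC N k h1 z h2)
      exact ⟨l, fun _ => hl⟩
    · exact ⟨0, fun h => absurd h hz⟩
  choose G hG using hex
  refine ⟨G, ⟨?_, ?_⟩, fun j z k hz => hG j z k hz⟩
  · intro j k z hz
    obtain ⟨C, hC0, hC⟩ := hbd (j + 2) 0
    have key : ∀ y ≤ 0, ‖G j y k - G j z k - (y - z) • G (j + 1) z k‖ ≤ C * ‖y - z‖ * ‖y - z‖ := by
      intro y hy
      have ht := (((hG j y k hy).sub (hG j z k hz)).sub ((hG (j + 1) z k hz).const_smul (y - z))).norm
      refine le_of_tendsto ht ?_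
      filter_upwards [mem_kbox_eventually k, mem_Icc_eventually hz, mem_Icc_eventually hy] with N h1 h2 h3
      refine taylor_ineq (hder N j k) (hder N (j + 1) k) (fun w hw => ?_) h2 h3
      have h4 := hC N k h1 w hw
      have h5 : Real.exp (δ * w) ≤ 1 := Real.exp_le_one_iff.2 (mul_nonpos_of_nonneg_of_nonpos hδ hw.2)
      simp only [pow_zero, one_mul] at h4
      calc _ ≤ _ := h4
        _ ≤ C * 1 := by gcongr
        _ = C := mul_one _
    rw [hasDerivWithinAt_iff_isLittleO]
    rw [Asymptotics.isLittleO_iff]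
    intro c hc
    have hnb : ∀ᶠ y in nhdsWithin z (Set.Iic 0), C * ‖y - z‖ < c := by
      have : Filter.Tendsto (fun y : ℝ => C * ‖y - z‖) (nhdsWithin z (Set.Iic 0)) (nhds (C * ‖z - z‖)) :=
        ((by fun_prop : Continuous (fun y : ℝ => C * ‖y - z‖)).tendsto z).mono_left nhdsWithin_le_nhds
      apply this.eventually_lt_const
      simpa using hc
    filter_upwards [hnb, self_mem_nhdsWithin] with y h1 h2
    exact (key y h2).trans (mul_le_mul_of_nonneg_right h1.le (norm_nonneg _))
  · intro j s
    obtain ⟨C, hC0, hC⟩ := hbd j s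
    refine ⟨C, hC0, fun k z hz => ?_⟩
    refine le_of_tendsto ((hG j z k hz).norm.const_mul (om k ^ s)) ?_
    filter_upwards [mem_kbox_eventually k, mem_Icc_eventually hz] with N h1 h2
    exact hC N k h1 z h2

theorem Rapid.summable {n : ℕ} {f : (Fin n → ℤ) → ℂ} (hf : Rapid f) : Summable fun k => ‖f k‖ := by
  obtain ⟨C, hC0, hC⟩ := hf.sum 0
  refine summable_of_sum_le (c := C) (fun k => norm_nonneg _) fun K => ?_
  simpa using hC K

theorem Rapid.summable_shift {n : ℕ} {f : (Fin n → ℤ) → ℂ} (hf : Rapid f) (k : Fin n → ℤ) :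
    Summable fun l => ‖f (k - l)‖ :=
  (Equiv.subLeft k).summable_iff.2 hf.summable

theorem conv_tendsto {n : ℕ} {δ : ℝ} (hδ : 0 ≤ δ) {g : ℕ → ℕ → ℝ → (Fin n → ℤ) → ℂ}
    {G : ℕ → ℝ → (Fin n → ℤ) → ℂ} (hbd : FamBd δ g) (hG : ∀ j z k, z ≤ 0 →
      Filter.Tendsto (fun N => g N j z k) (Filter.hyperfilter ℕ) (nhds (G j z k)))
    {b : (Fin n → ℤ) → ℂ} (hb : Rapid b) (j : ℕ) {z : ℝ} (hz : z ≤ 0) (k : Fin n → ℤ) :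
    Filter.Tendsto (fun N => convK (kbox n N) b (g N j z) k) (Filter.hyperfilter ℕ)
      (nhds (∑' l, b (k - l) * G j z l)) := by
  obtain ⟨C, hC0, hC⟩ := hbd j 0
  have e : (fun N => convK (kbox n N) b (g N j z) k)
      = fun N => ∑' l, if l ∈ kbox n N then b (k - l) * g N j z l else 0 := by
    funext N
    rw [tsum_eq_sum (s := kbox n N) (fun l hl => by simp [hl])]
    exact Finset.sum_congr rfl fun l hl => by simp [hl]
  rw [e]
  refine tendsto_tsum_of_dominated_convergence (bound := fun l => ‖b (k - l)‖ * C)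
    ((hb.summable_shift k).mul_right C) ?_ ?_
  · intro l
    refine ((hG j z l hz).const_mul (b (k - l))).congr' ?_
    filter_upwards [mem_kbox_eventually l] with N hN
    simp [hN]
  · filter_upwards [mem_Icc_eventually hz] with N hN l
    by_cases hl : l ∈ kbox n N
    · simp only [hl, if_true, norm_mul]
      have h4 := hC N l hl z hN
      have h5 : Real.exp (δ * z) ≤ 1 := Real.exp_le_one_iff.2 (mul_nonpos_of_nonneg_of_nonpos hδ hz)
      simp only [pow_zero, one_mul] at h4
      refine mul_le_mul_of_nonneg_left ?_ (norm_nonneg _)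
      calc _ ≤ _ := h4
        _ ≤ C * 1 := by gcongr
        _ = C := mul_one _
    · simp only [hl, if_false, norm_zero]
      positivity

theorem nrmK_single {n : ℕ} {K : Finset (Fin n → ℤ)} {s : ℕ} {f : (Fin n → ℤ) → ℂ} {C δ z : ℝ}
    (hC : 0 ≤ C)
    (h : nrmK K (fun k => om k ^ s) f ≤ C * Real.exp (2 * δ * z)) {k : Fin n → ℤ} (hk : k ∈ K) :
    om k ^ s * ‖f k‖ ≤ Real.sqrt C * Real.exp (δ * z) := by
  have h1 := Finset.single_le_sum (f := fun k => (om k ^ s) ^ 2 * ‖f k‖ ^ 2) (s := K)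
      (fun i _ => by positivity) hk
  have h2 := h1.trans h
  have hom := om_pos k
  rw [← abs_of_nonneg (a := om k ^ s * ‖f k‖) (by positivity)]
  apply abs_le_of_sq_le_sq _ (by positivity)
  rw [mul_pow, mul_pow, Real.sq_sqrt hC, ← Real.exp_nat_mul]
  refine h2.trans (le_of_eq ?_)
  congr 2
  push_cast
  ring

theorem exp_decay_int {f f' : ℝ → ℂ} {C δ R : ℝ} (hδ : 0 < δ)
    (h1 : ∀ z, HasDerivAt f (f' z) z) (h2 : ∀ z ∈ Set.Icc (-R) 0, ‖f' z‖ ≤ C * Real.exp (δ * z))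
    (hC : 0 ≤ C) {z : ℝ} (hz : z ∈ Set.Icc (-R) 0) : ‖f z‖ ≤ ‖f 0‖ + C / δ := by
  have hd : ∀ u, HasDerivAt (fun u => f (-u)) (-f' (-u)) u := by
    intro u
    have := (h1 (-u)).scomp u (hasDerivAt_neg u)
    exact this.congr_deriv (by simp)
  have hB : ∀ u : ℝ, HasDerivAt (fun u => ‖f 0‖ + C / δ * (1 - Real.exp (-δ * u)))
      (C * Real.exp (-δ * u)) u := by
    intro u
    have := ((((hasDerivAt_id u).const_mul (-δ)).exp.const_sub 1).const_mul (C / δ)).const_add ‖f 0‖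
    refine this.congr_deriv ?_
    simp
    field_simp
  have := image_norm_le_of_norm_deriv_right_le_deriv_boundary (f := fun u => f (-u)) (a := 0) (b := R)
    (f' := fun u => -f' (-u)) (fun u _ => (hd u).continuousAt.continuousWithinAt)
    (fun u _ => (hd u).hasDerivWithinAt) (B := fun u => ‖f 0‖ + C / δ * (1 - Real.exp (-δ * u)))
    (by simp) hB (fun u hu => by
      rw [norm_neg]
      refine (h2 (-u) ⟨by linarith [hu.2], by linarith [hu.1]⟩).trans (le_of_eq ?_)
      simp) (x := -z) ⟨by linarith [hz.2], by linarith [hz.1]⟩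
  simp only [neg_neg] at this
  refine this.trans ?_
  have h3 : 0 ≤ C / δ := by positivity
  have h4 := Real.exp_pos (-δ * -z)
  nlinarith

theorem half_modes {n : ℕ} {b : Fin n → (Fin n → ℤ) → ℂ} {ψ : (Fin n → ℤ) → ℂ}
    (hb : ∀ i m, b i (-m) = starRingEnd ℂ (b i m)) (hr : ∀ i, Rapid (b i))
    (hψ : Rapid ψ) :
    ∃ δ > 0, ∃ v q : ℕ → ℝ → (Fin n → ℤ) → ℂ, ∃ d : Fin n → ℕ → ℝ → (Fin n → ℤ) → ℂ,
      HalfArr 0 v ∧ HalfArr δ (fun j => v (j + 1)) ∧ HalfArr δ q ∧ (∀ i, HalfArr δ (d i)) ∧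
      (∀ k, v 0 0 k = ψ k) ∧ ∀ z ≤ 0, ∀ k,
        (∀ i, d i 0 z k = opP i (v 0 z) k - ∑' l, b i (k - l) * v 1 z l) ∧
        (q 0 z k = v 1 z k - ∑ i, ∑' l, b i (k - l) * d i 0 z l) ∧
        (q 1 z k = - ∑ i, opP i (d i 0 z) k) := by
  obtain ⟨δ, hδ, hgal⟩ := gal_bounds hb hr hψ
  have hex : ∀ N : ℕ, ∃ v q d, IsGal (kbox n N) ((N:ℝ) + 1) b ψ v q d := fun N =>
    gal_exists _ hb hr (by positivity) ψ
  choose v q d hG using hex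
  have bv1 : FamBd δ (fun N j => v N (j + 1)) := by
    intro j s
    obtain ⟨C, hC0, hC⟩ := hgal j s
    refine ⟨Real.sqrt C, Real.sqrt_nonneg _, fun N k hk z hz => ?_⟩
    have := (hC _ _ _ _ _ (by positivity) (hG N) z hz).1
    unfold EnK at this
    have h2 : 0 ≤ ∑ i, nrmK (kbox n N) (fun k => om k ^ s) (d N i j z) :=
      Finset.sum_nonneg fun _ _ => nrmK_nonneg _ _ _
    exact nrmK_single hC0 (by linarith) hk
  have bd1 : ∀ i, FamBd δ (fun N => d N i) := by
    intro i j s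
    obtain ⟨C, hC0, hC⟩ := hgal j s
    refine ⟨Real.sqrt C, Real.sqrt_nonneg _, fun N k hk z hz => ?_⟩
    have := (hC _ _ _ _ _ (by positivity) (hG N) z hz).1
    unfold EnK at this
    have h2 := Finset.single_le_sum (f := fun i => nrmK (kbox n N) (fun k => om k ^ s) (d N i j z))
      (s := Finset.univ) (fun _ _ => nrmK_nonneg _ _ _) (Finset.mem_univ i)
    have h3 := nrmK_nonneg (kbox n N) (fun k => om k ^ s) (v N (j + 1) z)
    exact nrmK_single hC0 (by linarith) hk
  have bq1 : FamBd δ q := by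
    intro j s
    obtain ⟨C, hC0, hC⟩ := hgal j s
    refine ⟨Real.sqrt C, Real.sqrt_nonneg _, fun N k hk z hz => ?_⟩
    exact nrmK_single hC0 (hC _ _ _ _ _ (by positivity) (hG N) z hz).2 hk
  have bv0 : FamBd 0 v := by
    intro j s
    cases j with
    | succ j =>
      obtain ⟨C, hC0, hC⟩ := bv1 j s
      refine ⟨C, hC0, fun N k hk z hz => (hC N k hk z hz).trans ?_⟩
      have h5 : Real.exp (δ * z) ≤ 1 := Real.exp_le_one_iff.2 (mul_nonpos_of_nonneg_of_nonpos hδ.le hz.2)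
      simp only [zero_mul, Real.exp_zero]
      gcongr
    | zero =>
      obtain ⟨C, hC0, hC⟩ := bv1 0 s
      obtain ⟨D, hD0, hD⟩ := hψ s
      refine ⟨D + C / δ, by positivity, fun N k hk z hz => ?_⟩
      have hom := om_pos k
      have h1 := exp_decay_int (f := fun z => v N 0 z k) (f' := fun z => v N 1 z k) (C := C / om k ^ s) hδ
        (fun z => (hG N).hv 0 k z) (R := (N:ℝ) + 1) (fun z hz => by
          have := hC N k hk z hz
          rw [div_mul_eq_mul_div, le_div_iff₀ (by positivity), mul_comm]
          exact this) (by positivity) hz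
      have h2 := (hG N).bv k hk
      simp only [h2] at h1
      have h3 := hD k
      simp only [zero_mul, Real.exp_zero, mul_one]
      calc om k ^ s * ‖v N 0 z k‖ ≤ om k ^ s * (‖ψ k‖ + C / om k ^ s / δ) := by gcongr
        _ = om k ^ s * ‖ψ k‖ + C / δ := by field_simp
        _ ≤ _ := by linarith
  obtain ⟨V, hV, hVt⟩ := lim_arr (le_refl 0) (g := v) (fun N j k z => (hG N).hv j k z) bv0
  obtain ⟨Q, hQ, hQt⟩ := lim_arr hδ.le (g := q) (fun N j k z => (hG N).hq j k z) bq1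
  have hdx := fun i => lim_arr hδ.le (g := fun N => d N i) (fun N j k z => (hG N).hd i j k z) (bd1 i)
  choose D hD hDt using hdx
  have hopP : ∀ (i : Fin n) (k : Fin n → ℤ) (u : ℕ → (Fin n → ℤ) → ℂ) (U : (Fin n → ℤ) → ℂ),
      Filter.Tendsto (fun N => u N k) (Filter.hyperfilter ℕ) (nhds (U k)) →
      Filter.Tendsto (fun N => opP i (u N) k) (Filter.hyperfilter ℕ) (nhds (opP i U k)) :=
    fun i k u U h => h.const_mul _
  refine ⟨δ, hδ, V, Q, D, hV, ⟨fun j k z hz => hV.der (j + 1) k z hz, ?_⟩, hQ, hD, ?_, ?_⟩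
  · intro j s
    obtain ⟨C, hC0, hC⟩ := bv1 j s
    refine ⟨C, hC0, fun k z hz => ?_⟩
    refine le_of_tendsto ((hVt (j + 1) z k hz).norm.const_mul (om k ^ s)) ?_
    filter_upwards [mem_kbox_eventually k, mem_Icc_eventually hz] with N h1 h2
    exact hC N k h1 z h2
  · intro k
    refine tendsto_nhds_unique (hVt 0 0 k (le_refl _)) (tendsto_const_nhds.congr' ?_)
    filter_upwards [mem_kbox_eventually k] with N h1
    exact ((hG N).bv k h1).symm
  · intro z hz k
    refine ⟨fun i => ?_, ?_, ?_⟩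
    · have h1 := (hopP i k (fun N => v N 0 z) (V 0 z) (hVt 0 z k hz)).sub
        (conv_tendsto (le_refl 0) bv0 hVt (hr i) 1 hz k)
      refine tendsto_nhds_unique (hDt i 0 z k hz) (h1.congr' ?_)
      filter_upwards [mem_kbox_eventually k] with N h2
      exact (((hG N).pt 0 z).ed i k h2).symm
    · have h1 := (hVt 1 z k hz).sub (tendsto_finsetSum Finset.univ fun i _ =>
        (conv_tendsto hδ.le (bd1 i) (hDt i) (hr i) 0 hz k))
      refine tendsto_nhds_unique (hQt 0 z k hz) (h1.congr' ?_)
      filter_upwards [mem_kbox_eventually k] with N h2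
      exact (((hG N).pt 0 z).eq k h2).symm
    · have h1 := (tendsto_finsetSum Finset.univ fun i _ =>
        (hopP i k (fun N => d N i 0 z) (D i 0 z) (hDt i 0 z k hz))).neg
      refine tendsto_nhds_unique (hQt 1 z k hz) (h1.congr' ?_)
      filter_upwards [mem_kbox_eventually k] with N h2
      exact (((hG N).pt 0 z).eq1 k h2).symm



/-! ### Seeley extension across z = 0 -/

def seeA : ℕ → ℝ
  | 0 => 1
  | m + 1 => - ((1/10 : ℝ) ^ m / (1 - (1/10 : ℝ) ^ (m + 1))) * seeA m

theorem see_den (m : ℕ) : 9 / 10 ≤ 1 - (1/10 : ℝ) ^ (m + 1) := by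
  have : (1/10 : ℝ) ^ (m + 1) ≤ (1/10) ^ 1 := pow_le_pow_of_le_one (by norm_num) (by norm_num) (by omega)
  linarith

theorem seeA_rec (m : ℕ) : seeA (m + 1) * (1 - (1/10 : ℝ) ^ (m + 1)) = - ((1/10 : ℝ) ^ m * seeA m) := by
  have := see_den m
  rw [seeA]
  have h0 : (1 - (1/10 : ℝ) ^ (m + 1)) ≠ 0 := by linarith
  generalize 1 - (1/10 : ℝ) ^ (m + 1) = y at *
  field_simp

theorem seeA_ratio (m : ℕ) : |seeA (m + 1)| ≤ (10 / 9) * (1/10 : ℝ) ^ m * |seeA m| := by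
  rw [seeA, abs_mul, abs_neg]
  refine mul_le_mul_of_nonneg_right ?_ (abs_nonneg _)
  have := see_den m
  rw [abs_of_nonneg (by apply div_nonneg <;> [positivity; linarith]), div_le_iff₀ (by linarith)]
  have hp : (0:ℝ) < (1/10) ^ m := by positivity
  nlinarith

theorem seeA_bound (m : ℕ) : |seeA m| ≤ 10 / 9 := by
  induction m with
  | zero => simp [seeA]; norm_num
  | succ m ih =>
    refine (seeA_ratio m).trans ?_
    cases m with
    | zero => simp [seeA]
    | succ m =>
      have : (1/10 : ℝ) ^ (m + 1) ≤ (1/10) ^ 1 := pow_le_pow_of_le_one (by norm_num) (by norm_num) (by omega)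
      have h2 := abs_nonneg (seeA (m + 1))
      have h3 : (0:ℝ) ≤ (1/10) ^ (m + 1) := by positivity
      nlinarith

theorem seeA_summable (j : ℕ) : Summable fun m => |seeA m| * ((10:ℝ) ^ m) ^ j := by
  have hlim : Filter.Tendsto (fun m : ℕ => (10 / 9) * (1/10 : ℝ) ^ m * 10 ^ j) Filter.atTop (nhds 0) := by
    have := ((tendsto_pow_atTop_nhds_zero_of_lt_one (r := (1/10 : ℝ)) (by norm_num) (by norm_num)).const_mul
      (10 / 9)).mul_const ((10:ℝ) ^ j)
    simpa using this
  refine summable_of_ratio_norm_eventually_le (r := 1 / 2) (by norm_num) ?_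
  filter_upwards [hlim.eventually_le_const (by norm_num : (0:ℝ) < 1 / 2)] with m hm
  rw [Real.norm_of_nonneg (by positivity), Real.norm_of_nonneg (by positivity)]
  have h1 := seeA_ratio m
  have h2 : ((10:ℝ) ^ (m + 1)) ^ j = (10 ^ m) ^ j * 10 ^ j := by rw [pow_succ, mul_pow]
  rw [h2]
  have hp : (0:ℝ) < ((10:ℝ) ^ m) ^ j * 10 ^ j := by positivity
  calc |seeA (m + 1)| * ((10 ^ m) ^ j * 10 ^ j)
      ≤ ((10 / 9) * (1/10 : ℝ) ^ m * |seeA m|) * ((10 ^ m) ^ j * 10 ^ j) := by gcongr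
    _ = ((10 / 9) * (1/10 : ℝ) ^ m * 10 ^ j) * (|seeA m| * (10 ^ m) ^ j) := by ring
    _ ≤ 1 / 2 * (|seeA m| * (10 ^ m) ^ j) := by gcongr

theorem seeA_summable' (j : ℕ) : Summable fun m => seeA m * ((10:ℝ) ^ m) ^ j := by
  refine Summable.of_norm ?_
  have := seeA_summable j
  refine this.congr fun m => ?_
  rw [norm_mul, Real.norm_eq_abs, Real.norm_of_nonneg (by positivity)]

theorem seeA_sum (j : ℕ) : ∑' m, seeA m * ((10:ℝ) ^ m) ^ j = 0 := by
  -- F x = Σ a_m x^m, F x = (1 - x) F (x/10)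
  have step : ∀ x : ℝ, Summable (fun m => seeA m * x ^ m) → Summable (fun m => seeA m * (x / 10) ^ m) →
      ∑' m, seeA m * x ^ m = (1 - x) * ∑' m, seeA m * (x / 10) ^ m := by
    intro x h1 h2
    have h3 : ∑' m, seeA m * x ^ m - ∑' m, seeA m * (x / 10) ^ m
        = ∑' m, (seeA m * x ^ m - seeA m * (x / 10) ^ m) := (h1.tsum_sub h2).symm
    have h4 : ∑' m, (seeA m * x ^ m - seeA m * (x / 10) ^ m)
        = ∑' m, (seeA (m + 1) * x ^ (m + 1) - seeA (m + 1) * (x / 10) ^ (m + 1)) := by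
      rw [(h1.sub h2).tsum_eq_zero_add]
      simp
    have h5 : ∀ m, (seeA (m + 1) * x ^ (m + 1) - seeA (m + 1) * (x / 10) ^ (m + 1))
        = (-x) * (seeA m * (x / 10) ^ m) := by
      intro m
      have := seeA_rec m
      have e1 : (x / 10) ^ (m + 1) = x ^ (m + 1) * (1 / 10) ^ (m + 1) := by
        rw [← mul_pow]; congr 1; ring
      have e2 : (x / 10) ^ m = x ^ m * (1 / 10) ^ m := by
        rw [← mul_pow]; congr 1; ring
      rw [e1, e2]
      calc _ = x ^ (m + 1) * (seeA (m + 1) * (1 - (1/10 : ℝ) ^ (m + 1))) := by ring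
        _ = _ := by rw [this]; ring
    rw [h4] at h3
    simp only [h5] at h3
    rw [tsum_mul_left] at h3
    linarith
  have e : ∀ j : ℕ, (fun m => seeA m * ((10:ℝ) ^ m) ^ j) = fun m => seeA m * ((10:ℝ) ^ j) ^ m := by
    intro j; funext m; rw [← pow_mul, ← pow_mul, mul_comm m j]
  have hs : ∀ j : ℕ, Summable fun m => seeA m * ((10:ℝ) ^ j) ^ m := fun j => by
    rw [← e]; exact seeA_summable' j
  rw [e]
  induction j with
  | zero =>
    have hs0 := hs 0
    simp only [pow_zero] at hs0 ⊢
    rw [step 1 hs0]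
    · simp
    · refine Summable.of_norm (Summable.of_nonneg_of_le (fun _ => norm_nonneg _) (fun m => ?_) hs0.norm)
      rw [norm_mul, norm_mul]
      refine mul_le_mul_of_nonneg_left ?_ (norm_nonneg _)
      rw [norm_pow, norm_pow]
      refine pow_le_pow_left₀ (norm_nonneg _) ?_ m
      norm_num
  | succ j ih =>
    have e2 : (10:ℝ) ^ (j + 1) / 10 = 10 ^ j := by rw [pow_succ]; field_simp
    rw [step _ (hs (j + 1)) (by rw [e2]; exact hs j), e2, ih, mul_zero]

theorem seeS_summable (j : ℕ) :
    Summable fun m => |seeA m / ((10:ℝ) ^ m + 1)| * ((10:ℝ) ^ m) ^ j := by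
  refine Summable.of_nonneg_of_le (fun _ => by positivity) (fun m => ?_) (seeA_summable j)
  refine mul_le_mul_of_nonneg_right ?_ (by positivity)
  rw [abs_div, abs_of_pos (by positivity : (0:ℝ) < 10 ^ m + 1)]
  exact div_le_self (abs_nonneg _) (by linarith [pow_pos (by norm_num : (0:ℝ) < 10) m])

theorem seeS_summable' (j : ℕ) :
    Summable fun m => seeA m / ((10:ℝ) ^ m + 1) * (-((10:ℝ) ^ m)) ^ j := by
  refine Summable.of_norm ((seeS_summable j).congr fun m => ?_)
  rw [norm_mul, Real.norm_eq_abs, norm_pow, norm_neg, Real.norm_of_nonneg (by positivity)]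

theorem seeS_const (j : ℕ) : ∑' m, seeA m / ((10:ℝ) ^ m + 1) * (-((10:ℝ) ^ m)) ^ j
    = ∑' m, seeA m / ((10:ℝ) ^ m + 1) := by
  induction j with
  | zero => simp
  | succ j ih =>
    rw [← ih, ← sub_eq_zero, ← (seeS_summable' (j + 1)).tsum_sub (seeS_summable' j)]
    have : ∀ m, seeA m / ((10:ℝ) ^ m + 1) * (-((10:ℝ) ^ m)) ^ (j + 1)
        - seeA m / ((10:ℝ) ^ m + 1) * (-((10:ℝ) ^ m)) ^ j
        = (-1) ^ (j + 1) * (seeA m * ((10:ℝ) ^ m) ^ j) := by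
      intro m
      have : (10:ℝ) ^ m + 1 ≠ 0 := by positivity
      rw [neg_pow ((10:ℝ) ^ m) (j + 1), neg_pow ((10:ℝ) ^ m) j]
      field_simp
      ring
    simp only [this]
    rw [tsum_mul_left, seeA_sum, mul_zero]

theorem seeS_ne : ∑' m, seeA m / ((10:ℝ) ^ m + 1) ≠ 0 := by
  have hs : Summable fun m => seeA m / ((10:ℝ) ^ m + 1) := by simpa using seeS_summable' 0
  rw [hs.tsum_eq_zero_add]
  have hg : HasSum (fun m : ℕ => (1 / 9) * (1/10 : ℝ) ^ m) ((1/9) * (1 - 1/10)⁻¹) :=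
    (hasSum_geometric_of_lt_one (by norm_num) (by norm_num)).mul_left _
  have hb : ‖∑' m, seeA (m + 1) / ((10:ℝ) ^ (m + 1) + 1)‖ ≤ (1/9) * (1 - 1/10)⁻¹ := by
    refine tsum_of_norm_bounded hg fun m => ?_
    rw [norm_div, Real.norm_eq_abs, Real.norm_of_nonneg (by positivity), div_le_iff₀ (by positivity)]
    have h1 := seeA_bound (m + 1)
    have h2 : (1/10 : ℝ) ^ m * 10 ^ (m + 1) = 10 := by
      rw [pow_succ, ← mul_assoc, ← mul_pow]; norm_num
    have h3 : (0:ℝ) < (1/10) ^ m := by positivity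
    nlinarith
  intro h
  rw [Real.norm_eq_abs, abs_le] at hb
  have h00 : seeA 0 = 1 := rfl
  rw [h00] at h
  norm_num at hb h
  linarith [hb.1]

def seeC (m : ℕ) : ℝ := (∑' m, seeA m / ((10:ℝ) ^ m + 1))⁻¹ * (seeA m / ((10:ℝ) ^ m + 1))

theorem seeC_summable (j : ℕ) : Summable fun m => |seeC m * (-((10:ℝ) ^ m)) ^ j| := by
  have := ((seeS_summable' j).mul_left (∑' m, seeA m / ((10:ℝ) ^ m + 1))⁻¹).norm
  refine this.congr fun m => ?_
  rw [Real.norm_eq_abs, seeC, mul_assoc]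

theorem seeC_sum (j : ℕ) : ∑' m, seeC m * (-((10:ℝ) ^ m)) ^ j = 1 := by
  have : ∀ m, seeC m * (-((10:ℝ) ^ m)) ^ j = (∑' m, seeA m / ((10:ℝ) ^ m + 1))⁻¹
      * (seeA m / ((10:ℝ) ^ m + 1) * (-((10:ℝ) ^ m)) ^ j) := fun m => by rw [seeC, mul_assoc]
  simp only [this]
  rw [tsum_mul_left, seeS_const, inv_mul_cancel₀ seeS_ne]

def seeR (f : ℕ → ℝ → ℂ) (j : ℕ) (z : ℝ) : ℂ :=
  ∑' m, (seeC m * (-((10:ℝ) ^ m)) ^ j) • f j (-((10:ℝ) ^ m) * z)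

def seeExt (f : ℕ → ℝ → ℂ) (j : ℕ) (z : ℝ) : ℂ := if z ≤ 0 then f j z else seeR f j z

def seeN (j : ℕ) : ℝ := 1 + ∑' m, |seeC m * (-((10:ℝ) ^ m)) ^ j|

theorem seeN_one_le (j : ℕ) : 1 ≤ seeN j := by
  unfold seeN
  have : 0 ≤ ∑' m, |seeC m * (-((10:ℝ) ^ m)) ^ j| := tsum_nonneg fun _ => abs_nonneg _
  linarith

theorem see_arg {m : ℕ} {z : ℝ} (hz : 0 ≤ z) : -((10:ℝ) ^ m) * z ≤ 0 := by
  have : 0 < (10:ℝ) ^ m := by positivity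
  nlinarith

theorem seeExt_bound {f : ℕ → ℝ → ℂ} {j : ℕ} {C : ℝ} (hC : ∀ z ≤ 0, ‖f j z‖ ≤ C) (z : ℝ) :
    ‖seeExt f j z‖ ≤ seeN j * C := by
  have hC0 : 0 ≤ C := (norm_nonneg _).trans (hC 0 le_rfl)
  unfold seeExt
  split_ifs with hz
  · have := seeN_one_le j
    refine (hC z hz).trans ?_
    nlinarith
  · push Not at hz
    have h1 : ‖seeR f j z‖ ≤ (∑' m, |seeC m * (-((10:ℝ) ^ m)) ^ j|) * C := by
      refine tsum_of_norm_bounded ((seeC_summable j).hasSum.mul_right C) fun m => ?_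
      rw [norm_smul, Real.norm_eq_abs]
      exact mul_le_mul_of_nonneg_left (hC _ (see_arg hz.le)) (abs_nonneg _)
    refine h1.trans ?_
    unfold seeN
    nlinarith

theorem seeExt_deriv {f : ℕ → ℝ → ℂ}
    (hf : ∀ j, ∀ z ≤ 0, HasDerivWithinAt (f j) (f (j + 1) z) (Set.Iic 0) z)
    (hC : ∀ j, ∃ C, ∀ z ≤ 0, ‖f j z‖ ≤ C) (j : ℕ) (z : ℝ) :
    HasDerivAt (seeExt f j) (seeExt f (j + 1) z) z := by
  have hcont : ∀ j, ContinuousAt (seeExt f j) 0 := by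
    intro j
    obtain ⟨C, hC⟩ := hC j
    have hl : ContinuousWithinAt (seeExt f j) (Set.Iic 0) 0 := by
      refine ((hf j 0 le_rfl).continuousWithinAt).congr (fun y hy => ?_) ?_
      · simp only [seeExt]; exact if_pos hy
      · simp [seeExt]
    have hrc : ContinuousOn (seeR f j) (Set.Ici 0) := by
      refine continuousOn_tsum (u := fun m => |seeC m * (-((10:ℝ) ^ m)) ^ j| * C) (fun m => ?_)
        ((seeC_summable j).mul_right C) (fun m z hz => ?_)
      · refine ContinuousOn.fun_const_smul ?_ _
        refine ContinuousOn.comp (t := Set.Iic 0) (fun w hw => (hf j w hw).continuousWithinAt)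
          (by fun_prop) (fun w hw => see_arg hw)
      · rw [norm_smul, Real.norm_eq_abs]
        exact mul_le_mul_of_nonneg_left (hC _ (see_arg hz)) (abs_nonneg _)
    have h0 : seeR f j 0 = f j 0 := by
      simp only [seeR, mul_zero]
      rw [((seeC_summable j).of_abs).tsum_smul_const, seeC_sum, one_smul]
    have hrr : ContinuousWithinAt (seeExt f j) (Set.Ici 0) 0 := by
      refine (hrc 0 Set.self_mem_Ici).congr (fun y hy => ?_) ?_
      · simp only [seeExt]
        split_ifs with h
        · have : y = 0 := le_antisymm h hy
          rw [this, h0]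
        · rfl
      · simp [seeExt, h0]
    have := hl.union hrr
    rwa [Set.Iic_union_Ici, continuousWithinAt_univ] at this
  have hne : ∀ y ≠ (0:ℝ), HasDerivAt (seeExt f j) (seeExt f (j + 1) y) y := by
    intro y hy
    rcases lt_or_gt_of_ne hy with h | h
    · have h1 := (hf j y h.le).hasDerivAt (Iic_mem_nhds h)
      have e : seeExt f (j + 1) y = f (j + 1) y := by simp [seeExt, h.le]
      rw [e]
      refine h1.congr_of_eventuallyEq ?_
      filter_upwards [Iic_mem_nhds h] with w hw
      simp only [seeExt]
      exact if_pos hw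
    · have e : seeExt f (j + 1) y = seeR f (j + 1) y := by simp [seeExt, not_le.2 h]
      rw [e]
      have h2 : HasDerivAt (seeR f j) (seeR f (j + 1) y) y := by
        obtain ⟨C1, hC1⟩ := hC (j + 1)
        obtain ⟨C0, hC0⟩ := hC j
        refine hasDerivAt_tsum_of_isPreconnected (u := fun m => |seeC m * (-((10:ℝ) ^ m)) ^ (j + 1)| * C1)
          (t := Set.Ioi 0) (y₀ := y) ((seeC_summable (j + 1)).mul_right C1) isOpen_Ioi isPreconnected_Ioi
          (g := fun m z => (seeC m * (-((10:ℝ) ^ m)) ^ j) • f j (-((10:ℝ) ^ m) * z))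
          (g' := fun m z => (seeC m * (-((10:ℝ) ^ m)) ^ (j + 1)) • f (j + 1) (-((10:ℝ) ^ m) * z)) ?_ ?_ h ?_ h
        · intro m w hw
          have hneg : -((10:ℝ) ^ m) * w < 0 := by
            have : 0 < (10:ℝ) ^ m := by positivity
            have : (0:ℝ) < w := hw
            nlinarith
          have h3 := (hf j _ hneg.le).hasDerivAt (Iic_mem_nhds hneg)
          have h4 := (h3.scomp w ((hasDerivAt_id w).const_mul (-((10:ℝ) ^ m)))).const_smul
            (seeC m * (-((10:ℝ) ^ m)) ^ j)
          refine h4.congr_deriv ?_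
          rw [smul_smul]
          congr 1
          ring
        · intro m w hw
          rw [norm_smul, Real.norm_eq_abs]
          exact mul_le_mul_of_nonneg_left (hC1 _ (see_arg (le_of_lt hw))) (abs_nonneg _)
        · refine Summable.of_norm_bounded ((seeC_summable j).mul_right C0) fun m => ?_
          rw [norm_smul, Real.norm_eq_abs]
          exact mul_le_mul_of_nonneg_left (hC0 _ (see_arg (le_of_lt h))) (abs_nonneg _)
      refine h2.congr_of_eventuallyEq ?_
      filter_upwards [Ioi_mem_nhds h] with w hw
      simp only [seeExt]
      exact if_neg (not_le.2 hw)
  by_cases hz : z = 0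
  · subst hz
    exact hasDerivAt_of_hasDerivAt_of_ne hne (hcont j) (hcont (j + 1))
  · exact hne z hz



/-! ### Fourier series of smooth periodic functions -/

def CPer {n : ℕ} {E : Type*} (f : (Fin n → ℝ) → E) : Prop :=
  ∀ (x : Fin n → ℝ) (k : Fin n → ℤ), f (x + fun i => (k i : ℝ)) = f x

theorem div_int {n : ℕ} {E : Type*} [NormedAddCommGroup E] [NormedSpace ℝ E] [CompleteSpace E]
    {f : (Fin n → ℝ) → E} (hf : ContDiff ℝ (⊤ : ℕ∞) f) (hp : CPer f) (i : Fin n) :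
    ∫ x in Set.Icc (0 : Fin n → ℝ) 1, fderiv ℝ f x (Pi.single i 1) = 0 := by
  cases n with
  | zero => exact i.elim0
  | succ n =>
    have hfd : ContDiff ℝ (⊤ : ℕ∞) (fderiv ℝ f) := hf.fderiv_right (le_of_eq rfl)
    have hc : Continuous fun x => fderiv ℝ f x (Pi.single i 1) :=
      hfd.continuous.clm_apply continuous_const
    have hsum : ∀ x, (∑ j, (if j = i then fderiv ℝ f x else 0) (Pi.single j (1:ℝ)))
        = fderiv ℝ f x (Pi.single i 1) := by
      intro x
      rw [Finset.sum_eq_single i]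
      · simp
      · intro j _ hj
        simp [hj]
      · simp
    have h := integral_divergence_of_hasFDerivAt_off_countable' (0 : Fin (n + 1) → ℝ) 1
      (by intro i; simp) (fun j x => if j = i then f x else 0)
      (fun j x => if j = i then fderiv ℝ f x else 0) ∅ Set.countable_empty
      (fun j => by
        by_cases hj : j = i
        · simp only [hj, if_true]; exact hf.continuous.continuousOn
        · simp only [hj, if_false]; exact continuousOn_const)
      (fun x _ j => by
        by_cases hj : j = i
        · simp only [hj, if_true]; exact (smooth_differentiable hf x).hasFDerivAt
        · simp only [hj, if_false]; exact hasFDerivAt_const _ _)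
      (by
        simp only [hsum]
        exact hc.continuousOn.integrableOn_compact isCompact_Icc)
    simp only [hsum] at h
    rw [h]
    refine Finset.sum_eq_zero fun j _ => ?_
    by_cases hj : j = i
    · simp only [hj, if_true]
      rw [sub_eq_zero]
      congr 1
      funext x
      simp only [Pi.one_apply, Pi.zero_apply]
      have := hp (Fin.insertNth i (0:ℝ) x) (Pi.single i 1)
      rw [← this]
      congr 1
      funext l
      refine Fin.succAboveCases i ?_ (fun m => ?_) l
      · simp
      · simp [Pi.single_apply]
    · simp [hj]

def kdot {n : ℕ} (k : Fin n → ℤ) (x : Fin n → ℝ) : ℝ := ∑ i, (k i : ℝ) * x i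

def eK {n : ℕ} (k : Fin n → ℤ) (x : Fin n → ℝ) : ℂ :=
  Complex.exp ((2 * Real.pi * kdot k x : ℝ) * Complex.I)

theorem eK_norm {n : ℕ} (k : Fin n → ℤ) (x : Fin n → ℝ) : ‖eK k x‖ = 1 := by
  unfold eK; exact Complex.norm_exp_ofReal_mul_I _

theorem kdot_smooth {n : ℕ} (k : Fin n → ℤ) : ContDiff ℝ (⊤ : ℕ∞) (kdot k) := by
  unfold kdot
  fun_prop

theorem eK_smooth {n : ℕ} (k : Fin n → ℤ) : ContDiff ℝ (⊤ : ℕ∞) (eK k) := by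
  unfold eK
  have := kdot_smooth k
  have h2 : ContDiff ℝ (⊤ : ℕ∞) fun x => ((2 * Real.pi * kdot k x : ℝ) : ℂ) :=
    Complex.ofRealCLM.contDiff.comp (contDiff_const.mul this)
  exact (h2.mul contDiff_const).cexp

def kdotL {n : ℕ} (k : Fin n → ℤ) : (Fin n → ℝ) →L[ℝ] ℝ :=
  ∑ i, (k i : ℝ) • ContinuousLinearMap.proj (R := ℝ) (φ := fun _ : Fin n => ℝ) i

theorem kdotL_apply {n : ℕ} (k : Fin n → ℤ) (x : Fin n → ℝ) : kdotL k x = kdot k x := by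
  simp [kdotL, kdot]

theorem eK_hasFDerivAt {n : ℕ} (k : Fin n → ℤ) (x : Fin n → ℝ) :
    HasFDerivAt (eK k) ((2 * Real.pi * Complex.I * eK k x) • (Complex.ofRealCLM.comp (kdotL k))) x := by
  have h1 : HasFDerivAt (fun x => ((2 * Real.pi * kdot k x : ℝ) * Complex.I : ℂ))
      ((2 * Real.pi * Complex.I) • (Complex.ofRealCLM.comp (kdotL k))) x := by
    have := ((Complex.ofRealCLM.comp (kdotL k)).hasFDerivAt (x := x)).const_smul (2 * Real.pi * Complex.I)
    refine this.congr_of_eventuallyEq (Filter.Eventually.of_forall fun y => ?_)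
    simp [kdotL_apply]
    ring
  have := h1.cexp
  refine this.congr_fderiv ?_
  rw [smul_smul]
  congr 1
  unfold eK
  ring

theorem eK_fderiv {n : ℕ} (k : Fin n → ℤ) (x : Fin n → ℝ) (i : Fin n) :
    fderiv ℝ (eK k) x (Pi.single i 1) = (cP i k * Complex.I) * eK k x := by
  rw [(eK_hasFDerivAt k x).fderiv]
  simp only [ContinuousLinearMap.smul_apply, ContinuousLinearMap.comp_apply, kdotL_apply]
  have : kdot k (Pi.single i 1) = k i := by
    simp [kdot, Pi.single_apply]
  rw [this]
  simp [cP]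
  ring

theorem eK_add {n : ℕ} (k l : Fin n → ℤ) (x : Fin n → ℝ) : eK (k + l) x = eK k x * eK l x := by
  unfold eK
  rw [← Complex.exp_add]
  congr 1
  simp [kdot, add_mul, Finset.sum_add_distrib]
  ring

theorem eK_per {n : ℕ} (k : Fin n → ℤ) : CPer (eK k) := by
  intro x m
  unfold eK
  have : (((2 * Real.pi * kdot k (x + fun i => (m i : ℝ)) : ℝ) : ℂ) * Complex.I)
      = ((2 * Real.pi * kdot k x : ℝ) : ℂ) * Complex.I + ((∑ i, k i * m i : ℤ) : ℂ) * (2 * Real.pi * Complex.I) := by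
    simp only [kdot, Pi.add_apply, mul_add, Finset.sum_add_distrib]
    push_cast
    ring
  rw [this, Complex.exp_add, Complex.exp_int_mul_two_pi_mul_I, mul_one]

theorem eK_neg {n : ℕ} (k : Fin n → ℤ) (x : Fin n → ℝ) : eK (-k) x = starRingEnd ℂ (eK k x) := by
  unfold eK
  rw [← Complex.exp_conj]
  congr 1
  rw [map_mul, Complex.conj_ofReal, Complex.conj_I]
  simp [kdot]

theorem eK_mFourier {n : ℕ} (k : Fin n → ℤ) (x : Fin n → ℝ) :
    UnitAddTorus.mFourier k (fun i => (x i : UnitAddCircle)) = eK k x := by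
  simp only [UnitAddTorus.mFourier, ContinuousMap.coe_mk, fourier_coe_apply]
  rw [← Complex.exp_sum]
  unfold eK kdot
  congr 1
  push_cast
  rw [Finset.mul_sum, Finset.sum_mul]
  exact Finset.sum_congr rfl fun i _ => by ring

def fc {n : ℕ} (f : (Fin n → ℝ) → ℂ) (k : Fin n → ℤ) : ℂ :=
  ∫ x in Set.Icc (0 : Fin n → ℝ) 1, eK (-k) x * f x

theorem CPer.fderiv {n : ℕ} {f : (Fin n → ℝ) → ℂ} (hp : CPer f) (v : Fin n → ℝ) :
    CPer (fun x => fderiv ℝ f x v) := by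
  intro x k
  have : (fun y => f (y + fun i => (k i : ℝ))) = f := by
    funext y; exact hp y k
  have h2 := fderiv_comp_add_right (𝕜 := ℝ) (f := f) (x := x) (fun i => (k i : ℝ))
  rw [this] at h2
  simp only [h2]

theorem CPer.bounded {n : ℕ} {f : (Fin n → ℝ) → ℂ} (hp : CPer f) (hf : Continuous f) :
    ∃ C, 0 ≤ C ∧ ∀ x, ‖f x‖ ≤ C := by
  obtain ⟨C, hC0, hC⟩ := periodic_bounded' (n := n) (f := fun x => ‖f x‖) (hf.norm)
    (fun x k => by simp only [hp x k])
  exact ⟨C, hC0, fun x => (le_abs_self _).trans (hC x)⟩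

theorem fc_deriv {n : ℕ} {f : (Fin n → ℝ) → ℂ} (hf : ContDiff ℝ (⊤ : ℕ∞) f) (hp : CPer f) (i : Fin n)
    (k : Fin n → ℤ) :
    fc (fun x => fderiv ℝ f x (Pi.single i 1)) k = (cP i k * Complex.I) * fc f k := by
  have hfd : ContDiff ℝ (⊤ : ℕ∞) (fderiv ℝ f) := hf.fderiv_right (le_of_eq rfl)
  have hc : Continuous fun x => fderiv ℝ f x (Pi.single i 1) :=
      hfd.continuous.clm_apply continuous_const
  have hec := (eK_smooth (-k)).continuous
  have h := div_int ((eK_smooth (-k)).mul hf) (fun x m => by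
    simp only [eK_per (-k) x m, hp x m]) i
  have e : ∀ x, fderiv ℝ (fun y => eK (-k) y * f y) x (Pi.single i 1)
      = eK (-k) x * fderiv ℝ f x (Pi.single i 1) - (cP i k * Complex.I) * (eK (-k) x * f x) := by
    intro x
    rw [fderiv_fun_mul (smooth_differentiable (eK_smooth (-k)) x) (smooth_differentiable hf x)]
    simp only [ContinuousLinearMap.add_apply, ContinuousLinearMap.smul_apply, smul_eq_mul, eK_fderiv]
    have : cP i (-k) = - cP i k := by simp [cP]
    rw [this]
    push_cast
    ring
  simp only [e] at h
  rw [integral_sub, integral_const_mul, sub_eq_zero] at h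
  · exact h
  · exact (hec.mul hc).continuousOn.integrableOn_compact isCompact_Icc
  · exact ((hec.mul hf.continuous).const_mul _).continuousOn.integrableOn_compact isCompact_Icc

theorem fc_le {n : ℕ} {f : (Fin n → ℝ) → ℂ} {C : ℝ} (hC : ∀ x, ‖f x‖ ≤ C) (k : Fin n → ℤ) :
    ‖fc f k‖ ≤ C := by
  have h := norm_setIntegral_le_of_norm_le_const (μ := volume) (s := Set.Icc (0 : Fin n → ℝ) 1) (C := C)
    (f := fun x => eK (-k) x * f x)
    (isCompact_Icc.measure_lt_top) (fun x _ => by rw [norm_mul, eK_norm, one_mul]; exact hC x)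
  refine h.trans (le_of_eq ?_)
  rw [Measure.real, Real.volume_Icc_pi]
  simp

theorem fc_rapid {n : ℕ} {f : (Fin n → ℝ) → ℂ} (hf : ContDiff ℝ (⊤ : ℕ∞) f) (hp : CPer f) :
    Rapid (fc f) := by
  intro s
  induction s generalizing f with
  | zero =>
    obtain ⟨C, hC0, hC⟩ := hp.bounded hf.continuous
    exact ⟨C, hC0, fun k => by simpa using fc_le hC k⟩
  | succ s ih =>
    have hfd : ContDiff ℝ (⊤ : ℕ∞) (fderiv ℝ f) := hf.fderiv_right (le_of_eq rfl)
    obtain ⟨C, hC0, hC⟩ := ih hf hp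
    have h2 := fun i => ih (f := fun x => fderiv ℝ f x (Pi.single i 1))
      (hfd.clm_apply contDiff_const) (hp.fderiv _)
    choose D hD0 hD using h2
    refine ⟨C + ∑ i, D i, add_nonneg hC0 (Finset.sum_nonneg fun i _ => hD0 i), fun k => ?_⟩
    have h3 : ∀ i, om k ^ s * (|(k i : ℝ)| * ‖fc f k‖) ≤ D i := by
      intro i
      refine le_trans ?_ (hD i k)
      rw [fc_deriv hf hp, norm_mul, norm_mul, Complex.norm_real, Complex.norm_I, mul_one]
      have hom := om_pos k
      refine mul_le_mul_of_nonneg_left (mul_le_mul_of_nonneg_right ?_ (norm_nonneg _)) (by positivity)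
      rw [cP, Real.norm_eq_abs, abs_mul]
      have h4 : 1 ≤ |2 * Real.pi| := by
        rw [abs_of_pos (by positivity)]
        linarith [Real.pi_gt_three]
      nlinarith [abs_nonneg (k i : ℝ)]
    have h5 : om k = 1 + ∑ i, |(k i : ℝ)| := by simp [om, nk]
    calc om k ^ (s + 1) * ‖fc f k‖ = om k ^ s * ‖fc f k‖ + ∑ i, om k ^ s * (|(k i : ℝ)| * ‖fc f k‖) := by
          rw [← Finset.mul_sum, ← Finset.sum_mul, pow_succ]
          nth_rewrite 2 [h5]
          ring
      _ ≤ C + ∑ i, D i := add_le_add (hC k) (Finset.sum_le_sum fun i _ => h3 i)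

theorem fc_hasSum {n : ℕ} {f : (Fin n → ℝ) → ℂ} (hf : ContDiff ℝ (⊤ : ℕ∞) f) (hp : CPer f)
    (x : Fin n → ℝ) : HasSum (fun k => fc f k * eK k x) (f x) := by
  let π : (Fin n → ℝ) → UnitAddTorus (Fin n) := fun x i => (x i : UnitAddCircle)
  have hq : IsOpenQuotientMap π :=
    IsOpenQuotientMap.piMap (fun i : Fin n => QuotientAddGroup.isOpenQuotientMap_mk)
  have hinv : ∀ x y, π x = π y → f x = f y := by
    intro x y hxy
    have : ∀ i, ∃ m : ℤ, y i = x i + m := by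
      intro i
      have h1 : (x i : UnitAddCircle) = y i := congrFun hxy i
      have h2 : ((y i - x i : ℝ) : UnitAddCircle) = 0 := by
        rw [AddCircle.coe_sub, h1, sub_self]
      obtain ⟨m, hm⟩ := (AddCircle.coe_eq_zero_iff (1:ℝ)).mp h2
      refine ⟨m, ?_⟩
      simp at hm
      linarith
    choose m hm using this
    rw [show y = x + fun i => (m i : ℝ) from funext hm, hp]
  let F : C(UnitAddTorus (Fin n), ℂ) := ⟨fun t => f (Function.surjInv hq.surjective t), by
    rw [hq.isQuotientMap.continuous_iff]
    refine hf.continuous.congr fun x => ?_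
    exact hinv _ _ (Function.surjInv_eq hq.surjective _).symm⟩
  have hF : ∀ x, F (π x) = f x := fun x => hinv _ _ (Function.surjInv_eq hq.surjective _)
  have hco : ∀ k, UnitAddTorus.mFourierCoeff F k = fc f k := by
    intro k
    rw [UnitAddTorus.mFourierCoeff_eq_integral _ _ 0]
    unfold fc
    have hs : {x : Fin n → ℝ | ∀ i, x i ∈ Set.Ioc ((0 : Fin n → ℝ) i) ((0 : Fin n → ℝ) i + 1)}
        = Set.pi Set.univ fun i => Set.Ioc ((0 : Fin n → ℝ) i) ((1 : Fin n → ℝ) i) := by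
      ext x; simp
    have hae : (Set.univ.pi fun i => Set.Ioc ((0 : Fin n → ℝ) i) ((1 : Fin n → ℝ) i))
        =ᵐ[volume] Set.Icc (0 : Fin n → ℝ) 1 := Measure.univ_pi_Ioc_ae_eq_Icc
    rw [hs, setIntegral_congr_set hae]
    congr 1
    funext x
    rw [eK_mFourier, smul_eq_mul]
    congr 1
    exact hF x
  have hsum : Summable (UnitAddTorus.mFourierCoeff F) := by
    have : UnitAddTorus.mFourierCoeff F = fc f := funext hco
    rw [this]
    exact (fc_rapid hf hp).summable.of_norm
  have := UnitAddTorus.hasSum_mFourier_series_apply_of_summable hsum (π x)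
  rw [hF x] at this
  refine this.congr_fun fun k => ?_
  rw [hco, smul_eq_mul, eK_mFourier]

theorem fc_neg {n : ℕ} (f : (Fin n → ℝ) → ℝ) (k : Fin n → ℤ) :
    fc (fun x => (f x : ℂ)) (-k) = starRingEnd ℂ (fc (fun x => (f x : ℂ)) k) := by
  unfold fc
  rw [← integral_conj]
  congr 1
  funext x
  rw [eK_neg (-k)]
  simp



/-! ### Smooth functions from rapidly decaying mode arrays -/

structure GoodArr {n : ℕ} (G : ℕ → ℝ → (Fin n → ℤ) → ℂ) : Prop where
  der : ∀ j k z, HasDerivAt (fun z => G j z k) (G (j + 1) z k) z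
  bd : ∀ j s, ∃ C : ℝ, 0 ≤ C ∧ ∀ k z, om k ^ s * ‖G j z k‖ ≤ C

theorem GoodArr.shift {n : ℕ} {G : ℕ → ℝ → (Fin n → ℤ) → ℂ} (hG : GoodArr G) :
    GoodArr (fun j => G (j + 1)) :=
  ⟨fun j => hG.der (j + 1), fun j => hG.bd (j + 1)⟩

theorem cP_le_om {n : ℕ} (i : Fin n) (k : Fin n → ℤ) : |cP i k| ≤ 2 * Real.pi * om k := by
  have h1 : |(k i : ℝ)| ≤ om k := by
    have : |(k i : ℝ)| ≤ ∑ i, |(k i : ℝ)| :=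
      Finset.single_le_sum (f := fun i => |(k i : ℝ)|) (fun _ _ => abs_nonneg _) (Finset.mem_univ i)
    unfold om nk
    linarith
  unfold cP
  rw [abs_mul, abs_of_pos (by positivity : (0:ℝ) < 2 * Real.pi)]
  exact mul_le_mul_of_nonneg_left h1 (by positivity)

theorem opP_bd {n : ℕ} (i : Fin n) (k : Fin n → ℤ) (f : (Fin n → ℤ) → ℂ) (s : ℕ) :
    om k ^ s * ‖opP i f k‖ ≤ 2 * Real.pi * (om k ^ (s + 1) * ‖f k‖) := by
  unfold opP
  rw [norm_mul, norm_mul, Complex.norm_real, Complex.norm_I, mul_one, Real.norm_eq_abs]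
  have h1 := cP_le_om i k
  have h2 := om_pos k
  calc om k ^ s * (|cP i k| * ‖f k‖) ≤ om k ^ s * ((2 * Real.pi * om k) * ‖f k‖) := by gcongr
    _ = _ := by ring

theorem GoodArr.opP {n : ℕ} {G : ℕ → ℝ → (Fin n → ℤ) → ℂ} (hG : GoodArr G) (i : Fin n) :
    GoodArr (fun j z => opP i (G j z)) := by
  constructor
  · intro j k z
    exact (hG.der j k z).const_mul _
  · intro j s
    obtain ⟨C, hC0, hC⟩ := hG.bd j (s + 1)
    refine ⟨2 * Real.pi * C, by positivity, fun k z => (opP_bd i k (G j z) s).trans ?_⟩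
    exact mul_le_mul_of_nonneg_left (hC k z) (by positivity)

theorem om_inv_summable (n : ℕ) : Summable fun k : Fin n → ℤ => (om k ^ (2 * n))⁻¹ := by
  obtain ⟨S, hS0, hS⟩ := om_sum_bound n
  exact summable_of_sum_le (fun k => by have := om_pos k; positivity) hS

theorem GoodArr.unif {n : ℕ} {G : ℕ → ℝ → (Fin n → ℤ) → ℂ} (hG : GoodArr G) :
    ∃ C : ℝ, 0 ≤ C ∧ ∀ k z, ‖G 0 z k‖ ≤ C * (om k ^ (2 * n))⁻¹ := by
  obtain ⟨C, hC0, hC⟩ := hG.bd 0 (2 * n)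
  refine ⟨C, hC0, fun k z => ?_⟩
  have := om_pos k
  rw [← div_eq_mul_inv, le_div_iff₀ (by positivity), mul_comm]
  exact hC k z

def TG {n : ℕ} (G : ℕ → ℝ → (Fin n → ℤ) → ℂ) (p : (Fin n → ℝ) × ℝ) : ℂ :=
  ∑' k, G 0 p.2 k * eK k p.1

theorem GoodArr.summable {n : ℕ} {G : ℕ → ℝ → (Fin n → ℤ) → ℂ} (hG : GoodArr G) (p : (Fin n → ℝ) × ℝ) :
    Summable fun k => G 0 p.2 k * eK k p.1 := by
  obtain ⟨C, hC0, hC⟩ := hG.unif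
  refine Summable.of_norm_bounded ((om_inv_summable n).mul_left C) fun k => ?_
  rw [norm_mul, eK_norm, mul_one]
  exact hC k p.2

def XL (n : ℕ) (i : Fin n) : ((Fin n → ℝ) × ℝ) →L[ℝ] ℂ :=
  Complex.ofRealCLM.comp ((ContinuousLinearMap.proj (R := ℝ) (φ := fun _ : Fin n => ℝ) i).comp
    (ContinuousLinearMap.fst ℝ (Fin n → ℝ) ℝ))

def YL (n : ℕ) : ((Fin n → ℝ) × ℝ) →L[ℝ] ℂ :=
  Complex.ofRealCLM.comp (ContinuousLinearMap.snd ℝ (Fin n → ℝ) ℝ)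

theorem TG_term {n : ℕ} {G : ℕ → ℝ → (Fin n → ℤ) → ℂ} (hG : GoodArr G) (k : Fin n → ℤ)
    (p : (Fin n → ℝ) × ℝ) :
    HasFDerivAt (fun p : (Fin n → ℝ) × ℝ => G 0 p.2 k * eK k p.1)
      ((∑ i, (opP i (G 0 p.2) k * eK k p.1) • XL n i) + (G 1 p.2 k * eK k p.1) • YL n) p := by
  have h1 : HasFDerivAt (fun p : (Fin n → ℝ) × ℝ => eK k p.1) _ p :=
    (eK_hasFDerivAt k p.1).comp p (hasFDerivAt_fst (𝕜 := ℝ))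
  have h2 : HasFDerivAt (fun p : (Fin n → ℝ) × ℝ => G 0 p.2 k) _ p :=
    ((hG.der 0 k p.2).hasFDerivAt).comp p (hasFDerivAt_snd (𝕜 := ℝ))
  refine (h2.mul h1).congr_fderiv ?_
  refine ContinuousLinearMap.ext fun v => ?_
  simp [XL, YL, kdotL_apply, kdot, opP, cP, Finset.mul_sum]
  congr 1
  · refine Finset.sum_congr rfl fun i _ => ?_
    ring
  · ring

theorem TG_hasFDerivAt {n : ℕ} {G : ℕ → ℝ → (Fin n → ℤ) → ℂ} (hG : GoodArr G)
    (p : (Fin n → ℝ) × ℝ) :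
    HasFDerivAt (TG G) ((∑ i, TG (fun j z => opP i (G j z)) p • XL n i)
      + TG (fun j => G (j + 1)) p • YL n) p := by
  choose C hC0 hC using fun i => (hG.opP i).unif
  obtain ⟨D, hD0, hD⟩ := hG.shift.unif
  have hs := om_inv_summable n
  have := hasFDerivAt_tsum (𝕜 := ℝ) (u := fun k => (∑ i, C i * (om k ^ (2 * n))⁻¹ * ‖XL n i‖)
      + D * (om k ^ (2 * n))⁻¹ * ‖YL n‖) (x₀ := p)
    (Summable.add (summable_sum fun i _ => (hs.mul_left _).mul_right _) ((hs.mul_left _).mul_right _))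
    (fun k p => TG_term hG k p) (fun k p => by
      refine (norm_add_le _ _).trans (add_le_add ((norm_sum_le _ _).trans
        (Finset.sum_le_sum fun i _ => ?_)) ?_)
      · rw [norm_smul, norm_mul, eK_norm, mul_one]
        exact mul_le_mul_of_nonneg_right (hC i k p.2) (norm_nonneg _)
      · rw [norm_smul, norm_mul, eK_norm, mul_one]
        exact mul_le_mul_of_nonneg_right (hD k p.2) (norm_nonneg _))
    (hG.summable p) p
  refine this.congr_fderiv ?_
  have s1 : ∀ i, Summable fun k => opP i (G 0 p.2) k * eK k p.1 := fun i => (hG.opP i).summable p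
  have s2 : Summable fun k => G 1 p.2 k * eK k p.1 := hG.shift.summable p
  rw [Summable.tsum_add (summable_sum fun i _ => (s1 i).smul_const _) (s2.smul_const _),
    Summable.tsum_finsetSum (fun i _ => (s1 i).smul_const _), s2.tsum_smul_const]
  congr 1
  refine Finset.sum_congr rfl fun i _ => ?_
  rw [(s1 i).tsum_smul_const]
  rfl

theorem TG_contDiff_nat {n : ℕ} (m : ℕ) : ∀ {G : ℕ → ℝ → (Fin n → ℤ) → ℂ}, GoodArr G →
    ContDiff ℝ m (TG G) := by
  induction m with
  | zero =>
    intro G hG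
    rw [Nat.cast_zero, contDiff_zero, continuous_iff_continuousAt]
    exact fun p => (TG_hasFDerivAt hG p).continuousAt
  | succ m ih =>
    intro G hG
    rw [Nat.cast_succ, contDiff_succ_iff_hasFDerivAt]
    refine ⟨_, ?_, TG_hasFDerivAt hG⟩
    exact (ContDiff.sum fun i _ => (ih (hG.opP i)).smul contDiff_const).add
      ((ih hG.shift).smul contDiff_const)

theorem TG_contDiff {n : ℕ} {G : ℕ → ℝ → (Fin n → ℤ) → ℂ} (hG : GoodArr G) :
    ContDiff ℝ (⊤ : ℕ∞) (TG G) := contDiff_infty.2 fun m => TG_contDiff_nat m hG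

def UG {n : ℕ} (G : ℕ → ℝ → (Fin n → ℤ) → ℂ) (p : (Fin n → ℝ) × ℝ) : ℝ := (TG G p).re

theorem UG_contDiff {n : ℕ} {G : ℕ → ℝ → (Fin n → ℤ) → ℂ} (hG : GoodArr G) :
    ContDiff ℝ (⊤ : ℕ∞) (UG G) := Complex.reCLM.contDiff.comp (TG_contDiff hG)

theorem UG_hasFDerivAt {n : ℕ} {G : ℕ → ℝ → (Fin n → ℤ) → ℂ} (hG : GoodArr G)
    (p : (Fin n → ℝ) × ℝ) :
    HasFDerivAt (UG G) (Complex.reCLM.comp ((∑ i, TG (fun j z => opP i (G j z)) p • XL n i)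
      + TG (fun j => G (j + 1)) p • YL n)) p :=
  Complex.reCLM.hasFDerivAt.comp p (TG_hasFDerivAt hG p)

theorem UG_pdX {n : ℕ} {G : ℕ → ℝ → (Fin n → ℤ) → ℂ} (hG : GoodArr G) (i : Fin n) :
    pdE n (UG G) (eX n i) = UG (fun j z => opP i (G j z)) := by
  funext p
  unfold pdE
  rw [(UG_hasFDerivAt hG p).fderiv]
  simp [XL, YL, eX, UG, Pi.single_apply]

theorem UG_pdY {n : ℕ} {G : ℕ → ℝ → (Fin n → ℤ) → ℂ} (hG : GoodArr G) :
    pdE n (UG G) (eY n) = UG (fun j => G (j + 1)) := by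
  funext p
  unfold pdE
  rw [(UG_hasFDerivAt hG p).fderiv]
  simp [XL, YL, eY, UG]

theorem UG_per {n : ℕ} (G : ℕ → ℝ → (Fin n → ℤ) → ℂ) : ZPeriodicE n (UG G) := by
  intro x y k
  unfold UG TG
  simp only [eK_per _ x k]

/-- extension of half arrays -/
def extG {n : ℕ} (G : ℕ → ℝ → (Fin n → ℤ) → ℂ) (j : ℕ) (z : ℝ) (k : Fin n → ℤ) : ℂ :=
  seeExt (fun j z => G j z k) j z

theorem extG_eq {n : ℕ} (G : ℕ → ℝ → (Fin n → ℤ) → ℂ) (j : ℕ) {z : ℝ} (hz : z ≤ 0) :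
    extG G j z = G j z := by
  funext k
  exact if_pos hz

theorem HalfArr.good {n : ℕ} {δ : ℝ} (hδ : 0 ≤ δ) {G : ℕ → ℝ → (Fin n → ℤ) → ℂ} (hG : HalfArr δ G) :
    GoodArr (extG G) := by
  have hb : ∀ j s, ∃ C : ℝ, 0 ≤ C ∧ ∀ k, ∀ z ≤ 0, om k ^ s * ‖G j z k‖ ≤ C := by
    intro j s
    obtain ⟨C, hC0, hC⟩ := hG.bd j s
    refine ⟨C, hC0, fun k z hz => (hC k z hz).trans ?_⟩
    have : Real.exp (δ * z) ≤ 1 := Real.exp_le_one_iff.2 (mul_nonpos_of_nonneg_of_nonpos hδ hz)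
    nlinarith
  constructor
  · intro j k z
    refine seeExt_deriv (f := fun j z => G j z k) (fun j z hz => hG.der j k z hz) (fun j => ?_) j z
    obtain ⟨C, hC0, hC⟩ := hb j 0
    exact ⟨C, fun z hz => by simpa using hC k z hz⟩
  · intro j s
    obtain ⟨C, hC0, hC⟩ := hb j s
    refine ⟨seeN j * C, mul_nonneg (zero_le_one.trans (seeN_one_le j)) hC0, fun k z => ?_⟩
    have hom : 0 < om k ^ s := pow_pos (om_pos k) s
    have := seeExt_bound (f := fun j z => G j z k) (j := j) (C := C / om k ^ s) (fun z hz => by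
      rw [le_div_iff₀ hom, mul_comm]
      exact hC k z hz) z
    calc om k ^ s * ‖extG G j z k‖ ≤ om k ^ s * (seeN j * (C / om k ^ s)) :=
          mul_le_mul_of_nonneg_left this hom.le
      _ = seeN j * C := by field_simp

theorem HalfArr.UG_bound {n : ℕ} {δ : ℝ} {G : ℕ → ℝ → (Fin n → ℤ) → ℂ} (hG : HalfArr δ G) :
    ∃ C : ℝ, 0 ≤ C ∧ ∀ x, ∀ z ≤ 0, |UG (extG G) (x, z)| ≤ C * Real.exp (δ * z) := by
  obtain ⟨C, hC0, hC⟩ := hG.bd 0 (2 * n)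
  refine ⟨C * ∑' k : Fin n → ℤ, (om k ^ (2 * n))⁻¹, mul_nonneg hC0 (tsum_nonneg fun k => by
    have := om_pos k; positivity), fun x z hz => ?_⟩
  have h1 : ‖TG (extG G) (x, z)‖ ≤ ∑' k : Fin n → ℤ, C * Real.exp (δ * z) * (om k ^ (2 * n))⁻¹ := by
    refine tsum_of_norm_bounded (((om_inv_summable n).mul_left _).hasSum) fun k => ?_
    rw [norm_mul, eK_norm, mul_one]
    simp only [extG_eq G 0 hz]
    have := om_pos k
    rw [← div_eq_mul_inv, le_div_iff₀ (by positivity), mul_comm]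
    exact hC k z hz
  rw [tsum_mul_left] at h1
  refine (Complex.abs_re_le_norm _).trans (h1.trans (le_of_eq (by ring)))

def convE (n : ℕ) : (Fin n → ℤ) × (Fin n → ℤ) ≃ (Fin n → ℤ) × (Fin n → ℤ) where
  toFun z := (z.1 - z.2, z.2)
  invFun z := (z.1 + z.2, z.2)
  left_inv z := by simp
  right_inv z := by simp

theorem conv_tsum_aux {n : ℕ} {f g : (Fin n → ℤ) → ℂ} (hf : Summable fun k => ‖f k‖)
    (hg : Summable fun k => ‖g k‖) (x : Fin n → ℝ) :
    HasSum (fun z : (Fin n → ℤ) × (Fin n → ℤ) => f (z.1 - z.2) * g z.2 * eK z.1 x)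
      ((∑' k, f k * eK k x) * ∑' k, g k * eK k x) := by
  have hf' : Summable fun k => ‖f k * eK k x‖ := by
    refine hf.congr fun k => ?_
    rw [norm_mul, eK_norm, mul_one]
  have hg' : Summable fun k => ‖g k * eK k x‖ := by
    refine hg.congr fun k => ?_
    rw [norm_mul, eK_norm, mul_one]
  have h2 : HasSum (fun z : (Fin n → ℤ) × (Fin n → ℤ) => (f z.1 * eK z.1 x) * (g z.2 * eK z.2 x))
      ((∑' k, f k * eK k x) * ∑' k, g k * eK k x) := by
    rw [tsum_mul_tsum_of_summable_norm hf' hg']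
    exact (summable_mul_of_summable_norm hf' hg').hasSum
  have h3 := (convE n).hasSum_iff.2 h2
  refine h3.congr_fun fun z => ?_
  have h5 : eK z.1 x = eK (z.1 - z.2) x * eK z.2 x := by rw [← eK_add, sub_add_cancel]
  rw [h5]
  show _ = (f (z.1 - z.2) * eK (z.1 - z.2) x) * (g z.2 * eK z.2 x)
  ring

theorem conv_tsum {n : ℕ} {f g : (Fin n → ℤ) → ℂ} (hf : Summable fun k => ‖f k‖)
    (hg : Summable fun k => ‖g k‖) (x : Fin n → ℝ) :
    HasSum (fun k => (∑' l, f (k - l) * g l) * eK k x)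
      ((∑' k, f k * eK k x) * ∑' k, g k * eK k x) := by
  have h3 := conv_tsum_aux hf hg x
  have h5 : ∀ k, HasSum (fun l => f (k - l) * g l * eK k x) ((∑' l, f (k - l) * g l) * eK k x) := by
    intro k
    have h6 : Summable fun l => f (k - l) * g l * eK k x := h3.summable.prod_factor k
    have := h6.hasSum
    rwa [tsum_mul_right] at this
  exact HasSum.prod_fiberwise h3 h5



/-! ### Existence of harmonic extensions -/

theorem UG_conv {n : ℕ} {β : Fin n → (Fin n → ℝ) → ℝ} (hβ : ∀ i, ContDiff ℝ (⊤ : ℕ∞) (β i))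
    (hp : ∀ i, ZPeriodic n (β i)) {A B : ℕ → ℝ → (Fin n → ℤ) → ℂ}
    {W : Fin n → ℕ → ℝ → (Fin n → ℤ) → ℂ} (s : Finset (Fin n))
    (hB : GoodArr B) (hW : ∀ i, GoodArr (W i)) (z : ℝ)
    (h : ∀ k, A 0 z k = B 0 z k - ∑ i ∈ s, ∑' l, fc (fun x => (β i x : ℂ)) (k - l) * W i 0 z l)
    (x : Fin n → ℝ) :
    UG A (x, z) = UG B (x, z) - ∑ i ∈ s, β i x * UG (W i) (x, z) := by
  have hb : ∀ i, ContDiff ℝ (⊤ : ℕ∞) fun x => (β i x : ℂ) := fun i =>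
    Complex.ofRealCLM.contDiff.comp (hβ i)
  have hbp : ∀ i, CPer fun x => (β i x : ℂ) := fun i x k => by simp only [hp i x k]
  have h1 : ∀ i, HasSum (fun k => (∑' l, fc (fun x => (β i x : ℂ)) (k - l) * W i 0 z l) * eK k x)
      ((β i x : ℂ) * TG (W i) (x, z)) := by
    intro i
    have hw : Summable fun k => ‖W i 0 z k‖ := by
      have := ((hW i).summable (0, z)).norm
      refine this.congr fun k => ?_
      rw [norm_mul, eK_norm, mul_one]
    have := conv_tsum (fc_rapid (hb i) (hbp i)).summable hw x
    rwa [(fc_hasSum (hb i) (hbp i) x).tsum_eq] at this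
  have h2 : HasSum (fun k => A 0 z k * eK k x)
      (TG B (x, z) - ∑ i ∈ s, (β i x : ℂ) * TG (W i) (x, z)) := by
    have := (hB.summable (x, z)).hasSum.sub (hasSum_sum fun i (_ : i ∈ s) => h1 i)
    refine this.congr_fun fun k => ?_
    rw [h k, sub_mul, Finset.sum_mul]
  unfold UG
  have h3 : TG A (x, z) = TG B (x, z) - ∑ i ∈ s, (β i x : ℂ) * TG (W i) (x, z) := h2.tsum_eq
  rw [h3, Complex.sub_re, Complex.re_sum]
  congr 1
  refine Finset.sum_congr rfl fun i _ => ?_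
  rw [Complex.re_ofReal_mul]

def flat {n : ℕ} (h : (Fin n → ℝ) → ℝ) (p : (Fin n → ℝ) × ℝ) : (Fin n → ℝ) × ℝ := (p.1, p.2 - h p.1)

theorem flat_contDiff {n : ℕ} {h : (Fin n → ℝ) → ℝ} (hh : ContDiff ℝ (⊤ : ℕ∞) h) :
    ContDiff ℝ (⊤ : ℕ∞) (flat h) :=
  contDiff_fst.prodMk (contDiff_snd.sub (hh.comp contDiff_fst))

theorem flat_fderiv {n : ℕ} {h : (Fin n → ℝ) → ℝ} (hh : ContDiff ℝ (⊤ : ℕ∞) h)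
    (p v : (Fin n → ℝ) × ℝ) : fderiv ℝ (flat h) p v = (v.1, v.2 - fderiv ℝ h p.1 v.1) := by
  have h1 : HasFDerivAt (fun p : (Fin n → ℝ) × ℝ => h p.1) _ p :=
    (smooth_differentiable hh p.1).hasFDerivAt.comp p (hasFDerivAt_fst (𝕜 := ℝ))
  have h2 : HasFDerivAt (flat h) _ p :=
    (hasFDerivAt_fst (𝕜 := ℝ)).prodMk ((hasFDerivAt_snd (𝕜 := ℝ)).sub h1)
  rw [h2.fderiv]
  simp

theorem flat_pdE {n : ℕ} {h : (Fin n → ℝ) → ℝ} (hh : ContDiff ℝ (⊤ : ℕ∞) h)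
    {F : (Fin n → ℝ) × ℝ → ℝ} (hF : ContDiff ℝ (⊤ : ℕ∞) F) (p v : (Fin n → ℝ) × ℝ) :
    pdE n (fun p => F (flat h p)) v p = pdE n F (v.1, v.2 - fderiv ℝ h p.1 v.1) (flat h p) := by
  unfold pdE
  have := ((smooth_differentiable hF (flat h p)).hasFDerivAt.comp p
    (smooth_differentiable (flat_contDiff hh) p).hasFDerivAt).fderiv
  have e : (fun p => F (flat h p)) = F ∘ flat h := rfl
  rw [e, this, ContinuousLinearMap.comp_apply, flat_fderiv hh]

theorem flat_pdY {n : ℕ} {h : (Fin n → ℝ) → ℝ} (hh : ContDiff ℝ (⊤ : ℕ∞) h)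
    {F : (Fin n → ℝ) × ℝ → ℝ} (hF : ContDiff ℝ (⊤ : ℕ∞) F) (p : (Fin n → ℝ) × ℝ) :
    pdE n (fun p => F (flat h p)) (eY n) p = pdE n F (eY n) (flat h p) := by
  rw [flat_pdE hh hF]
  simp [eY]

theorem flat_pdX {n : ℕ} {h : (Fin n → ℝ) → ℝ} (hh : ContDiff ℝ (⊤ : ℕ∞) h)
    {F : (Fin n → ℝ) × ℝ → ℝ} (hF : ContDiff ℝ (⊤ : ℕ∞) F) (p : (Fin n → ℝ) × ℝ) (i : Fin n) :
    pdE n (fun p => F (flat h p)) (eX n i) p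
      = pdE n F (eX n i) (flat h p) - pdX n h i p.1 * pdE n F (eY n) (flat h p) := by
  rw [flat_pdE hh hF]
  have : (((eX n i).1, (eX n i).2 - fderiv ℝ h p.1 (eX n i).1) : (Fin n → ℝ) × ℝ)
      = eX n i - (pdX n h i p.1) • eY n := by
    ext <;> simp [eX, eY, pdX]
  unfold pdE at *
  rw [this, map_sub, map_smul, smul_eq_mul]

theorem pdE_congr {n : ℕ} {F G : (Fin n → ℝ) × ℝ → ℝ} {p : (Fin n → ℝ) × ℝ}
    (h : F =ᶠ[nhds p] G) (v : (Fin n → ℝ) × ℝ) : pdE n F v p = pdE n G v p := by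
  unfold pdE
  rw [h.fderiv_eq]

theorem nhds_below {n : ℕ} {h : (Fin n → ℝ) → ℝ} (hh : Continuous h) {p : (Fin n → ℝ) × ℝ}
    (hp : p.2 < h p.1) : ∀ᶠ q : (Fin n → ℝ) × ℝ in nhds p, q.2 < h q.1 :=
  (isOpen_lt continuous_snd (hh.comp continuous_fst)).mem_nhds hp

theorem exp_integrable (n : ℕ) {h : (Fin n → ℝ) → ℝ} {H : ℝ} (hH : ∀ x, |h x| ≤ H)
    {δ : ℝ} (hδ : 0 < δ) :
    IntegrableOn (fun p : (Fin n → ℝ) × ℝ => Real.exp (δ * p.2)) (fluidCell n h) := by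
  have h1 : IntegrableOn (fun y : ℝ => Real.exp (δ * y)) (Set.Iic H) :=
    (integrableOn_Iic_iff_integrableOn_Iio).2 (by
      have := integrableOn_exp_mul_Iic hδ H
      exact this.mono_set Set.Iio_subset_Iic_self)
  have h2 : IntegrableOn (fun _ : Fin n → ℝ => (1:ℝ)) (cubeX n) :=
    continuous_const.continuousOn.integrableOn_compact (cubeX_compact n)
  have h3 : IntegrableOn (fun p : (Fin n → ℝ) × ℝ => (1:ℝ) * Real.exp (δ * p.2))
      (cubeX n ×ˢ Set.Iic H) := by
    unfold IntegrableOn at *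
    rw [Measure.volume_eq_prod, ← Measure.prod_restrict]
    exact h2.mul_prod h1
  simp only [one_mul] at h3
  refine h3.mono_set fun p hp => ⟨fun i hi => Set.Ico_subset_Icc_self (hp.1 i hi), ?_⟩
  exact hp.2.le.trans ((le_abs_self _).trans (hH p.1))

theorem harmonic_exists {n : ℕ} {h ψ : (Fin n → ℝ) → ℝ} (hh : ContDiff ℝ (⊤ : ℕ∞) h)
    (hp : ZPeriodic n h) (hψ : ContDiff ℝ (⊤ : ℕ∞) ψ) (hψp : ZPeriodic n ψ) :
    ∃ φ, IsHarmonicExt n h ψ φ ∧ ∃ C : ℝ, 0 ≤ C ∧ ∀ p : (Fin n → ℝ) × ℝ, p.2 ≤ h p.1 →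
      |φ p| ≤ C ∧ (∀ i, |pdE n φ (eX n i) p| ≤ C) ∧ |pdE n φ (eY n) p| ≤ C := by
  have hβ : ∀ i, ContDiff ℝ (⊤ : ℕ∞) (pdX n h i) := fun i => pdX_contDiff hh i
  have hβp : ∀ i, ZPeriodic n (pdX n h i) := fun i => hp.pdX i
  have hbC : ∀ i, ContDiff ℝ (⊤ : ℕ∞) fun x => (pdX n h i x : ℂ) := fun i =>
    Complex.ofRealCLM.contDiff.comp (hβ i)
  have hbp : ∀ i, CPer fun x => (pdX n h i x : ℂ) := fun i x k => by simp only [hβp i x k]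
  have hψC : ContDiff ℝ (⊤ : ℕ∞) fun x => (ψ x : ℂ) := Complex.ofRealCLM.contDiff.comp hψ
  have hψcp : CPer fun x => (ψ x : ℂ) := fun x k => by simp only [hψp x k]
  obtain ⟨δ, hδ, v, q, d, hv, hv1, hq, hd, hv0, heq⟩ := half_modes
    (b := fun i => fc (fun x => (pdX n h i x : ℂ))) (ψ := fc (fun x => (ψ x : ℂ)))
    (fun i m => fc_neg _ m) (fun i => fc_rapid (hbC i) (hbp i)) (fc_rapid hψC hψcp)
  have gv := hv.good le_rfl
  have gv1 := hv1.good hδ.le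
  have gq := hq.good hδ.le
  have gd := fun i => (hd i).good hδ.le
  -- relations on the half space
  have r1 : ∀ i x, ∀ z ≤ 0, UG (extG (d i)) (x, z)
      = pdE n (UG (extG v)) (eX n i) (x, z) - pdX n h i x * pdE n (UG (extG v)) (eY n) (x, z) := by
    intro i x z hz
    rw [UG_pdX gv, UG_pdY gv]
    have := UG_conv (β := fun i => pdX n h i) hβ hβp (A := extG (d i))
      (B := fun j z => opP i (extG v j z)) (W := fun _ j => extG v (j + 1)) {i} (gv.opP i)
      (fun _ => gv.shift) z (fun k => by
        rw [extG_eq _ _ hz, extG_eq _ _ hz, extG_eq _ _ hz, Finset.sum_singleton]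
        exact (heq z hz k).1 i) x
    rwa [Finset.sum_singleton] at this
  have r2 : ∀ x, ∀ z ≤ 0, UG (extG q) (x, z)
      = pdE n (UG (extG v)) (eY n) (x, z) - ∑ i, pdX n h i x * UG (extG (d i)) (x, z) := by
    intro x z hz
    rw [UG_pdY gv]
    exact UG_conv (β := fun i => pdX n h i) hβ hβp (A := extG q)
      (B := fun j => extG v (j + 1)) (W := fun i => extG (d i)) Finset.univ gv.shift
      gd z (fun k => by
        simp only [extG_eq _ _ hz]
        exact (heq z hz k).2.1) x
  have r3 : ∀ x, ∀ z ≤ 0, pdE n (UG (extG q)) (eY n) (x, z)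
      = - ∑ i, pdE n (UG (extG (d i))) (eX n i) (x, z) := by
    intro x z hz
    rw [UG_pdY gq]
    simp only [UG_pdX (gd _)]
    have : TG (fun j => extG q (j + 1)) (x, z)
        = - ∑ i, TG (fun j z => opP i (extG (d i) j z)) (x, z) := by
      have h1 := (hasSum_sum fun i (_ : i ∈ Finset.univ) => (((gd i).opP i).summable (x, z)).hasSum).neg
      refine (h1.congr_fun fun k => ?_).tsum_eq
      simp only [extG_eq _ _ hz]
      rw [(heq z hz k).2.2, neg_mul, Finset.sum_mul]
    unfold UG
    rw [this, Complex.neg_re, Complex.re_sum]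
  let u := UG (extG v)
  have hu : ContDiff ℝ (⊤ : ℕ∞) u := UG_contDiff gv
  have hud : ∀ i, ContDiff ℝ (⊤ : ℕ∞) (UG (extG (d i))) := fun i => UG_contDiff (gd i)
  have huq : ContDiff ℝ (⊤ : ℕ∞) (UG (extG q)) := UG_contDiff gq
  let φ : (Fin n → ℝ) × ℝ → ℝ := fun p => u (flat h p)
  have hφ : ContDiff ℝ (⊤ : ℕ∞) φ := hu.comp (flat_contDiff hh)
  have hφX : ∀ i (p : (Fin n → ℝ) × ℝ), p.2 ≤ h p.1 → pdE n φ (eX n i) p = UG (extG (d i)) (flat h p) := by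
    intro i p hp
    rw [flat_pdX hh hu]
    exact (r1 i p.1 _ (sub_nonpos.2 hp)).symm
  have hφY : pdE n φ (eY n) = fun p => pdE n u (eY n) (flat h p) := by
    funext p
    exact flat_pdY hh hu p
  have hφYb : ∀ p : (Fin n → ℝ) × ℝ, p.2 ≤ h p.1 →
      pdE n φ (eY n) p = UG (extG (fun j => v (j + 1))) (flat h p) := by
    intro p hp
    rw [hφY]
    show pdE n (UG (extG v)) (eY n) (flat h p) = _
    rw [UG_pdY gv]
    unfold UG TG
    have hz : (flat h p).2 ≤ 0 := sub_nonpos.2 hp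
    simp only [extG_eq _ _ hz]
  -- harmonicity
  have hharm : ∀ p : (Fin n → ℝ) × ℝ, p.2 < h p.1 → lapE n φ p = 0 := by
    intro p hpp
    have hev := nhds_below hh.continuous hpp
    have hz : (flat h p).2 < 0 := sub_neg.2 hpp
    have e1 : ∀ i, pdE n (pdE n φ (eX n i)) (eX n i) p
        = pdE n (UG (extG (d i))) (eX n i) (flat h p)
          - pdX n h i p.1 * pdE n (UG (extG (d i))) (eY n) (flat h p) := by
      intro i
      rw [pdE_congr (hev.mono fun q hq => hφX i q hq.le), flat_pdX hh (hud i)]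
    have e2 : pdE n (pdE n φ (eY n)) (eY n) p = pdE n (pdE n u (eY n)) (eY n) (flat h p) := by
      rw [hφY, flat_pdY hh (pdE_contDiff hu _)]
    have e3 : pdE n (UG (extG q)) (eY n) (flat h p) = pdE n (pdE n u (eY n)) (eY n) (flat h p)
        - ∑ i, pdX n h i p.1 * pdE n (UG (extG (d i))) (eY n) (flat h p) := by
      have a1 := hasDerivAt_y huq p.1 (flat h p).2
      have a2 := (hasDerivAt_y (pdE_contDiff hu (eY n)) p.1 (flat h p).2).sub
        (HasDerivAt.fun_sum fun i (_ : i ∈ Finset.univ) =>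
          (hasDerivAt_y (hud i) p.1 (flat h p).2).const_mul (pdX n h i p.1))
      refine a1.unique (a2.congr_of_eventuallyEq ?_)
      filter_upwards [Iio_mem_nhds hz] with z hz'
      exact r2 p.1 z (le_of_lt hz')
    have e4 := r3 p.1 (flat h p).2 hz.le
    unfold lapE
    rw [e2, Finset.sum_congr rfl fun i _ => e1 i, Finset.sum_sub_distrib]
    have e5 : ((p.1, (flat h p).2) : (Fin n → ℝ) × ℝ) = flat h p := rfl
    rw [e5] at e4
    linarith
  obtain ⟨H, hH0, hH⟩ := periodic_bounded' hh.continuous hp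
  obtain ⟨C0, hC0, hb0⟩ := hv.UG_bound
  obtain ⟨C1, hC1, hb1⟩ := hv1.UG_bound
  choose D hD0 hbD using fun i => (hd i).UG_bound
  have bX : ∀ i (p : (Fin n → ℝ) × ℝ), p.2 ≤ h p.1 →
      |pdE n φ (eX n i) p| ≤ D i * Real.exp (δ * (p.2 - h p.1)) := by
    intro i p hp
    rw [hφX i p hp]
    exact hbD i p.1 _ (sub_nonpos.2 hp)
  have bY : ∀ (p : (Fin n → ℝ) × ℝ), p.2 ≤ h p.1 →
      |pdE n φ (eY n) p| ≤ C1 * Real.exp (δ * (p.2 - h p.1)) := by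
    intro p hp
    rw [hφYb p hp]
    exact hb1 p.1 _ (sub_nonpos.2 hp)
  refine ⟨φ, ⟨hφ, ?_, hharm, ?_, ?_⟩, C0 + C1 + ∑ i, D i, ?_, ?_⟩
  · intro x y k
    show u (_, _) = u (_, _)
    simp only [hp x k]
    exact UG_per (extG v) x _ k
  · intro x
    show UG (extG v) (x, h x - h x) = ψ x
    rw [sub_self]
    have : TG (extG v) (x, 0) = ψ x := by
      refine HasSum.tsum_eq ?_
      refine (fc_hasSum hψC hψcp x).congr_fun fun k => ?_
      simp only [extG_eq _ _ (le_refl (0:ℝ)), hv0]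
    unfold UG
    rw [this, Complex.ofReal_re]
  · have hm : MeasurableSet (fluidCell n h) := by
      refine MeasurableSet.inter ?_ (isOpen_lt continuous_snd (hh.continuous.comp continuous_fst)).measurableSet
      exact measurable_fst (MeasurableSet.univ_pi fun _ => measurableSet_Ico)
    have hc : Continuous (gradSqE n φ) := by
      unfold gradSqE
      refine (continuous_finsetSum _ fun i _ => ?_).add ?_
      · exact (pdE_contDiff hφ _).continuous.pow 2
      · exact (pdE_contDiff hφ _).continuous.pow 2
    have hintg := (exp_integrable n hH (by positivity : 0 < 2 * δ)).const_mul
      (((∑ i, D i ^ 2) + C1 ^ 2) * Real.exp (2 * δ * H))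
    refine Integrable.mono' hintg hc.aestronglyMeasurable ?_
    filter_upwards [self_mem_ae_restrict hm] with p hpp
    have hle : p.2 ≤ h p.1 := hpp.2.le
    have key : ∀ a c : ℝ, |a| ≤ c * Real.exp (δ * (p.2 - h p.1)) → 
        a ^ 2 ≤ c ^ 2 * (Real.exp (2 * δ * H) * Real.exp (2 * δ * p.2)) := by
      intro a c hac
      have h1 : a ^ 2 ≤ (c * Real.exp (δ * (p.2 - h p.1))) ^ 2 := sq_le_sq.2 (hac.trans (le_abs_self _))
      refine h1.trans ?_
      rw [mul_pow, ← Real.exp_nat_mul, ← Real.exp_add]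
      refine mul_le_mul_of_nonneg_left (Real.exp_le_exp.2 ?_) (sq_nonneg _)
      have := (abs_le.1 (hH p.1)).1
      push_cast
      nlinarith
    have hnn : 0 ≤ gradSqE n φ p := by
      unfold gradSqE
      exact add_nonneg (Finset.sum_nonneg fun _ _ => sq_nonneg _) (sq_nonneg _)
    rw [Real.norm_eq_abs, abs_of_nonneg hnn]
    unfold gradSqE
    calc _ ≤ (∑ i, D i ^ 2 * (Real.exp (2 * δ * H) * Real.exp (2 * δ * p.2)))
          + C1 ^ 2 * (Real.exp (2 * δ * H) * Real.exp (2 * δ * p.2)) :=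
          add_le_add (Finset.sum_le_sum fun i _ => key _ _ (bX i p hle)) (key _ _ (bY p hle))
      _ = _ := by rw [← Finset.sum_mul]; ring
  · exact add_nonneg (add_nonneg hC0 hC1) (Finset.sum_nonneg fun i _ => hD0 i)
  · intro p hpp
    have hexp : Real.exp (δ * (p.2 - h p.1)) ≤ 1 :=
      Real.exp_le_one_iff.2 (mul_nonpos_of_nonneg_of_nonpos hδ.le (sub_nonpos.2 hpp))
    have hs : 0 ≤ ∑ i, D i := Finset.sum_nonneg fun i _ => hD0 i
    refine ⟨?_, fun i => ?_, ?_⟩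
    · have := hb0 p.1 _ (sub_nonpos.2 hpp)
      rw [zero_mul, Real.exp_zero, mul_one] at this
      have h2 : |φ p| ≤ C0 := this
      linarith
    · have h1 := bX i p hpp
      have h2 : D i ≤ ∑ i, D i := Finset.single_le_sum (fun i _ => hD0 i) (Finset.mem_univ i)
      have h3 := hD0 i
      nlinarith
    · have h1 := bY p hpp
      nlinarith



/-! ### Uniqueness of harmonic extensions with square integrable gradient -/

def cubeI (n : ℕ) : Set (Fin n → ℝ) := Set.Icc 0 1

theorem cont_int_cube {n : ℕ} {f : (Fin n → ℝ) → ℝ} (hf : Continuous f) :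
    IntegrableOn f (cubeI n) :=
  hf.continuousOn.integrableOn_compact isCompact_Icc

theorem hasDerivAt_cube {n : ℕ} {f f' : (Fin n → ℝ) → ℝ → ℝ} (hc : Continuous (Function.uncurry f))
    (hc' : Continuous (Function.uncurry f')) (hd : ∀ x z, HasDerivAt (f x) (f' x z) z) (z : ℝ) :
    HasDerivAt (fun z => ∫ x in cubeI n, f x z) (∫ x in cubeI n, f' x z) z := by
  obtain ⟨C, hC⟩ := ((isCompact_Icc (a := (0 : Fin n → ℝ)) (b := 1)).prod
    (isCompact_closedBall z 1)).exists_bound_of_continuousOn hc'.continuousOn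
  have hmeas : MeasurableSet (cubeI n) := measurableSet_Icc
  refine (hasDerivAt_integral_of_dominated_loc_of_deriv_le (μ := volume.restrict (cubeI n))
    (F := fun z x => f x z) (F' := fun z x => f' x z) (x₀ := z) (s := Metric.ball z 1)
    (bound := fun _ => C) (Metric.ball_mem_nhds z one_pos) ?_ ?_ ?_ ?_ ?_ ?_).2
  · refine Filter.Eventually.of_forall fun y => ?_
    exact (hc.comp (Continuous.prodMk_left y)).aestronglyMeasurable
  · exact cont_int_cube (hc.comp (Continuous.prodMk_left z))
  · exact (hc'.comp (Continuous.prodMk_left z)).aestronglyMeasurable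
  · filter_upwards [self_mem_ae_restrict hmeas] with x hx y hy
    exact hC (x, y) ⟨hx, Metric.ball_subset_closedBall hy⟩
  · exact cont_int_cube continuous_const
  · exact Filter.Eventually.of_forall fun x y _ => hd x y

theorem eq_zero_of_sq_int {n : ℕ} {f : (Fin n → ℝ) → ℝ} (hf : Continuous f)
    (h0 : ∫ x in cubeI n, f x ^ 2 ≤ 0) : ∀ x ∈ cubeI n, f x = 0 := by
  have h1 : ∫ x in cubeI n, f x ^ 2 = 0 := le_antisymm h0 (integral_nonneg fun x => sq_nonneg _)
  rw [setIntegral_eq_zero_iff_of_nonneg_ae (Filter.Eventually.of_forall fun x => sq_nonneg _)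
    (cont_int_cube (hf.pow 2))] at h1
  have h2 : f =ᵐ[volume.restrict (cubeI n)] fun _ => 0 := by
    filter_upwards [h1] with x hx
    simpa using hx
  refine Measure.eqOn_of_ae_eq h2 hf.continuousOn continuousOn_const ?_
  have : cubeI n = Set.univ.pi fun _ => Set.Icc (0:ℝ) 1 := by
    unfold cubeI
    rw [← Set.pi_univ_Icc]
    rfl
  rw [this, interior_pi_set Set.finite_univ, closure_pi_set]
  refine Set.pi_mono fun i _ => ?_
  rw [interior_Icc, closure_Ioo (by norm_num)]

theorem slice_integrable {n : ℕ} {h : (Fin n → ℝ) → ℝ} (hh : Continuous h)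
    {P : (Fin n → ℝ) × ℝ → ℝ} (hP : IntegrableOn P (fluidCell n h)) :
    IntegrableOn (fun z => ∫ x in cubeI n, P (x, z + h x)) (Set.Iio 0) := by
  let e : ((Fin n → ℝ) × ℝ) ≃ₜ ((Fin n → ℝ) × ℝ) :=
    { toFun := fun p => (p.1, p.2 + h p.1)
      invFun := fun p => (p.1, p.2 - h p.1)
      left_inv := fun p => by simp
      right_inv := fun p => by simp
      continuous_toFun := by fun_prop
      continuous_invFun := by fun_prop }
  have hmp : MeasurePreserving e (volume : Measure ((Fin n → ℝ) × ℝ)) volume := by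
    rw [Measure.volume_eq_prod]
    exact (MeasurePreserving.id (volume : Measure (Fin n → ℝ))).skew_product
      (g := fun x z => z + h x) (by fun_prop)
      (Filter.Eventually.of_forall fun x => (measurePreserving_add_right volume (h x)).map_eq)
  have h1 := (hmp.integrableOn_comp_preimage e.measurableEmbedding (f := P) (s := fluidCell n h)).2 hP
  have h2 : e ⁻¹' (fluidCell n h) = cell n ×ˢ Set.Iio 0 := by
    ext p
    show (p.1 ∈ cell n ∧ p.2 + h p.1 < h p.1) ↔ _
    simp [Set.mem_prod]
  rw [h2] at h1
  unfold IntegrableOn at h1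
  rw [Measure.volume_eq_prod, ← Measure.prod_restrict] at h1
  have h3 := h1.integral_prod_right
  have hae : cell n =ᵐ[volume] cubeI n := by
    have := Measure.univ_pi_Ico_ae_eq_Icc (μ := fun _ : Fin n => (volume : Measure ℝ))
      (f := fun _ => 0) (g := fun _ => 1)
    exact this
  rw [Measure.restrict_congr_set hae] at h3
  exact h3

theorem energy_der {n : ℕ} {h : (Fin n → ℝ) → ℝ} (hh : ContDiff ℝ (⊤ : ℕ∞) h)
    {w : (Fin n → ℝ) × ℝ → ℝ} (hw : ContDiff ℝ (⊤ : ℕ∞) w) (z : ℝ) :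
    HasDerivAt (fun z => ∫ x in cubeI n, w (x, z + h x) *
        (pdE n w (eY n) (x, z + h x) - ∑ i, pdX n h i x * pdE n w (eX n i) (x, z + h x)))
      (∫ x in cubeI n, (pdE n w (eY n) (x, z + h x) *
        (pdE n w (eY n) (x, z + h x) - ∑ i, pdX n h i x * pdE n w (eX n i) (x, z + h x))
      + w (x, z + h x) * (pdE n (pdE n w (eY n)) (eY n) (x, z + h x)
        - ∑ i, pdX n h i x * pdE n (pdE n w (eX n i)) (eY n) (x, z + h x)))) z := by
  have cw := hw.continuous
  have cX : ∀ i, Continuous (pdE n w (eX n i)) := fun i => (pdE_contDiff hw _).continuous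
  have cY : Continuous (pdE n w (eY n)) := (pdE_contDiff hw _).continuous
  have cXY : ∀ i, Continuous (pdE n (pdE n w (eX n i)) (eY n)) := fun i =>
    (pdE_contDiff (pdE_contDiff hw _) _).continuous
  have cXX : ∀ i, Continuous (pdE n (pdE n w (eX n i)) (eX n i)) := fun i =>
    (pdE_contDiff (pdE_contDiff hw _) _).continuous
  have cYY : Continuous (pdE n (pdE n w (eY n)) (eY n)) :=
    (pdE_contDiff (pdE_contDiff hw _) _).continuous
  have ch := hh.continuous
  have chi : ∀ i, Continuous (pdX n h i) := fun i => (pdX_contDiff hh i).continuous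
  have hy : ∀ {φ : (Fin n → ℝ) × ℝ → ℝ}, ContDiff ℝ (⊤ : ℕ∞) φ → ∀ x z,
      HasDerivAt (fun z => φ (x, z + h x)) (pdE n φ (eY n) (x, z + h x)) z := fun hφ x z =>
    (hasDerivAt_y hφ x (z + h x)).comp_add_const z (h x)
  exact hasDerivAt_cube (n := n)
    (f := fun x z => w (x, z + h x) *
        (pdE n w (eY n) (x, z + h x) - ∑ i, pdX n h i x * pdE n w (eX n i) (x, z + h x)))
    (f' := fun x z => pdE n w (eY n) (x, z + h x) *
        (pdE n w (eY n) (x, z + h x) - ∑ i, pdX n h i x * pdE n w (eX n i) (x, z + h x))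
      + w (x, z + h x) * (pdE n (pdE n w (eY n)) (eY n) (x, z + h x)
        - ∑ i, pdX n h i x * pdE n (pdE n w (eX n i)) (eY n) (x, z + h x)))
    (by unfold Function.uncurry; fun_prop) (by unfold Function.uncurry; fun_prop)
    (fun x z => (hy hw x z).mul ((hy (pdE_contDiff hw _) x z).sub
      (HasDerivAt.fun_sum fun i _ => (hy (pdE_contDiff hw _) x z).const_mul _))) z

theorem energy_aux {n : ℕ} {h : (Fin n → ℝ) → ℝ} (hh : ContDiff ℝ (⊤ : ℕ∞) h) (hp : ZPeriodic n h)
    {w : (Fin n → ℝ) × ℝ → ℝ} (hw : ContDiff ℝ (⊤ : ℕ∞) w) (hwp : ZPeriodicE n w)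
    (hharm : ∀ p : (Fin n → ℝ) × ℝ, p.2 < h p.1 → lapE n w p = 0) {z : ℝ} (hz : z < 0) :
    HasDerivAt (fun z => ∫ x in cubeI n, w (x, z + h x) *
        (pdE n w (eY n) (x, z + h x) - ∑ i, pdX n h i x * pdE n w (eX n i) (x, z + h x)))
      (∫ x in cubeI n, gradSqE n w (x, z + h x)) z := by
  have cw := hw.continuous
  have cX : ∀ i, Continuous (pdE n w (eX n i)) := fun i => (pdE_contDiff hw _).continuous
  have cY : Continuous (pdE n w (eY n)) := (pdE_contDiff hw _).continuous
  have cXY : ∀ i, Continuous (pdE n (pdE n w (eX n i)) (eY n)) := fun i =>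
    (pdE_contDiff (pdE_contDiff hw _) _).continuous
  have cXX : ∀ i, Continuous (pdE n (pdE n w (eX n i)) (eX n i)) := fun i =>
    (pdE_contDiff (pdE_contDiff hw _) _).continuous
  have ch := hh.continuous
  have main := energy_der hh hw z
  refine main.congr_deriv ?_
  let hz' : (Fin n → ℝ) → ℝ := fun x => z + h x
  have hhz : ContDiff ℝ (⊤ : ℕ∞) hz' := contDiff_const.add hh
  have hpd : ∀ i x, pdX n hz' i x = pdX n h i x := by
    intro i x
    unfold pdX
    rw [fderiv_const_add]
  let f : Fin n → (Fin n → ℝ) → ℝ := fun i x => w (x, z + h x) * pdE n w (eX n i) (x, z + h x)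
  have hfs : ∀ i, ContDiff ℝ (⊤ : ℕ∞) (f i) := fun i =>
    (graph_contDiff hw hhz).mul (graph_contDiff (pdE_contDiff hw _) hhz)
  have hfp : ∀ i, CPer (f i) := by
    intro i x k
    simp only [f, hp x k]
    rw [hwp x _ k, hwp.pdE (eX n i) x _ k]
  have hdiv : ∀ i, ∫ x in cubeI n, pdX n (f i) i x = 0 := fun i => div_int (hfs i) (hfp i) i
  have hfd : ∀ i x, pdX n (f i) i x =
      w (x, z + h x) * (pdE n (pdE n w (eX n i)) (eX n i) (x, z + h x)
        + pdX n h i x * pdE n (pdE n w (eX n i)) (eY n) (x, z + h x))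
      + pdE n w (eX n i) (x, z + h x) * (pdE n w (eX n i) (x, z + h x)
        + pdX n h i x * pdE n w (eY n) (x, z + h x)) := by
    intro i x
    have e1 := pdX_graph (pdE_contDiff hw (eX n i)) hhz i x
    have e2 := pdX_graph hw hhz i x
    rw [hpd] at e1 e2
    rw [← e1, ← e2]
    have d1 := smooth_differentiable (graph_contDiff hw hhz) x
    have d2 := smooth_differentiable (graph_contDiff (pdE_contDiff hw (eX n i)) hhz) x
    unfold pdX
    have := fderiv_fun_mul d1 d2
    show fderiv ℝ (fun y => w (y, hz' y) * pdE n w (eX n i) (y, hz' y)) x _ = _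
    rw [this]
    rfl
  have hsum : ∫ x in cubeI n, ∑ i, pdX n (f i) i x = 0 := by
    rw [integral_finsetSum _ fun i _ => cont_int_cube (pdX_contDiff (hfs i) i).continuous]
    exact Finset.sum_eq_zero fun i _ => hdiv i
  have hintg : IntegrableOn (fun x => gradSqE n w (x, z + h x)) (cubeI n) := by
    apply cont_int_cube
    unfold gradSqE
    fun_prop
  have hint2 : IntegrableOn (fun x => ∑ i, pdX n (f i) i x) (cubeI n) :=
    cont_int_cube (continuous_finsetSum _ fun i _ => (pdX_contDiff (hfs i) i).continuous)
  rw [← sub_zero (∫ x in cubeI n, gradSqE n w (x, z + h x)), ← hsum, ← integral_sub hintg hint2]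
  congr 1
  funext x
  have hl := hharm (x, z + h x) (by simpa using hz)
  unfold lapE at hl
  have hl' : pdE n (pdE n w (eY n)) (eY n) (x, z + h x)
    = - ∑ i, pdE n (pdE n w (eX n i)) (eX n i) (x, z + h x) := by linarith
  unfold gradSqE
  rw [hl']
  simp only [hfd, Finset.sum_add_distrib, mul_add, mul_sub, Finset.mul_sum]
  have e1 : ∀ i, pdE n w (eX n i) (x, z + h x) * (pdX n h i x * pdE n w (eY n) (x, z + h x))
      = pdE n w (eY n) (x, z + h x) * (pdX n h i x * pdE n w (eX n i) (x, z + h x)) := fun i => by ring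
  simp only [e1, mul_neg, Finset.mul_sum, sq]
  ring

theorem h_inv_not (z₀ : ℝ) : ¬ IntegrableOn (fun z : ℝ => z⁻¹) (Set.Iio z₀) := by
  intro h1
  have h2 : IntegrableOn (fun z : ℝ => z⁻¹) (Set.Iic (- (-z₀))) := by
    rw [neg_neg]; exact (integrableOn_Iic_iff_integrableOn_Iio (by simp)).2 h1
  have h3 := h2.comp_neg_Ici.neg
  refine not_integrableOn_Ici_inv (a := -z₀) (h3.congr (Filter.Eventually.of_forall fun z => ?_))
  simp [inv_neg]

theorem harm_unique_zero {n : ℕ} {h : (Fin n → ℝ) → ℝ} (hh : ContDiff ℝ (⊤ : ℕ∞) h) (hp : ZPeriodic n h)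
    {w : (Fin n → ℝ) × ℝ → ℝ} (hw : IsHarmonicExt n h (fun _ => 0) w) :
    ∀ p : (Fin n → ℝ) × ℝ, p.2 ≤ h p.1 → w p = 0 := by
  have hws := hw.smooth
  have cw := hws.continuous
  have cX : ∀ i, Continuous (pdE n w (eX n i)) := fun i => (pdE_contDiff hws _).continuous
  have cY : Continuous (pdE n w (eY n)) := (pdE_contDiff hws _).continuous
  have ch := hh.continuous
  have chi : ∀ i, Continuous (pdX n h i) := fun i => (pdX_contDiff hh i).continuous
  have cg : Continuous (gradSqE n w) := by unfold gradSqE; fun_prop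
  have gnn : ∀ p, 0 ≤ gradSqE n w p := fun p => by
    unfold gradSqE
    exact add_nonneg (Finset.sum_nonneg fun _ _ => sq_nonneg _) (sq_nonneg _)
  let q : (Fin n → ℝ) → ℝ → ℝ := fun x z =>
    pdE n w (eY n) (x, z + h x) - ∑ i, pdX n h i x * pdE n w (eX n i) (x, z + h x)
  have cq : Continuous (Function.uncurry q) := by
    unfold q Function.uncurry; fun_prop
  have cqz : ∀ z, Continuous fun x => q x z := fun z => cq.comp (Continuous.prodMk_left z)
  let J : ℝ → ℝ := fun z => ∫ x in cubeI n, w (x, z + h x) * q x z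
  let m : ℝ → ℝ := fun z => ∫ x in cubeI n, gradSqE n w (x, z + h x)
  let F : ℝ → ℝ := fun z => ∫ x in cubeI n, w (x, z + h x) ^ 2
  let F' : ℝ → ℝ := fun z => ∫ x in cubeI n, 2 * (w (x, z + h x) * pdE n w (eY n) (x, z + h x))
  have hJ : ∀ z < 0, HasDerivAt J (m z) z := fun z hz =>
    energy_aux hh hp hws hw.periodic hw.harmonic hz
  have mnn : ∀ z, 0 ≤ m z := fun z => integral_nonneg fun x => gnn _
  have hJc : Continuous J := continuous_iff_continuousAt.2 fun z => (energy_der hh hws z).continuousAt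
  have hF : ∀ z, HasDerivAt F (F' z) z := by
    intro z
    refine hasDerivAt_cube (n := n) (f := fun x z => w (x, z + h x) ^ 2)
      (f' := fun x z => 2 * (w (x, z + h x) * pdE n w (eY n) (x, z + h x)))
      (by unfold Function.uncurry; fun_prop) (by unfold Function.uncurry; fun_prop) (fun x z => ?_) z
    have := ((hasDerivAt_y hws x (z + h x)).comp_add_const z (h x)).pow 2
    exact this.congr_deriv (by simp; ring)
  have hb0 : ∀ x, w (x, 0 + h x) = 0 := fun x => by rw [zero_add]; exact hw.boundary x
  have hb0' : ∀ x, w (x, h x) = 0 := fun x => hw.boundary x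
  have hJ0 : J 0 = 0 := by simp [J, hb0']
  have hF0 : F 0 = 0 := by simp [F, hb0']
  have hF'0 : F' 0 = 0 := by simp [F', hb0']
  have hFnn : ∀ z, 0 ≤ F z := fun z => integral_nonneg fun x => sq_nonneg _
  have iv : ∀ z, IntegrableOn (fun x => w (x, z + h x) ^ 2) (cubeI n) := fun z =>
    cont_int_cube (by fun_prop)
  have ig : ∀ z, IntegrableOn (fun x => gradSqE n w (x, z + h x)) (cubeI n) := fun z =>
    cont_int_cube (by fun_prop)
  have ivy : ∀ z, IntegrableOn (fun x => 2 * (w (x, z + h x) * pdE n w (eY n) (x, z + h x))) (cubeI n) :=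
    fun z => cont_int_cube (by fun_prop)
  have ineq1 : ∀ z, F' z * z - F z ≤ m z * z ^ 2 := by
    intro z
    simp only [F', F, m]
    rw [← integral_mul_const, ← integral_mul_const, ← integral_sub ((ivy z).mul_const z) (iv z)]
    refine integral_mono (((ivy z).mul_const z).sub (iv z)) ((ig z).mul_const _) fun x => ?_
    have h1 : pdE n w (eY n) (x, z + h x) ^ 2 ≤ gradSqE n w (x, z + h x) := by
      unfold gradSqE
      exact le_add_of_nonneg_left (Finset.sum_nonneg fun _ _ => sq_nonneg _)
    have h2 := mul_le_mul_of_nonneg_right h1 (sq_nonneg z)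
    simp only
    nlinarith [sq_nonneg (pdE n w (eY n) (x, z + h x) * z - w (x, z + h x))]
  let g : ℝ → ℝ := fun z => - J z + F z / z
  have hg : ∀ z < 0, HasDerivAt g (- m z + (F' z * z - F z * 1) / z ^ 2) z := fun z hz =>
    (hJ z hz).neg.add ((hF z).div (hasDerivAt_id z) hz.ne)
  have hganti : AntitoneOn g (Set.Iio 0) := by
    refine antitoneOn_of_deriv_nonpos (convex_Iio 0) (fun z hz => (hg z hz).continuousAt.continuousWithinAt)
      ?_ ?_
    · rw [interior_Iio]
      exact fun z hz => (hg z hz).differentiableAt.differentiableWithinAt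
    · rw [interior_Iio]
      intro z hz
      have hz0 : z < 0 := hz
      rw [(hg z hz).deriv]
      have hz2 : 0 < z ^ 2 := by
        have := mul_pos_of_neg_of_neg hz0 hz0
        nlinarith
      have : (F' z * z - F z * 1) / z ^ 2 ≤ m z := by
        rw [div_le_iff₀ hz2, mul_one]
        exact ineq1 z
      linarith
  have hgl : Filter.Tendsto g (nhdsWithin 0 (Set.Iio 0)) (nhds 0) := by
    have h1 : Filter.Tendsto (fun z => - J z) (nhdsWithin 0 (Set.Iio 0)) (nhds (- J 0)) :=
      (hJc.neg.tendsto 0).mono_left nhdsWithin_le_nhds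
    have hsub : Set.Iio (0:ℝ) ⊆ {0}ᶜ := fun z hz => ne_of_lt hz
    have h2 := (hasDerivAt_iff_tendsto_slope.1 (hF 0)).mono_left (nhdsWithin_mono 0 hsub)
    have h3 := h1.add h2
    rw [hJ0, hF'0, neg_zero, add_zero] at h3
    refine h3.congr fun z => ?_
    simp only [g, slope_def_field, hF0, sub_zero]
  have hgnn : ∀ z < 0, 0 ≤ g z := by
    intro z hz
    refine le_of_tendsto hgl ?_
    filter_upwards [Ioo_mem_nhdsLT hz] with y hy
    exact hganti (Set.mem_Iio.2 hz) (Set.mem_Iio.2 hy.2) hy.1.le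
  obtain ⟨B, hB0, hB⟩ := periodic_bounded' (n := n) (f := fun x => ∑ i, pdX n h i x ^ 2) (by fun_prop)
    (fun x k => by simp only [hp.pdX _ x k])
  have hq : ∀ x z, q x z ^ 2 ≤ 2 * (1 + B) * gradSqE n w (x, z + h x) := by
    intro x z
    simp only [q]
    unfold gradSqE
    have h1 := Finset.sum_mul_sq_le_sq_mul_sq Finset.univ (fun i => pdX n h i x)
      (fun i => pdE n w (eX n i) (x, z + h x))
    have h2 : ∑ i, pdX n h i x ^ 2 ≤ B := (le_abs_self _).trans (hB x)
    have h3 : 0 ≤ ∑ i, pdE n w (eX n i) (x, z + h x) ^ 2 := Finset.sum_nonneg fun _ _ => sq_nonneg _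
    generalize (∑ i, pdX n h i x * pdE n w (eX n i) (x, z + h x)) = s at *
    generalize (∑ i, pdE n w (eX n i) (x, z + h x) ^ 2) = G at *
    generalize pdE n w (eY n) (x, z + h x) = a at *
    have h4 := mul_le_mul_of_nonneg_right h2 h3
    nlinarith [sq_nonneg (a + s), mul_nonneg hB0 (sq_nonneg a)]
  have key : ∀ z < 0, - J z ≤ (-z) * (2 * (1 + B)) * m z := by
    intro z hz
    have hs : 0 < -z := by linarith
    have h1 : - J z ≤ F z / (2 * (-z)) + (-z) * (1 + B) * m z := by
      simp only [J, F, m]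
      rw [← integral_neg, ← integral_div, ← integral_const_mul,
        ← integral_add ((iv z).div_const _) ((ig z).const_mul _)]
      refine integral_mono (cont_int_cube (by have := cqz z; fun_prop))
        (((iv z).div_const _).add ((ig z).const_mul _)) fun x => ?_
      have h2 := mul_le_mul_of_nonneg_left (hq x z) hs.le
      have h3 : - (w (x, z + h x) * q x z) ≤ w (x, z + h x) ^ 2 / (2 * (-z)) + (-z) * q x z ^ 2 / 2 := by
        have : w (x, z + h x) ^ 2 / (2 * (-z)) + (-z) * q x z ^ 2 / 2 + w (x, z + h x) * q x z
          = (w (x, z + h x) + (-z) * q x z) ^ 2 / (2 * (-z)) := by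
          have hzne := hz.ne
          field_simp
          ring
        have h5 : 0 ≤ (w (x, z + h x) + (-z) * q x z) ^ 2 / (2 * (-z)) := by positivity
        linarith
      simp only
      linarith
    have h2 := hgnn z hz
    have h3 : F z / (2 * (-z)) = - (F z / z) / 2 := by
      have := hz.ne
      field_simp
    have h4 : g z = - J z + F z / z := rfl
    rw [h3] at h1
    linarith
  have hJmono : MonotoneOn J (Set.Iio 0) := by
    refine monotoneOn_of_deriv_nonneg (convex_Iio 0) hJc.continuousOn ?_ ?_
    · rw [interior_Iio]
      exact fun z hz => (hJ z hz).differentiableAt.differentiableWithinAt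
    · rw [interior_Iio]
      intro z hz
      rw [(hJ z hz).deriv]
      exact mnn z
  have hmint : IntegrableOn m (Set.Iio 0) := slice_integrable hh.continuous hw.gradL2
  have hJz : ∀ z < 0, - J z ≤ 0 := by
    intro z₀ hz₀
    by_contra hc
    push Not at hc
    have h1 : IntegrableOn (fun z : ℝ => z⁻¹) (Set.Iio z₀) := by
      have h2 : IntegrableOn m (Set.Iio z₀) := hmint.mono_set (Set.Iio_subset_Iio hz₀.le)
      refine Integrable.mono' (h2.const_mul (2 * (1 + B) / (- J z₀))) ?_ ?_
      · exact measurable_inv.aestronglyMeasurable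
      · filter_upwards [self_mem_ae_restrict measurableSet_Iio] with z hz
        have hz1 : z < z₀ := hz
        have hz' : z < 0 := hz1.trans hz₀
        have h3 := key z hz'
        have h4 : J z ≤ J z₀ := hJmono (Set.mem_Iio.2 hz') (Set.mem_Iio.2 hz₀) hz1.le
        rw [Real.norm_eq_abs, abs_inv, abs_of_neg hz', inv_eq_one_div, div_mul_eq_mul_div,
          div_le_div_iff₀ (by linarith) hc]
        nlinarith
    exact h_inv_not z₀ h1
  intro p hpp
  have hlt : ∀ x, ∀ z < 0, w (x, z + h x) = 0 := by
    intro x z hz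
    have h1 : F z ≤ 0 := by
      have h2 := hgnn z hz
      have h3 := hJz z hz
      have h4 : g z = - J z + F z / z := rfl
      have h5 : 0 ≤ F z / z := by linarith
      by_contra hc
      push Not at hc
      have := div_neg_of_pos_of_neg hc hz
      linarith
    have h2 := eq_zero_of_sq_int (f := fun x => w (x, z + h x)) (by fun_prop) h1
    obtain ⟨k, hk⟩ := exists_cube_rep x
    have h3 := h2 _ (by
      refine ⟨fun i => (hk i (Set.mem_univ i)).1, fun i => (hk i (Set.mem_univ i)).2⟩)
    simp only [hp x k] at h3
    rwa [hw.periodic x _ k] at h3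
  rcases hpp.lt_or_eq with h1 | h1
  · have := hlt p.1 (p.2 - h p.1) (by linarith)
    simpa using this
  · have := hw.boundary p.1
    rwa [← h1] at this

theorem harm_unique {n : ℕ} {h ψ : (Fin n → ℝ) → ℝ} (hh : ContDiff ℝ (⊤ : ℕ∞) h) (hp : ZPeriodic n h)
    {φ₁ φ₂ : (Fin n → ℝ) × ℝ → ℝ} (h1 : IsHarmonicExt n h ψ φ₁) (h2 : IsHarmonicExt n h ψ φ₂) :
    ∀ p : (Fin n → ℝ) × ℝ, p.2 ≤ h p.1 → φ₁ p = φ₂ p := by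
  have hs : ContDiff ℝ (⊤ : ℕ∞) (fun p => φ₁ p - φ₂ p) := h1.smooth.sub h2.smooth
  have hw : IsHarmonicExt n h (fun _ => 0) (fun p => φ₁ p - φ₂ p) := by
    refine ⟨hs, ?_, ?_, ?_, ?_⟩
    · intro x y k
      simp only [h1.periodic x y k, h2.periodic x y k]
    · intro p hpp
      rw [lapE_sub h1.smooth h2.smooth, h1.harmonic p hpp, h2.harmonic p hpp, sub_zero]
    · intro x
      simp only [h1.boundary x, h2.boundary x, sub_self]
    · have hc : Continuous (gradSqE n (fun p => φ₁ p - φ₂ p)) := by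
        unfold gradSqE
        refine (continuous_finsetSum _ fun i _ => ?_).add ?_
        · exact (pdE_contDiff hs _).continuous.pow 2
        · exact (pdE_contDiff hs _).continuous.pow 2
      refine Integrable.mono' ((h1.gradL2.add h2.gradL2).const_mul 2) hc.aestronglyMeasurable
        (Filter.Eventually.of_forall fun p => ?_)
      have hnn : 0 ≤ gradSqE n (fun p => φ₁ p - φ₂ p) p := by
        unfold gradSqE
        exact add_nonneg (Finset.sum_nonneg fun _ _ => sq_nonneg _) (sq_nonneg _)
      rw [Real.norm_eq_abs, abs_of_nonneg hnn]
      unfold gradSqE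
      simp only [pdE_sub h1.smooth h2.smooth, Pi.add_apply]
      have e : ∀ a b : ℝ, (a - b) ^ 2 ≤ 2 * a ^ 2 + 2 * b ^ 2 := fun a b => by
        nlinarith [sq_nonneg (a + b)]
      calc _ ≤ (∑ i, (2 * pdE n φ₁ (eX n i) p ^ 2 + 2 * pdE n φ₂ (eX n i) p ^ 2))
            + (2 * pdE n φ₁ (eY n) p ^ 2 + 2 * pdE n φ₂ (eY n) p ^ 2) :=
            add_le_add (Finset.sum_le_sum fun i _ => e _ _) (e _ _)
        _ = _ := by
          rw [Finset.sum_add_distrib, ← Finset.mul_sum, ← Finset.mul_sum]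
          ring
  intro p hpp
  have := harm_unique_zero hh hp hw p hpp
  linarith

/-- equality on the closed domain implies equality of first derivatives on the closed domain -/
theorem pdE_eq_of_eq {n : ℕ} {h : (Fin n → ℝ) → ℝ} (hh : ContDiff ℝ (⊤ : ℕ∞) h)
    {φ₁ φ₂ : (Fin n → ℝ) × ℝ → ℝ} (h1 : ContDiff ℝ (⊤ : ℕ∞) φ₁) (h2 : ContDiff ℝ (⊤ : ℕ∞) φ₂)
    (he : ∀ p : (Fin n → ℝ) × ℝ, p.2 ≤ h p.1 → φ₁ p = φ₂ p) (v : (Fin n → ℝ) × ℝ) :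
    ∀ p : (Fin n → ℝ) × ℝ, p.2 ≤ h p.1 → pdE n φ₁ v p = pdE n φ₂ v p := by
  have hlt : ∀ p : (Fin n → ℝ) × ℝ, p.2 < h p.1 → pdE n φ₁ v p = pdE n φ₂ v p := fun p hp =>
    pdE_congr ((nhds_below hh.continuous hp).mono fun q hq => he q hq.le) v
  rintro ⟨x, y⟩ hp
  have t1 : Filter.Tendsto (fun r => pdE n φ₁ v (x, r)) (nhdsWithin y (Set.Iio y)) (nhds (pdE n φ₁ v (x, y))) :=
    (((pdE_contDiff h1 v).continuous.comp (Continuous.prodMk_right x)).tendsto y).mono_left nhdsWithin_le_nhds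
  have t2 : Filter.Tendsto (fun r => pdE n φ₂ v (x, r)) (nhdsWithin y (Set.Iio y)) (nhds (pdE n φ₂ v (x, y))) :=
    (((pdE_contDiff h2 v).continuous.comp (Continuous.prodMk_right x)).tendsto y).mono_left nhdsWithin_le_nhds
  refine tendsto_nhds_unique t1 (t2.congr' ?_)
  filter_upwards [self_mem_nhdsWithin] with r hr
  exact (hlt (x, r) (lt_of_lt_of_le hr hp)).symm

theorem DtN_eq {n : ℕ} {h ψ : (Fin n → ℝ) → ℝ} (hh : ContDiff ℝ (⊤ : ℕ∞) h) (hp : ZPeriodic n h)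
    {φ : (Fin n → ℝ) × ℝ → ℝ} (hφ : IsHarmonicExt n h ψ φ) (x : Fin n → ℝ) :
    DtN n h ψ x = pdE n φ (eY n) (x, h x) - ∑ i, pdX n h i x * pdE n φ (eX n i) (x, h x) := by
  have H : ∃ φ, IsHarmonicExt n h ψ φ := ⟨φ, hφ⟩
  have e := fun v => pdE_eq_of_eq hh H.choose_spec.smooth hφ.smooth (harm_unique hh hp H.choose_spec hφ) v
    (x, h x) le_rfl
  unfold DtN
  rw [dif_pos H]
  simp only [e]

theorem Bop_eq {n : ℕ} {h ψ : (Fin n → ℝ) → ℝ} (hh : ContDiff ℝ (⊤ : ℕ∞) h) (hp : ZPeriodic n h)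
    {φ : (Fin n → ℝ) × ℝ → ℝ} (hφ : IsHarmonicExt n h ψ φ) (x : Fin n → ℝ) :
    Bop n h ψ x = pdE n φ (eY n) (x, h x) := by
  have H : ∃ φ, IsHarmonicExt n h ψ φ := ⟨φ, hφ⟩
  have e := fun v => pdE_eq_of_eq hh H.choose_spec.smooth hφ.smooth (harm_unique hh hp H.choose_spec hφ) v
    (x, h x) le_rfl
  unfold Bop
  rw [dif_pos H]
  simp only [e]

theorem Vop_eq {n : ℕ} {h ψ : (Fin n → ℝ) → ℝ} (hh : ContDiff ℝ (⊤ : ℕ∞) h) (hp : ZPeriodic n h)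
    {φ : (Fin n → ℝ) × ℝ → ℝ} (hφ : IsHarmonicExt n h ψ φ) (x : Fin n → ℝ) (i : Fin n) :
    Vop n h ψ x i = pdE n φ (eX n i) (x, h x) := by
  have H : ∃ φ, IsHarmonicExt n h ψ φ := ⟨φ, hφ⟩
  have e := fun v => pdE_eq_of_eq hh H.choose_spec.smooth hφ.smooth (harm_unique hh hp H.choose_spec hφ) v
    (x, h x) le_rfl
  unfold Vop
  rw [dif_pos H]
  simp only [e]



/-! ### Maximum principle -/

theorem deriv2_nonpos_of_localMax {f : ℝ → ℝ} {f' : ℝ → ℝ} {c a : ℝ} (hf : ∀ r, HasDerivAt f (f' r) r)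
    (hf' : HasDerivAt f' c a) (hm : IsLocalMax f a) : c ≤ 0 := by
  by_contra hc
  push Not at hc
  have e : deriv f = f' := funext fun r => (hf r).deriv
  have h1 : IsLocalMin f a := by
    refine isLocalMin_of_deriv_deriv_pos ?_ ?_ (hf a).continuousAt
    · rw [e, hf'.deriv]; exact hc
    · exact hm.deriv_eq_zero
  have h2 : f =ᶠ[nhds a] fun _ => f a := by
    filter_upwards [h1, hm] with r hr1 hr2
    exact le_antisymm hr2 hr1
  have h3 : f' =ᶠ[nhds a] fun _ => 0 := by
    filter_upwards [h2.eventually_nhds] with r hr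
    rw [← (hf r).deriv, Filter.EventuallyEq.deriv_eq hr]
    simp
  have h4 := h3.deriv_eq
  rw [hf'.deriv] at h4
  simp at h4
  exact hc.ne' h4

theorem lapE_nonpos_of_localMax {n : ℕ} {w : (Fin n → ℝ) × ℝ → ℝ} (hw : ContDiff ℝ (⊤ : ℕ∞) w)
    {p : (Fin n → ℝ) × ℝ} (hm : IsLocalMax w p) : lapE n w p ≤ 0 := by
  have key : ∀ v, pdE n (pdE n w v) v p ≤ 0 := by
    intro v
    have h2 := hasDerivAt_line (pdE_contDiff hw v) p v 0
    have hm' : IsLocalMax (fun r : ℝ => w (p + r • v)) 0 := by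
      have hc : Filter.Tendsto (fun r : ℝ => p + r • v) (nhds 0) (nhds p) := by
        have : Continuous (fun r : ℝ => p + r • v) := by fun_prop
        simpa using this.tendsto 0
      have := hc.eventually hm
      unfold IsLocalMax IsMaxFilter
      simpa using this
    have := deriv2_nonpos_of_localMax (fun r => hasDerivAt_line hw p v r) h2 hm'
    simpa using this
  unfold lapE
  have := Finset.sum_nonpos (s := Finset.univ) fun i _ => key (eX n i)
  linarith [key (eY n)]

theorem max_strip {n : ℕ} {w : (Fin n → ℝ) × ℝ → ℝ} (hw : ContDiff ℝ (⊤ : ℕ∞) w) (hwp : ZPeriodicE n w)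
    {l h : (Fin n → ℝ) → ℝ} (hl : Continuous l) (hh : Continuous h) (hlp : ZPeriodic n l)
    (hhp : ZPeriodic n h)
    (hlap : ∀ p : (Fin n → ℝ) × ℝ, l p.1 < p.2 → p.2 < h p.1 → 0 < lapE n w p)
    (ht : ∀ x, w (x, h x) ≤ 0) (hb : ∀ x, w (x, l x) ≤ 0) :
    ∀ p : (Fin n → ℝ) × ℝ, l p.1 ≤ p.2 → p.2 ≤ h p.1 → w p ≤ 0 := by
  intro p hp1 hp2
  by_contra hc
  push Not at hc
  obtain ⟨A, hA0, hA⟩ := periodic_bounded' hl hlp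
  obtain ⟨B, hB0, hB⟩ := periodic_bounded' hh hhp
  let K : Set ((Fin n → ℝ) × ℝ) := (cubeX n ×ˢ Set.Icc (-A) B) ∩ {q | l q.1 ≤ q.2 ∧ q.2 ≤ h q.1}
  have hK : IsCompact K := by
    refine ((cubeX_compact n).prod isCompact_Icc).inter_right ?_
    have c1 : IsClosed {q : (Fin n → ℝ) × ℝ | l q.1 ≤ q.2} := isClosed_le (by fun_prop) (by fun_prop)
    have c2 : IsClosed {q : (Fin n → ℝ) × ℝ | q.2 ≤ h q.1} := isClosed_le (by fun_prop) (by fun_prop)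
    exact c1.inter c2
  have hrep : ∀ q : (Fin n → ℝ) × ℝ, l q.1 ≤ q.2 → q.2 ≤ h q.1 → ∃ q' ∈ K, w q' = w q := by
    rintro ⟨x, y⟩ h1 h2
    obtain ⟨k, hk⟩ := exists_cube_rep x
    refine ⟨(x + fun i => (k i : ℝ), y), ⟨⟨hk, ?_, ?_⟩, ?_, ?_⟩, hwp x y k⟩
    · have := (abs_le.1 (hA x)).1
      exact this.trans h1
    · have := (abs_le.1 (hB x)).2
      exact h2.trans this
    · simp only [hlp x k]; exact h1
    · simp only [hhp x k]; exact h2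
  obtain ⟨p', hp'K, hp'⟩ := hrep p hp1 hp2
  obtain ⟨q, hqK, hq⟩ := hK.exists_isMaxOn ⟨p', hp'K⟩ hw.continuous.continuousOn
  have hqpos : 0 < w q := by
    have : w p' ≤ w q := hq hp'K
    linarith
  have hq1 : l q.1 < q.2 := by
    refine lt_of_le_of_ne hqK.2.1 fun he => ?_
    have := hb q.1
    rw [he] at this
    exact absurd hqpos (not_lt.2 this)
  have hq2 : q.2 < h q.1 := by
    refine lt_of_le_of_ne hqK.2.2 fun he => ?_
    have := ht q.1
    rw [← he] at this
    exact absurd hqpos (not_lt.2 this)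
  have hloc : IsLocalMax w q := by
    have o1 : IsOpen {q : (Fin n → ℝ) × ℝ | l q.1 < q.2} := isOpen_lt (by fun_prop) (by fun_prop)
    have o2 : IsOpen {q : (Fin n → ℝ) × ℝ | q.2 < h q.1} := isOpen_lt (by fun_prop) (by fun_prop)
    filter_upwards [o1.mem_nhds hq1, o2.mem_nhds hq2] with r hr1 hr2
    obtain ⟨r', hr'K, hr'⟩ := hrep r (le_of_lt hr1) (le_of_lt hr2)
    rw [← hr']
    exact hq hr'K
  have := lapE_nonpos_of_localMax hw hloc
  linarith [hlap q hq1 hq2]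

theorem pdE_fst {n : ℕ} {k : (Fin n → ℝ) → ℝ} (hk : ContDiff ℝ (⊤ : ℕ∞) k) (v p : (Fin n → ℝ) × ℝ) :
    pdE n (fun p => k p.1) v p = fderiv ℝ k p.1 v.1 := by
  unfold pdE
  have h1 : HasFDerivAt (fun p : (Fin n → ℝ) × ℝ => k p.1)
      ((fderiv ℝ k p.1).comp (ContinuousLinearMap.fst ℝ (Fin n → ℝ) ℝ)) p :=
    ((smooth_differentiable hk p.1).hasFDerivAt).comp p hasFDerivAt_fst
  rw [h1.fderiv]
  rfl

theorem pdE_fst_X {n : ℕ} {k : (Fin n → ℝ) → ℝ} (hk : ContDiff ℝ (⊤ : ℕ∞) k) (i : Fin n) :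
    pdE n (fun p => k p.1) (eX n i) = fun p => pdX n k i p.1 := by
  funext p
  rw [pdE_fst hk]
  rfl

theorem pdE_fst_Y {n : ℕ} {k : (Fin n → ℝ) → ℝ} (hk : ContDiff ℝ (⊤ : ℕ∞) k) :
    pdE n (fun p => k p.1) (eY n) = fun _ => 0 := by
  funext p
  rw [pdE_fst hk]
  simp [eY]

theorem lapE_fst {n : ℕ} {k : (Fin n → ℝ) → ℝ} (hk : ContDiff ℝ (⊤ : ℕ∞) k) (p : (Fin n → ℝ) × ℝ) :
    lapE n (fun p => k p.1) p = ∑ i, pdX n (pdX n k i) i p.1 := by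
  unfold lapE
  simp only [pdE_fst_X hk, pdE_fst_Y hk, pdE_const, pdE_fst_X (pdX_contDiff hk _), add_zero]

theorem snd_contDiff {n : ℕ} : ContDiff ℝ (⊤ : ℕ∞) (fun p : (Fin n → ℝ) × ℝ => p.2) := contDiff_snd

theorem pdE_snd {n : ℕ} (v : (Fin n → ℝ) × ℝ) : pdE n (fun p => p.2) v = fun _ => v.2 := by
  funext p
  unfold pdE
  have : HasFDerivAt (fun p : (Fin n → ℝ) × ℝ => p.2) (ContinuousLinearMap.snd ℝ (Fin n → ℝ) ℝ) p :=
    hasFDerivAt_snd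
  rw [this.fderiv]
  rfl

theorem lapE_snd {n : ℕ} (p : (Fin n → ℝ) × ℝ) : lapE n (fun p => p.2) p = 0 := by
  unfold lapE
  simp [pdE_snd, pdE_const]

theorem fst_contDiff {n : ℕ} {k : (Fin n → ℝ) → ℝ} (hk : ContDiff ℝ (⊤ : ℕ∞) k) :
    ContDiff ℝ (⊤ : ℕ∞) (fun p : (Fin n → ℝ) × ℝ => k p.1) := hk.comp contDiff_fst

theorem exp_contDiff' {n : ℕ} {q : (Fin n → ℝ) × ℝ → ℝ} (hq : ContDiff ℝ (⊤ : ℕ∞) q) :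
    ContDiff ℝ (⊤ : ℕ∞) (fun p => Real.exp (q p)) := Real.contDiff_exp.comp hq

theorem pdE_exp {n : ℕ} {q : (Fin n → ℝ) × ℝ → ℝ} (hq : ContDiff ℝ (⊤ : ℕ∞) q) (v : (Fin n → ℝ) × ℝ) :
    pdE n (fun p => Real.exp (q p)) v = fun p => Real.exp (q p) * pdE n q v p := by
  funext p
  unfold pdE
  have := (smooth_differentiable hq p).hasFDerivAt.exp
  rw [this.fderiv]
  rfl

theorem lapE_exp {n : ℕ} {q : (Fin n → ℝ) × ℝ → ℝ} (hq : ContDiff ℝ (⊤ : ℕ∞) q) (p : (Fin n → ℝ) × ℝ) :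
    lapE n (fun p => Real.exp (q p)) p = Real.exp (q p) * (gradSqE n q p + lapE n q p) := by
  unfold lapE gradSqE
  simp only [pdE_exp hq, pdE_mul (exp_contDiff' hq) (pdE_contDiff hq _), Finset.sum_add_distrib, mul_add,
    Finset.mul_sum]
  have e : ∀ i, pdE n q (eX n i) p * (Real.exp (q p) * pdE n q (eX n i) p)
    = Real.exp (q p) * pdE n q (eX n i) p ^ 2 := fun i => by ring
  simp only [e]
  ring

theorem lapE_exp_snd {n : ℕ} (p : (Fin n → ℝ) × ℝ) :
    lapE n (fun p => Real.exp p.2) p = Real.exp p.2 := by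
  rw [lapE_exp snd_contDiff, lapE_snd]
  unfold gradSqE
  simp [pdE_snd, eX, eY]

theorem max_half {n : ℕ} {w : (Fin n → ℝ) × ℝ → ℝ} (hw : ContDiff ℝ (⊤ : ℕ∞) w) (hwp : ZPeriodicE n w)
    {h : (Fin n → ℝ) → ℝ} (hh : Continuous h) (hhp : ZPeriodic n h)
    (hlap : ∀ p : (Fin n → ℝ) × ℝ, p.2 < h p.1 → 0 ≤ lapE n w p)
    {C M : ℝ} (hC : ∀ p : (Fin n → ℝ) × ℝ, p.2 ≤ h p.1 → w p ≤ C)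
    (ht : ∀ x, w (x, h x) ≤ M) :
    ∀ p : (Fin n → ℝ) × ℝ, p.2 ≤ h p.1 → w p ≤ M := by
  intro p hp
  obtain ⟨A, hA0, hA⟩ := periodic_bounded' hh hhp
  have hA' : ∀ x, h x ≤ A := fun x => (abs_le.1 (hA x)).2
  have hA'' : ∀ x, -A ≤ h x := fun x => (abs_le.1 (hA x)).1
  have key : ∀ ε > 0, w p ≤ M + ε * ((A - p.2) + (Real.exp A - Real.exp p.2)) := by
    intro ε hε
    let R : ℝ := max (max (|C - M| / ε) (A + 1)) (-p.2)
    have hR1 : |C - M| / ε ≤ R := (le_max_left _ _).trans (le_max_left _ _)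
    have hR2 : A + 1 ≤ R := (le_max_right _ _).trans (le_max_left _ _)
    have hR3 : -p.2 ≤ R := le_max_right _ _
    let v : (Fin n → ℝ) × ℝ → ℝ := fun q => w q + ε * ((q.2 + Real.exp q.2) - (A + Real.exp A)) - M
    have s1 : ContDiff ℝ (⊤ : ℕ∞) (fun q : (Fin n → ℝ) × ℝ => q.2 + Real.exp q.2) :=
      snd_contDiff.add (exp_contDiff' snd_contDiff)
    have s2 : ContDiff ℝ (⊤ : ℕ∞) (fun q : (Fin n → ℝ) × ℝ => (q.2 + Real.exp q.2) - (A + Real.exp A)) :=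
      s1.sub contDiff_const
    have s3 : ContDiff ℝ (⊤ : ℕ∞) (fun q : (Fin n → ℝ) × ℝ => ε * ((q.2 + Real.exp q.2) - (A + Real.exp A))) :=
      contDiff_const.mul s2
    have hv : ContDiff ℝ (⊤ : ℕ∞) v := (hw.add s3).sub contDiff_const
    have hlapv : ∀ q, lapE n v q = lapE n w q + ε * Real.exp q.2 := by
      intro q
      simp only [v]
      rw [lapE_sub (hw.add s3) contDiff_const, lapE_add hw s3, lapE_const_mul s2, lapE_sub s1 contDiff_const,
        lapE_add snd_contDiff (exp_contDiff' snd_contDiff), lapE_snd, lapE_exp_snd, lapE_const, lapE_const]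
      ring
    have hvp : ZPeriodicE n v := by
      intro x y k
      simp only [v, hwp x y k]
    have := max_strip hv hvp (l := fun _ => -R) continuous_const hh (fun _ _ => rfl) hhp
      (fun q _ hq => by
        rw [hlapv]
        have := hlap q hq
        have := mul_pos hε (Real.exp_pos q.2)
        linarith)
      (fun x => by
        have h1 := ht x
        have h2 := Real.exp_le_exp.2 (hA' x)
        have h3 : ε * ((h x + Real.exp (h x)) - (A + Real.exp A)) ≤ 0 :=
          mul_nonpos_of_nonneg_of_nonpos hε.le (by linarith [hA' x])
        simp only [v]
        linarith)
      (fun x => by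
        have h1 := hC (x, -R) (by simp only; linarith [hA'' x])
        have h2 : Real.exp (-R) ≤ Real.exp A := Real.exp_le_exp.2 (by linarith)
        rw [div_le_iff₀ hε] at hR1
        have h3 := le_abs_self (C - M)
        have h4 : ε * ((-R + Real.exp (-R)) - (A + Real.exp A)) ≤ ε * (-R) :=
          mul_le_mul_of_nonneg_left (by linarith) hε.le
        simp only [v]
        nlinarith)
      p (by linarith : -R ≤ p.2) hp
    simp only [v] at this
    nlinarith
  have hlim : Filter.Tendsto (fun ε : ℝ => M + ε * ((A - p.2) + (Real.exp A - Real.exp p.2)))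
      (nhdsWithin 0 (Set.Ioi 0)) (nhds M) := by
    have : Continuous (fun ε : ℝ => M + ε * ((A - p.2) + (Real.exp A - Real.exp p.2))) := by fun_prop
    have := (this.tendsto 0).mono_left (nhdsWithin_le_nhds (s := Set.Ioi 0))
    simpa using this
  refine ge_of_tendsto hlim ?_
  filter_upwards [self_mem_nhdsWithin] with ε hε
  exact key ε hε



theorem sup_bound {n : ℕ} {w : (Fin n → ℝ) × ℝ → ℝ} (hw : ContDiff ℝ (⊤ : ℕ∞) w) (hwp : ZPeriodicE n w)
    {h : (Fin n → ℝ) → ℝ} (hh : Continuous h) (hhp : ZPeriodic n h) {A M C : ℝ}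
    (hA : ∀ x, |h x| ≤ A) (hM : 0 < M)
    (hC : ∀ p : (Fin n → ℝ) × ℝ, p.2 ≤ h p.1 → |w p| ≤ C)
    (hl : ∀ p : (Fin n → ℝ) × ℝ, p.2 < h p.1 → |lapE n w p| ≤ M)
    (hl0 : ∀ p : (Fin n → ℝ) × ℝ, p.2 < h p.1 - 1 → lapE n w p = 0)
    (hb : ∀ x, |w (x, h x)| ≤ M) :
    ∀ p : (Fin n → ℝ) × ℝ, p.2 ≤ h p.1 → w p ≤ M * (1 + Real.exp (A + 1) * Real.exp A) := by
  intro p hp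
  let K : ℝ := M * Real.exp (A + 1)
  have hK : 0 < K := mul_pos hM (Real.exp_pos _)
  have es : ContDiff ℝ (⊤ : ℕ∞) (fun q : (Fin n → ℝ) × ℝ => Real.exp q.2) := exp_contDiff' snd_contDiff
  have es' : ContDiff ℝ (⊤ : ℕ∞) (fun q : (Fin n → ℝ) × ℝ => K * Real.exp q.2) := contDiff_const.mul es
  have hexp : ∀ q : (Fin n → ℝ) × ℝ, q.2 ≤ h q.1 → K * Real.exp q.2 ≤ K * Real.exp A := fun q hq =>
    mul_le_mul_of_nonneg_left (Real.exp_le_exp.2 (hq.trans (abs_le.1 (hA q.1)).2)) hK.le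
  have := max_half (w := fun q => w q + K * Real.exp q.2) (hw.add es')
    (fun x y k => by simp only [hwp x y k]) hh hhp
    (fun q hq => by
      rw [lapE_add hw es', lapE_const_mul es, lapE_exp_snd]
      by_cases h1 : q.2 < h q.1 - 1
      · rw [hl0 q h1, zero_add]
        exact (mul_pos hK (Real.exp_pos _)).le
      · push Not at h1
        have h2 := (abs_le.1 (hl q hq)).1
        have h3 : M ≤ K * Real.exp q.2 := by
          simp only [K]
          rw [mul_assoc, ← Real.exp_add]
          have : 1 ≤ Real.exp (A + 1 + q.2) := by
            have := (abs_le.1 (hA q.1)).1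
            exact Real.one_le_exp (by linarith)
          nlinarith
        linarith)
    (C := C + K * Real.exp A) (M := M + K * Real.exp A)
    (fun q hq => add_le_add ((abs_le.1 (hC q hq)).2) (hexp q hq))
    (fun x => add_le_add ((abs_le.1 (hb x)).2) (hexp (x, h x) le_rfl)) p hp
  have h2 := mul_pos hK (Real.exp_pos p.2)
  simp only [K] at this h2
  nlinarith

theorem barrier_lap {n : ℕ} {h : (Fin n → ℝ) → ℝ} (hh : ContDiff ℝ (⊤ : ℕ∞) h) {H : ℝ} (hH : 0 ≤ H)
    (hlh : ∀ x, |∑ i, pdX n (pdX n h i) i x| ≤ H) (p : (Fin n → ℝ) × ℝ)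
    (h1 : h p.1 - 1 ≤ p.2) :
    Real.exp (-(H + 1)) ≤ lapE n (fun p => Real.exp ((H + 1) * (p.2 - h p.1))) p := by
  have s1 : ContDiff ℝ (⊤ : ℕ∞) (fun p : (Fin n → ℝ) × ℝ => p.2 - h p.1) := snd_contDiff.sub (fst_contDiff hh)
  have s2 : ContDiff ℝ (⊤ : ℕ∞) (fun p : (Fin n → ℝ) × ℝ => (H + 1) * (p.2 - h p.1)) := contDiff_const.mul s1
  rw [lapE_exp s2, lapE_const_mul s1, lapE_sub snd_contDiff (fst_contDiff hh), lapE_snd, lapE_fst hh]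
  have h2 : (H + 1) ^ 2 ≤ gradSqE n (fun p : (Fin n → ℝ) × ℝ => (H + 1) * (p.2 - h p.1)) p := by
    unfold gradSqE
    have : pdE n (fun p : (Fin n → ℝ) × ℝ => (H + 1) * (p.2 - h p.1)) (eY n) p = H + 1 := by
      rw [pdE_const_mul s1, pdE_sub snd_contDiff (fst_contDiff hh), pdE_snd, pdE_fst_Y hh]
      simp [eY]
    rw [this]
    exact le_add_of_nonneg_left (Finset.sum_nonneg fun _ _ => sq_nonneg _)
  have h3 := (abs_le.1 (hlh p.1)).2
  have h4 : Real.exp (-(H + 1)) ≤ Real.exp ((H + 1) * (p.2 - h p.1)) := Real.exp_le_exp.2 (by nlinarith)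
  have h5 : 1 ≤ gradSqE n (fun p : (Fin n → ℝ) × ℝ => (H + 1) * (p.2 - h p.1)) p
      + (H + 1) * (0 - ∑ i, pdX n (pdX n h i) i p.1) := by nlinarith
  have h6 := Real.exp_pos ((H + 1) * (p.2 - h p.1))
  nlinarith

theorem normal_bound_one {n : ℕ} {w : (Fin n → ℝ) × ℝ → ℝ} (hw : ContDiff ℝ (⊤ : ℕ∞) w) (hwp : ZPeriodicE n w)
    {h : (Fin n → ℝ) → ℝ} (hh : ContDiff ℝ (⊤ : ℕ∞) h) (hhp : ZPeriodic n h) {A H M C : ℝ}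
    (hA : ∀ x, |h x| ≤ A) (hH : 0 ≤ H) (hlh : ∀ x, |∑ i, pdX n (pdX n h i) i x| ≤ H) (hM : 0 < M)
    (hC : ∀ p : (Fin n → ℝ) × ℝ, p.2 ≤ h p.1 → |w p| ≤ C)
    (hl : ∀ p : (Fin n → ℝ) × ℝ, p.2 < h p.1 → |lapE n w p| ≤ M)
    (hl0 : ∀ p : (Fin n → ℝ) × ℝ, p.2 < h p.1 - 1 → lapE n w p = 0)
    (hb : ∀ x, |w (x, h x)| ≤ M)
    (hlb : ∀ x, |∑ i, pdX n (pdX n (fun x => w (x, h x)) i) i x| ≤ M) (x : Fin n → ℝ) :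
    - ((3 * Real.exp (H + 1) + 2 * (2 + Real.exp (A + 1) * Real.exp A)) * (H + 1) * M)
      ≤ pdE n w (eY n) (x, h x) := by
  set E : ℝ := Real.exp (A + 1) * Real.exp A with hE
  have hE0 : 0 < E := mul_pos (Real.exp_pos _) (Real.exp_pos _)
  set N : ℝ := M * (3 * Real.exp (H + 1) + 2 * (2 + E)) with hN
  have he0 := Real.exp_pos (H + 1)
  have hN0 : 0 < N := mul_pos hM (by linarith)
  have hβ : ContDiff ℝ (⊤ : ℕ∞) (fun x => w (x, h x)) := graph_contDiff hw hh
  have hβp : ZPeriodic n (fun x => w (x, h x)) := ZPeriodicE.graph hwp hhp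
  set β : (Fin n → ℝ) → ℝ := fun x => w (x, h x) with hβd
  have s1 : ContDiff ℝ (⊤ : ℕ∞) (fun p : (Fin n → ℝ) × ℝ => p.2 - h p.1) := snd_contDiff.sub (fst_contDiff hh)
  have s2 : ContDiff ℝ (⊤ : ℕ∞) (fun p : (Fin n → ℝ) × ℝ => (H + 1) * (p.2 - h p.1)) := contDiff_const.mul s1
  have s3 : ContDiff ℝ (⊤ : ℕ∞) (fun p : (Fin n → ℝ) × ℝ => Real.exp ((H + 1) * (p.2 - h p.1))) :=
    exp_contDiff' s2
  have s4 : ContDiff ℝ (⊤ : ℕ∞) (fun p : (Fin n → ℝ) × ℝ => Real.exp ((H + 1) * (p.2 - h p.1)) - 1) :=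
    s3.sub contDiff_const
  have s5 : ContDiff ℝ (⊤ : ℕ∞) (fun p : (Fin n → ℝ) × ℝ => N * (Real.exp ((H + 1) * (p.2 - h p.1)) - 1)) :=
    contDiff_const.mul s4
  have s6 : ContDiff ℝ (⊤ : ℕ∞) (fun p : (Fin n → ℝ) × ℝ => w p - β p.1) := hw.sub (fst_contDiff hβ)
  let v : (Fin n → ℝ) × ℝ → ℝ := fun p => (w p - β p.1) + N * (Real.exp ((H + 1) * (p.2 - h p.1)) - 1)
  have hv : ContDiff ℝ (⊤ : ℕ∞) v := s6.add s5
  have hvp : ZPeriodicE n v := by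
    intro x y k
    simp only [v, hwp x y k, hhp x k, hβp x k]
  have hlv : ∀ p : (Fin n → ℝ) × ℝ, h p.1 - 1 < p.2 → p.2 < h p.1 → 0 < lapE n v p := by
    intro p h1 h2
    simp only [v]
    rw [lapE_add s6 s5, lapE_sub hw (fst_contDiff hβ), lapE_fst hβ, lapE_const_mul s4,
      lapE_sub s3 contDiff_const, lapE_const, sub_zero]
    have h3 := barrier_lap hh hH hlh p h1.le
    have h4 := (abs_le.1 (hl p h2)).1
    have h5 := (abs_le.1 (hlb p.1)).2
    have h6 : M * 3 ≤ N * Real.exp (-(H + 1)) := by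
      rw [Real.exp_neg, ← div_eq_mul_inv, le_div_iff₀ he0, hN]
      nlinarith
    have h7 := mul_le_mul_of_nonneg_left h3 hN0.le
    linarith
  have hvt : ∀ x, v (x, h x) = 0 := fun x => by simp [v, β]
  have hsup := sup_bound hw hwp hh.continuous hhp hA hM hC hl hl0 hb
  have hvb : ∀ x, v (x, h x - 1) ≤ 0 := by
    intro x
    have h1 := hsup (x, h x - 1) (by simp)
    have h2 := (abs_le.1 (hb x)).1
    have h3 : Real.exp ((H + 1) * ((h x - 1) - h x)) ≤ 1 / 2 := by
      have : Real.exp ((H + 1) * ((h x - 1) - h x)) = (Real.exp (H + 1))⁻¹ := by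
        rw [← Real.exp_neg]; congr 1; ring
      rw [this, inv_eq_one_div]
      refine one_div_le_one_div_of_le (by norm_num) ?_
      have := Real.add_one_le_exp (H + 1)
      linarith
    simp only [v, β]
    have h4 : N * (Real.exp ((H + 1) * ((h x - 1) - h x)) - 1) ≤ N * (-(1/2)) :=
      mul_le_mul_of_nonneg_left (by linarith) hN0.le
    have h5 : M * (2 + E) ≤ N * (1/2) := by
      rw [hN]; nlinarith
    nlinarith
  have hneg := max_strip hv hvp (l := fun x => h x - 1) (hh.continuous.sub continuous_const) hh.continuous
    (fun x k => by simp only [hhp x k]) hhp hlv (fun x => (hvt x).le) hvb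
  have hder : 0 ≤ pdE n v (eY n) (x, h x) := by
    have hd := hasDerivAt_y hv x (h x)
    have ht := (hasDerivAt_iff_tendsto_slope.1 hd).mono_left
      (nhdsWithin_mono (h x) (fun z hz => ne_of_lt hz : Set.Iio (h x) ⊆ {h x}ᶜ))
    refine ge_of_tendsto ht ?_
    filter_upwards [Ioo_mem_nhdsLT (show h x - 1 < h x by linarith)] with y hy
    rw [slope_def_field, hvt, sub_zero]
    exact div_nonneg_of_nonpos (hneg (x, y) hy.1.le hy.2.le) (by linarith [hy.2])
  have hval : pdE n v (eY n) (x, h x) = pdE n w (eY n) (x, h x) + N * (H + 1) := by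
    simp only [v]
    rw [pdE_add s6 s5, pdE_sub hw (fst_contDiff hβ), pdE_fst_Y hβ, pdE_const_mul s4,
      pdE_sub s3 contDiff_const, pdE_const, pdE_exp s2, pdE_const_mul s1, pdE_sub snd_contDiff (fst_contDiff hh),
      pdE_snd, pdE_fst_Y hh]
    simp [eY]
  rw [hval] at hder
  rw [hN] at hder
  linarith

theorem normal_bound {n : ℕ} {w : (Fin n → ℝ) × ℝ → ℝ} (hw : ContDiff ℝ (⊤ : ℕ∞) w) (hwp : ZPeriodicE n w)
    {h : (Fin n → ℝ) → ℝ} (hh : ContDiff ℝ (⊤ : ℕ∞) h) (hhp : ZPeriodic n h) {A H M C : ℝ}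
    (hA : ∀ x, |h x| ≤ A) (hH : 0 ≤ H) (hlh : ∀ x, |∑ i, pdX n (pdX n h i) i x| ≤ H) (hM : 0 < M)
    (hC : ∀ p : (Fin n → ℝ) × ℝ, p.2 ≤ h p.1 → |w p| ≤ C)
    (hl : ∀ p : (Fin n → ℝ) × ℝ, p.2 < h p.1 → |lapE n w p| ≤ M)
    (hl0 : ∀ p : (Fin n → ℝ) × ℝ, p.2 < h p.1 - 1 → lapE n w p = 0)
    (hb : ∀ x, |w (x, h x)| ≤ M)
    (hlb : ∀ x, |∑ i, pdX n (pdX n (fun x => w (x, h x)) i) i x| ≤ M) (x : Fin n → ℝ) :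
    |pdE n w (eY n) (x, h x)|
      ≤ (3 * Real.exp (H + 1) + 2 * (2 + Real.exp (A + 1) * Real.exp A)) * (H + 1) * M := by
  have e : ∀ (f : (Fin n → ℝ) → ℝ), ContDiff ℝ (⊤ : ℕ∞) f → ∀ i,
      pdX n (fun x => -1 * f x) i = fun x => -1 * pdX n f i x := by
    intro f hf i
    funext z
    unfold pdX
    rw [fderiv_const_mul (smooth_differentiable hf z)]
    rfl
  have hβ : ContDiff ℝ (⊤ : ℕ∞) (fun x => w (x, h x)) := graph_contDiff hw hh
  have h1 := normal_bound_one hw hwp hh hhp hA hH hlh hM hC hl hl0 hb hlb x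
  have h2 := normal_bound_one (w := fun p => -1 * w p) (contDiff_const.mul hw)
    (fun x y k => by simp only [hwp x y k]) hh hhp hA hH hlh hM (C := C)
    (fun p hp => by simpa using hC p hp)
    (fun p hp => by rw [lapE_const_mul hw]; simpa using hl p hp)
    (fun p hp => by rw [lapE_const_mul hw, hl0 p hp, mul_zero])
    (fun x => by simpa using hb x)
    (fun x => by
      simp only [e _ hβ, e _ (pdX_contDiff hβ _)]
      rw [← Finset.mul_sum]
      simpa using hlb x) x
  rw [pdE_const_mul hw] at h2
  rw [abs_le]
  constructor <;> linarith



/-! ### Time derivative of the boundary trace -/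

theorem taylor2 {n : ℕ} {F : (Fin n → ℝ) × ℝ → ℝ} (hF : ContDiff ℝ (⊤ : ℕ∞) F) (hFp : ZPeriodicE n F) (t : ℝ)
    (h0 : ∀ x, F (x, t) = 0) (h1 : ∀ x, pdE n F (eY n) (x, t) = 0) :
    ∃ C : ℝ, 0 ≤ C ∧ ∀ x s, |s - t| ≤ 1 → |F (x, s)| ≤ C * (s - t) ^ 2 := by
  have hF1 := pdE_contDiff hF (eY n)
  have hF2 := pdE_contDiff hF1 (eY n)
  obtain ⟨C, hC0, hC⟩ := periodic_bounded (n := n) (f := fun x s => pdE n (pdE n F (eY n)) (eY n) (x, s))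
    (K := Set.Icc (t - 1) (t + 1)) hF2.continuous isCompact_Icc
    (fun s _ x k => ((hFp.pdE _).pdE _) x s k)
  refine ⟨C, hC0, fun x s hs => ?_⟩
  have hs' := abs_le.1 hs
  have hsub : ∀ r ∈ Set.uIcc t s, |r - t| ≤ |s - t| := fun r hr => Set.abs_sub_left_of_mem_uIcc hr
  have b1 : ∀ r ∈ Set.uIcc t s, |pdE n F (eY n) (x, r)| ≤ C * |s - t| := by
    intro r hr
    have := (convex_uIcc t s).norm_image_sub_le_of_norm_hasDerivWithin_le
      (f := fun r => pdE n F (eY n) (x, r)) (C := C)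
      (fun r _ => (hasDerivAt_y hF1 x r).hasDerivWithinAt)
      (fun r hr => hC x r (by
        have := abs_le.1 ((hsub r hr).trans hs)
        constructor <;> linarith)) Set.left_mem_uIcc hr
    rw [h1, sub_zero] at this
    exact this.trans (mul_le_mul_of_nonneg_left (hsub r hr) hC0)
  have := (convex_uIcc t s).norm_image_sub_le_of_norm_hasDerivWithin_le
      (f := fun r => F (x, r)) (C := C * |s - t|)
      (fun r _ => (hasDerivAt_y hF x r).hasDerivWithinAt) b1 Set.left_mem_uIcc Set.right_mem_uIcc
  rw [h0, sub_zero, Real.norm_eq_abs, Real.norm_eq_abs, mul_assoc, abs_mul_abs_self] at this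
  rw [sq]
  exact this

theorem lip1 {n : ℕ} {F : (Fin n → ℝ) × ℝ → ℝ} (hF : ContDiff ℝ (⊤ : ℕ∞) F) (hFp : ZPeriodicE n F) (t : ℝ) :
    ∃ C : ℝ, 0 ≤ C ∧ ∀ x s, |s - t| ≤ 1 → |F (x, s) - F (x, t)| ≤ C * |s - t| := by
  have hF1 := pdE_contDiff hF (eY n)
  obtain ⟨C, hC0, hC⟩ := periodic_bounded (n := n) (f := fun x s => pdE n F (eY n) (x, s))
    (K := Set.Icc (t - 1) (t + 1)) hF1.continuous isCompact_Icc
    (fun s _ x k => (hFp.pdE _) x s k)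
  refine ⟨C, hC0, fun x s hs => ?_⟩
  have hsub : ∀ r ∈ Set.uIcc t s, |r - t| ≤ |s - t| := fun r hr => Set.abs_sub_left_of_mem_uIcc hr
  exact (convex_uIcc t s).norm_image_sub_le_of_norm_hasDerivWithin_le
      (f := fun r => F (x, r)) (C := C)
      (fun r _ => (hasDerivAt_y hF x r).hasDerivWithinAt)
      (fun r hr => hC x r (by
        have := abs_le.1 ((hsub r hr).trans hs)
        constructor <;> linarith)) Set.left_mem_uIcc Set.right_mem_uIcc

theorem eq_closed_of_lt {n : ℕ} {h : (Fin n → ℝ) → ℝ} {f g : (Fin n → ℝ) × ℝ → ℝ}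
    (hf : Continuous f) (hg : Continuous g)
    (he : ∀ p : (Fin n → ℝ) × ℝ, p.2 < h p.1 → f p = g p) :
    ∀ p : (Fin n → ℝ) × ℝ, p.2 ≤ h p.1 → f p = g p := by
  rintro ⟨x, y⟩ hp
  have t1 : Filter.Tendsto (fun r => f (x, r)) (nhdsWithin y (Set.Iio y)) (nhds (f (x, y))) :=
    ((hf.comp (Continuous.prodMk_right x)).tendsto y).mono_left nhdsWithin_le_nhds
  have t2 : Filter.Tendsto (fun r => g (x, r)) (nhdsWithin y (Set.Iio y)) (nhds (g (x, y))) :=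
    ((hg.comp (Continuous.prodMk_right x)).tendsto y).mono_left nhdsWithin_le_nhds
  refine tendsto_nhds_unique t1 (t2.congr' ?_)
  filter_upwards [self_mem_nhdsWithin] with r hr
  exact (he (x, r) (lt_of_lt_of_le hr hp)).symm

theorem shift_contDiff {n : ℕ} {h : (Fin n → ℝ) → ℝ} (hh : ContDiff ℝ (⊤ : ℕ∞) h)
    {f : (Fin n → ℝ) × ℝ → ℝ} (hf : ContDiff ℝ (⊤ : ℕ∞) f) :
    ContDiff ℝ (⊤ : ℕ∞) (fun p : (Fin n → ℝ) × ℝ => f (p.1, h p.1 + p.2)) :=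
  hf.comp (contDiff_fst.prodMk ((fst_contDiff hh).add snd_contDiff))

theorem lap_flat {n : ℕ} {h : (Fin n → ℝ) → ℝ} (hh : ContDiff ℝ (⊤ : ℕ∞) h) (hhp : ZPeriodic n h)
    {φ : (Fin n → ℝ) × ℝ → ℝ} (hφ : ContDiff ℝ (⊤ : ℕ∞) φ) (hφp : ZPeriodicE n φ)
    (hl : ∀ p : (Fin n → ℝ) × ℝ, p.2 < h p.1 → lapE n φ p = 0) :
    ∃ C : ℝ, 0 ≤ C ∧ ∀ p : (Fin n → ℝ) × ℝ, |p.2 - h p.1| ≤ 1 → |lapE n φ p| ≤ C * (p.2 - h p.1) ^ 2 := by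
  have hL := lapE_contDiff hφ
  have hLp := hφp.lapE
  have hcl := eq_closed_of_lt (h := h) (g := fun _ => 0) hL.continuous continuous_const hl
  have hcl1 := pdE_eq_of_eq (φ₂ := fun _ => (0:ℝ)) hh hL contDiff_const hcl (eY n)
  have hS := shift_contDiff hh hL
  obtain ⟨C, hC0, hC⟩ := taylor2 hS
    (fun x y k => by
      simp only [hhp x k]
      exact hLp x _ k) 0
    (fun x => by
      simp only [add_zero]
      exact hcl (x, h x) le_rfl)
    (fun x => by
      have h1 := hasDerivAt_y hS x 0
      have h2 := (hasDerivAt_y hL x (h x + 0)).comp_const_add (h x) 0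
      rw [h1.unique h2, add_zero, hcl1 (x, h x) le_rfl, pdE_const])
  refine ⟨C, hC0, fun p hp => ?_⟩
  have := hC p.1 (p.2 - h p.1) (by simpa using hp)
  simpa using this

theorem bdd_above {n : ℕ} {h : (Fin n → ℝ) → ℝ} (hh : ContDiff ℝ (⊤ : ℕ∞) h) (hhp : ZPeriodic n h)
    {φ : (Fin n → ℝ) × ℝ → ℝ} (hφ : ContDiff ℝ (⊤ : ℕ∞) φ) (hφp : ZPeriodicE n φ) {C : ℝ}
    (hC : ∀ p : (Fin n → ℝ) × ℝ, p.2 ≤ h p.1 → |φ p| ≤ C) :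
    ∃ C' : ℝ, ∀ p : (Fin n → ℝ) × ℝ, p.2 ≤ h p.1 + 1 → |φ p| ≤ C' := by
  obtain ⟨D, hD0, hD⟩ := periodic_bounded (n := n) (f := fun x s => φ (x, h x + s))
    (K := Set.Icc 0 1) (shift_contDiff hh hφ).continuous isCompact_Icc
    (fun s _ x k => by
      simp only [hhp x k]
      exact hφp x _ k)
  refine ⟨max C D, fun p hp => ?_⟩
  rcases le_total p.2 (h p.1) with h1 | h1
  · exact (hC p h1).trans (le_max_left _ _)
  · have := hD p.1 (p.2 - h p.1) ⟨by linarith, by linarith⟩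
    simp only [add_sub_cancel] at this
    exact this.trans (le_max_right _ _)

theorem pdX_slice {n : ℕ} {F : (Fin n → ℝ) × ℝ → ℝ} (hF : ContDiff ℝ (⊤ : ℕ∞) F) (s : ℝ) (i : Fin n) :
    pdX n (fun x => F (x, s)) i = fun x => pdE n F (eX n i) (x, s) := by
  funext x
  have := pdX_graph (h := fun _ => s) hF contDiff_const i x
  rw [this]
  simp [pdX]

theorem lap_slice {n : ℕ} {F : (Fin n → ℝ) × ℝ → ℝ} (hF : ContDiff ℝ (⊤ : ℕ∞) F) (s : ℝ) (x : Fin n → ℝ) :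
    ∑ i, pdX n (pdX n (fun x => F (x, s)) i) i x = ∑ i, pdE n (pdE n F (eX n i)) (eX n i) (x, s) := by
  refine Finset.sum_congr rfl fun i _ => ?_
  rw [pdX_slice hF, pdX_slice (pdE_contDiff hF _)]

/-- lateral derivatives keep vanishing along the slice s = t -/
theorem slice_zero {n : ℕ} {F : (Fin n → ℝ) × ℝ → ℝ} (hF : ContDiff ℝ (⊤ : ℕ∞) F) {t : ℝ}
    (h0 : ∀ x, F (x, t) = 0) (i : Fin n) (x : Fin n → ℝ) : pdE n F (eX n i) (x, t) = 0 := by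
  have := congrFun (pdX_slice hF t i) x
  rw [← this]
  have e : (fun x => F (x, t)) = fun _ => 0 := funext h0
  rw [e]
  simp [pdX]

theorem lap_taylor {n : ℕ} {F : (Fin n → ℝ) × ℝ → ℝ} (hF : ContDiff ℝ (⊤ : ℕ∞) F) (hFp : ZPeriodicE n F) (t : ℝ)
    (h0 : ∀ x, F (x, t) = 0) (h1 : ∀ x, pdE n F (eY n) (x, t) = 0) :
    ∃ C : ℝ, 0 ≤ C ∧ ∀ x s, |s - t| ≤ 1 →
      |∑ i, pdX n (pdX n (fun x => F (x, s)) i) i x| ≤ C * (s - t) ^ 2 := by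
  have hX := fun i => pdE_contDiff hF (eX n i)
  have hXX := fun i => pdE_contDiff (hX i) (eX n i)
  have key : ∀ i, ∃ C : ℝ, 0 ≤ C ∧ ∀ x s, |s - t| ≤ 1 →
      |pdE n (pdE n F (eX n i)) (eX n i) (x, s)| ≤ C * (s - t) ^ 2 := by
    intro i
    refine taylor2 (hXX i) ((hFp.pdE _).pdE _) t
      (slice_zero (hX i) (slice_zero hF h0 i) i) ?_
    rw [pdE_comm (hX i), pdE_comm hF]
    exact slice_zero (pdE_contDiff (pdE_contDiff hF _) _) (slice_zero (pdE_contDiff hF _) h1 i) i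
  choose C hC0 hC using key
  refine ⟨∑ i, C i, Finset.sum_nonneg fun i _ => hC0 i, fun x s hs => ?_⟩
  rw [lap_slice hF, Finset.sum_mul]
  exact (Finset.abs_sum_le_sum_abs _ _).trans (Finset.sum_le_sum fun i _ => hC i x s hs)



theorem time_deriv {n : ℕ} {h : ℝ → (Fin n → ℝ) → ℝ} (hs : ContDiff ℝ (⊤ : ℕ∞) (Function.uncurry h))
    (hper : ∀ t : ℝ, ZPeriodic n (h t)) (t : ℝ)
    {φ Φ : (Fin n → ℝ) × ℝ → ℝ} (hφ : IsHarmonicExt n (h t) (h t) φ)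
    (hΦ : IsHarmonicExt n (h t)
      (fun x => deriv (fun s => h s x) t - deriv (fun s => h s x) t * pdE n φ (eY n) (x, h t x)) Φ)
    {C₀ C₁ : ℝ} (hC₀ : ∀ p : (Fin n → ℝ) × ℝ, p.2 ≤ h t p.1 → |φ p| ≤ C₀)
    (hC₁ : ∀ p : (Fin n → ℝ) × ℝ, p.2 ≤ h t p.1 → |Φ p| ≤ C₁) (x₀ : Fin n → ℝ) :
    HasDerivAt (fun s => HSB n h s x₀)
      (pdE n (pdE n φ (eY n)) (eY n) (x₀, h t x₀) * deriv (fun s => h s x₀) t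
        + pdE n Φ (eY n) (x₀, h t x₀)) t := by
  have hφs := hφ.smooth
  have hΦs := hΦ.smooth
  have hsl : ∀ s, ContDiff ℝ (⊤ : ℕ∞) (h s) := fun s =>
    hs.comp (contDiff_const.prodMk contDiff_id : ContDiff ℝ (⊤ : ℕ∞) fun x : Fin n → ℝ => (s, x))
  let H : (Fin n → ℝ) × ℝ → ℝ := fun p => h p.2 p.1
  have hH : ContDiff ℝ (⊤ : ℕ∞) H := hs.comp (contDiff_snd.prodMk contDiff_fst)
  have hHp : ZPeriodicE n H := fun x y k => hper y x k
  have hHd : ∀ x, deriv (fun s => h s x) t = pdE n H (eY n) (x, t) := fun x =>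
    (hasDerivAt_y hH x t).deriv
  have hgr : ∀ {f : (Fin n → ℝ) × ℝ → ℝ}, ContDiff ℝ (⊤ : ℕ∞) f →
      ContDiff ℝ (⊤ : ℕ∞) (fun p : (Fin n → ℝ) × ℝ => f (p.1, H p)) := fun hf =>
    hf.comp (contDiff_fst.prodMk hH)
  have hgrd : ∀ {f : (Fin n → ℝ) × ℝ → ℝ}, ContDiff ℝ (⊤ : ℕ∞) f → ∀ x,
      HasDerivAt (fun s => f (x, h s x)) (pdE n f (eY n) (x, h t x) * pdE n H (eY n) (x, t)) t := by
    intro f hf x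
    exact (hasDerivAt_y hf x (h t x)).comp t (hasDerivAt_y hH x t)
  let β : (Fin n → ℝ) × ℝ → ℝ := fun p => H p - φ (p.1, H p) - (p.2 - t) * Φ (p.1, H p)
  have hβ : ContDiff ℝ (⊤ : ℕ∞) β :=
    (hH.sub (hgr hφs)).sub ((snd_contDiff.sub contDiff_const).mul (hgr hΦs))
  have hβp : ZPeriodicE n β := by
    intro x y k
    simp only [β, hHp x y k, hφ.periodic x (H (x, y)) k, hΦ.periodic x (H (x, y)) k]
  have hβ0 : ∀ x, β (x, t) = 0 := by
    intro x
    have := hφ.boundary x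
    simp only [β, H, sub_self, zero_mul, sub_zero, this]
  have hβ1 : ∀ x, pdE n β (eY n) (x, t) = 0 := by
    intro x
    have h1 := hasDerivAt_y hβ x t
    have h2 := ((hasDerivAt_y hH x t).sub (hgrd hφs x)).sub
      (((hasDerivAt_id t).sub_const t).mul (hgrd hΦs x))
    have h3 := h1.unique h2
    rw [h3, hΦ.boundary x, hHd]
    simp
    ring
  obtain ⟨c1, hc10, hc1⟩ := taylor2 hβ hβp t hβ0 hβ1
  obtain ⟨c2, hc20, hc2⟩ := lap_taylor hβ hβp t hβ0 hβ1
  obtain ⟨L, hL0, hL⟩ := lip1 hH hHp t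
  obtain ⟨c3, hc30, hc3⟩ := lap_flat (hsl t) (hper t) hφs hφ.periodic hφ.harmonic
  obtain ⟨c4, hc40, hc4⟩ := lap_flat (hsl t) (hper t) hΦs hΦ.periodic hΦ.harmonic
  obtain ⟨b3, hb3⟩ := bdd_above (hsl t) (hper t) hφs hφ.periodic hC₀
  obtain ⟨b4, hb4⟩ := bdd_above (hsl t) (hper t) hΦs hΦ.periodic hC₁
  have hφl := eq_closed_of_lt (h := h t) (g := fun _ => 0) (lapE_contDiff hφs).continuous continuous_const hφ.harmonic
  have hΦl := eq_closed_of_lt (h := h t) (g := fun _ => 0) (lapE_contDiff hΦs).continuous continuous_const hΦ.harmonic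
  obtain ⟨A, hA0, hA⟩ := periodic_bounded (n := n) (f := fun x s => H (x, s))
    (K := Set.Icc (t - 1) (t + 1)) hH.continuous isCompact_Icc (fun s _ x k => hHp x s k)
  obtain ⟨Hb, hHb0, hHb⟩ := periodic_bounded (n := n)
    (f := fun x s => ∑ i, pdE n (pdE n H (eX n i)) (eX n i) (x, s))
    (K := Set.Icc (t - 1) (t + 1))
    (continuous_finsetSum _ fun i _ => (pdE_contDiff (pdE_contDiff hH (eX n i)) (eX n i)).continuous)
    isCompact_Icc
    (fun s _ x k => Finset.sum_congr rfl fun i _ => ((hHp.pdE _).pdE _) x s k)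
  set c : ℝ := c1 + c2 + (c3 + c4) * L ^ 2 + 1 with hc
  have hL2 := sq_nonneg L
  have hcL : 0 ≤ (c3 + c4) * L ^ 2 := by positivity
  set K : ℝ := (3 * Real.exp (Hb + 1) + 2 * (2 + Real.exp (A + 1) * Real.exp A)) * (Hb + 1) with hK
  have main : ∀ s, |s - t| ≤ 1 → |s - t| * (L + 1) ≤ 1 → s ≠ t →
      |HSB n h s x₀ - (pdE n φ (eY n) (x₀, h s x₀) + (s - t) * pdE n Φ (eY n) (x₀, h s x₀))|
        ≤ K * (c * (s - t) ^ 2) := by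
    intro s hs1 hsL hst
    obtain ⟨u, hu, Cu, hCu0, hCu⟩ := harmonic_exists (hsl s) (hper s) (hsl s) (hper s)
    have hus := hu.smooth
    have hsI : s ∈ Set.Icc (t - 1) (t + 1) := by
      have := abs_le.1 hs1
      constructor <;> linarith
    have hdist : ∀ x, |h s x - h t x| ≤ L * |s - t| := fun x => hL x s hs1
    have habs := abs_nonneg (s - t)
    have hdist1 : ∀ x, |h s x - h t x| ≤ 1 := fun x => by
      have := hdist x
      nlinarith
    have hσ2 : 0 < (s - t) ^ 2 := by
      have : s - t ≠ 0 := sub_ne_zero.2 hst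
      positivity
    have sΦ : ContDiff ℝ (⊤ : ℕ∞) (fun p => (s - t) * Φ p) := contDiff_const.mul hΦs
    have sd : ContDiff ℝ (⊤ : ℕ∞) (fun p => u p - φ p) := hus.sub hφs
    have hw : ContDiff ℝ (⊤ : ℕ∞) (fun p => (u p - φ p) - (s - t) * Φ p) := sd.sub sΦ
    have hwb : ∀ x, (u (x, h s x) - φ (x, h s x)) - (s - t) * Φ (x, h s x) = β (x, s) := by
      intro x
      rw [hu.boundary x]
    have hlapw : ∀ p, lapE n (fun p => (u p - φ p) - (s - t) * Φ p) p
        = lapE n u p - lapE n φ p - (s - t) * lapE n Φ p := by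
      intro p
      rw [lapE_sub sd sΦ, lapE_sub hus hφs, lapE_const_mul hΦs]
    have hM : 0 < c * (s - t) ^ 2 := mul_pos (by linarith) hσ2
    have hb := normal_bound (n := n) (w := fun p => (u p - φ p) - (s - t) * Φ p) hw
      (fun x y k => by simp only [hu.periodic x y k, hφ.periodic x y k, hΦ.periodic x y k])
      (hsl s) (hper s) (A := A) (H := Hb) (M := c * (s - t) ^ 2) (C := Cu + b3 + b4)
      (fun x => hA x s hsI) hHb0
      (fun x => by
        have := hHb x s hsI
        rw [← lap_slice hH] at this
        exact this) hM
      (fun p hp => by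
        have h1 := (hCu p hp).1
        have h0 := hdist1 p.1
        have hp' : p.2 ≤ h t p.1 + 1 := by linarith [(abs_le.1 h0).2]
        have h2 := hb3 p hp'
        have h3 := hb4 p hp'
        have h4 : |(s - t) * Φ p| ≤ b4 := by
          rw [abs_mul]
          have := abs_nonneg (Φ p)
          nlinarith
        have h5 := abs_sub (u p - φ p) ((s - t) * Φ p)
        have h6 := abs_sub (u p) (φ p)
        linarith)
      (fun p hp => by
        rw [hlapw, hu.harmonic p hp]
        rcases le_or_gt p.2 (h t p.1) with h1 | h1
        · rw [hφl p h1, hΦl p h1]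
          simpa using hM.le
        · have h2 := hdist p.1
          have h3 := (abs_le.1 h2).2
          have h4 : |p.2 - h t p.1| ≤ L * |s - t| := by
            rw [abs_of_pos (by linarith)]
            linarith
          have h5 : |p.2 - h t p.1| ≤ 1 := h4.trans (by nlinarith)
          have h6 : (p.2 - h t p.1) ^ 2 ≤ L ^ 2 * (s - t) ^ 2 := by
            rw [← sq_abs (p.2 - h t p.1), ← sq_abs (s - t), ← mul_pow]
            exact pow_le_pow_left₀ (abs_nonneg _) h4 2
          have h7 := (hc3 p h5).trans (mul_le_mul_of_nonneg_left h6 hc30)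
          have h8 := (hc4 p h5).trans (mul_le_mul_of_nonneg_left h6 hc40)
          have h9 : |(s - t) * lapE n Φ p| ≤ c4 * (L ^ 2 * (s - t) ^ 2) := by
            rw [abs_mul]
            have := abs_nonneg (lapE n Φ p)
            nlinarith
          have h10 := abs_sub (0 - lapE n φ p) ((s - t) * lapE n Φ p)
          have h11 : |0 - lapE n φ p| = |lapE n φ p| := by rw [zero_sub, abs_neg]
          rw [h11] at h10
          have h12 : 0 ≤ (c1 + c2 + 1) * (s - t) ^ 2 := by positivity
          rw [hc]
          linarith)
      (fun p hp => by
        have h1 := (abs_le.1 (hdist1 p.1)).2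
        rw [hlapw, hu.harmonic p (by linarith), hφl p (by linarith), hΦl p (by linarith)]
        simp)
      (fun x => by
        rw [hwb]
        refine (hc1 x s hs1).trans (mul_le_mul_of_nonneg_right ?_ hσ2.le)
        linarith)
      (fun x => by
        simp only [hwb]
        refine (hc2 x s hs1).trans (mul_le_mul_of_nonneg_right ?_ hσ2.le)
        linarith) x₀
    have e1 : HSB n h s x₀ = pdE n u (eY n) (x₀, h s x₀) := Bop_eq (hsl s) (hper s) hu x₀
    rw [pdE_sub sd sΦ, pdE_sub hus hφs, pdE_const_mul hΦs] at hb
    rw [e1]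
    refine le_trans (le_of_eq ?_) hb
    congr 1
    ring
  have e0 : HSB n h t x₀ = pdE n φ (eY n) (x₀, h t x₀) := Bop_eq (hsl t) (hper t) hφ x₀
  have hg : HasDerivAt (fun s => pdE n φ (eY n) (x₀, h s x₀) + (s - t) * pdE n Φ (eY n) (x₀, h s x₀))
      (pdE n (pdE n φ (eY n)) (eY n) (x₀, h t x₀) * deriv (fun s => h s x₀) t
        + pdE n Φ (eY n) (x₀, h t x₀)) t := by
    have := (hgrd (pdE_contDiff hφs (eY n)) x₀).add
      (((hasDerivAt_id t).sub_const t).mul (hgrd (pdE_contDiff hΦs (eY n)) x₀))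
    refine this.congr_deriv ?_
    rw [hHd]
    simp
  have hd : HasDerivAt (fun s => HSB n h s x₀
      - (pdE n φ (eY n) (x₀, h s x₀) + (s - t) * pdE n Φ (eY n) (x₀, h s x₀))) 0 t := by
    have hO : (fun s => HSB n h s x₀
      - (pdE n φ (eY n) (x₀, h s x₀) + (s - t) * pdE n Φ (eY n) (x₀, h s x₀)))
        =O[nhds t] fun s => ‖s - t‖ ^ 2 := by
      refine Asymptotics.IsBigO.of_bound (K * c) ?_
      have hlim : Filter.Tendsto (fun s : ℝ => |s - t| * (L + 1)) (nhds t) (nhds 0) := by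
        have : Continuous (fun s : ℝ => |s - t| * (L + 1)) := by fun_prop
        simpa using this.tendsto t
      filter_upwards [hlim.eventually (gt_mem_nhds one_pos)] with s hs2
      have hs1 : |s - t| ≤ 1 := by nlinarith [abs_nonneg (s - t)]
      by_cases hst : s = t
      · subst hst
        simp [e0]
      · have := main s hs1 hs2.le hst
        rw [Real.norm_eq_abs, norm_pow, norm_norm, Real.norm_eq_abs, sq_abs, mul_assoc]
        exact this
    exact (hO.hasFDerivAt one_lt_two).hasDerivAt.congr_deriv (by simp)
  have := hd.add hg
  simp only [zero_add] at this
  refine this.congr_of_eventuallyEq (Filter.Eventually.of_forall fun s => ?_)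
  simp



theorem bdd_unique_le {n : ℕ} {h : (Fin n → ℝ) → ℝ} (hh : ContDiff ℝ (⊤ : ℕ∞) h) (hp : ZPeriodic n h)
    {f g : (Fin n → ℝ) × ℝ → ℝ} (hf : ContDiff ℝ (⊤ : ℕ∞) f) (hg : ContDiff ℝ (⊤ : ℕ∞) g)
    (hfp : ZPeriodicE n f) (hgp : ZPeriodicE n g)
    (hfl : ∀ p : (Fin n → ℝ) × ℝ, p.2 < h p.1 → lapE n f p = 0)
    (hgl : ∀ p : (Fin n → ℝ) × ℝ, p.2 < h p.1 → lapE n g p = 0)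
    {C D : ℝ} (hC : ∀ p : (Fin n → ℝ) × ℝ, p.2 ≤ h p.1 → |f p| ≤ C)
    (hD : ∀ p : (Fin n → ℝ) × ℝ, p.2 ≤ h p.1 → |g p| ≤ D)
    (he : ∀ x, f (x, h x) = g (x, h x)) :
    ∀ p : (Fin n → ℝ) × ℝ, p.2 ≤ h p.1 → f p ≤ g p := by
  intro p hpp
  have := max_half (w := fun p => f p - g p) (hf.sub hg)
    (fun x y k => by simp only [hfp x y k, hgp x y k]) hh.continuous hp
    (fun q hq => by rw [lapE_sub hf hg, hfl q hq, hgl q hq, sub_zero]) (C := C + D) (M := 0)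
    (fun q hq => by
      have h1 := (abs_le.1 (hC q hq)).2
      have h2 := (abs_le.1 (hD q hq)).1
      linarith)
    (fun x => by rw [he, sub_self]) p hpp
  linarith

theorem DtN_trace {n : ℕ} {h : (Fin n → ℝ) → ℝ} (hh : ContDiff ℝ (⊤ : ℕ∞) h) (hp : ZPeriodic n h)
    {f : (Fin n → ℝ) × ℝ → ℝ} (hf : ContDiff ℝ (⊤ : ℕ∞) f) (hfp : ZPeriodicE n f)
    (hfl : ∀ p : (Fin n → ℝ) × ℝ, p.2 < h p.1 → lapE n f p = 0)
    {C : ℝ} (hC : ∀ p : (Fin n → ℝ) × ℝ, p.2 ≤ h p.1 → |f p| ≤ C)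
    {ψ : (Fin n → ℝ) → ℝ} (hψ : ∀ x, ψ x = f (x, h x)) (x : Fin n → ℝ) :
    DtN n h ψ x = pdE n f (eY n) (x, h x) - ∑ i, pdX n h i x * pdE n f (eX n i) (x, h x) := by
  have eψ : ψ = fun x => f (x, h x) := funext hψ
  subst eψ
  obtain ⟨u, hu, D, hD0, hD⟩ := harmonic_exists hh hp (graph_contDiff hf hh) (ZPeriodicE.graph hfp hp)
  have hD' := fun p hp => (hD p hp).1
  have he : ∀ p : (Fin n → ℝ) × ℝ, p.2 ≤ h p.1 → u p = f p := fun p hpp => le_antisymm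
    (bdd_unique_le hh hp hu.smooth hf hu.periodic hfp hu.harmonic hfl hD' hC hu.boundary p hpp)
    (bdd_unique_le hh hp hf hu.smooth hfp hu.periodic hfl hu.harmonic hC hD' (fun x => (hu.boundary x).symm) p hpp)
  rw [DtN_eq hh hp hu x]
  have e := fun v => pdE_eq_of_eq hh hu.smooth hf he v (x, h x) le_rfl
  simp only [e]

theorem final_algebra {n : ℕ} (η r W : Fin n → ℝ) (S : Fin n → Fin n → ℝ) (Φx V τ : Fin n → ℝ)
    (p a hd Φy γ GΦ : ℝ)
    (hV : ∀ i, V i = a * η i)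
    (hhd : hd = -((1 - a) - ∑ i, η i * V i))
    (hτ : ∀ i, Φx i + η i * Φy = τ i)
    (hτ' : ∀ i, τ i = (2 * a - 1) * (-(r i + η i * p)) + 2 * ∑ j, V j * (S j i + η i * r j))
    (hW : ∀ i, W i = r i - ∑ j, η j * S i j)
    (hGΦ : GΦ = Φy - ∑ i, η i * Φx i)
    (hγ : γ = (1 + ∑ i, η i ^ 2)⁻¹ * (GΦ + (2 * a - 1) * (p - ∑ i, η i * r i) - 2 * ∑ i, V i * W i)) :
    -(p * hd + Φy) - ∑ i, V i * (-(r i + η i * p)) + a * (-(p - ∑ i, η i * r i)) + γ = 0 := by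
  set e : ℝ := ∑ i, η i ^ 2 with he
  set ρ : ℝ := ∑ i, η i * r i with hρ
  set σ : ℝ := ∑ i, ∑ j, η i * η j * S i j with hσ
  have he0 : 0 ≤ e := Finset.sum_nonneg fun _ _ => sq_nonneg _
  have hD : (1 + e) ≠ 0 := by positivity
  have e1 : ∑ i, η i * V i = a * e := by
    rw [he, Finset.mul_sum]
    exact Finset.sum_congr rfl fun i _ => by rw [hV]; ring
  have e2 : ∑ i, V i * (-(r i + η i * p)) = -(a * (ρ + e * p)) := by
    rw [he, hρ, Finset.sum_mul, ← Finset.sum_add_distrib, Finset.mul_sum, ← Finset.sum_neg_distrib]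
    exact Finset.sum_congr rfl fun i _ => by rw [hV]; ring
  have e3 : ∑ i, V i * W i = a * (ρ - σ) := by
    rw [hρ, hσ, ← Finset.sum_sub_distrib, Finset.mul_sum]
    refine Finset.sum_congr rfl fun i _ => ?_
    rw [hV, hW, mul_sub, mul_sub, Finset.mul_sum, Finset.mul_sum]
    congr 1
    · ring
    · exact Finset.sum_congr rfl fun j _ => by ring
  have e4 : ∑ i, η i * Φx i = ∑ i, η i * τ i - e * Φy := by
    rw [he, Finset.sum_mul, ← Finset.sum_sub_distrib]
    exact Finset.sum_congr rfl fun i _ => by rw [← hτ]; ring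
  have hσ2 : ∑ i, ∑ j, η i * η j * S j i = σ := by
    rw [hσ, Finset.sum_comm]
    exact Finset.sum_congr rfl fun i _ => Finset.sum_congr rfl fun j _ => by ring
  have e5 : ∑ i, η i * τ i = -(2 * a - 1) * (ρ + e * p) + 2 * a * (σ + e * ρ) := by
    have h1 : ∀ i, ∑ j, V j * (S j i + η i * r j) = a * (∑ j, η j * S j i) + a * η i * ρ := by
      intro i
      rw [hρ, Finset.mul_sum, Finset.mul_sum, ← Finset.sum_add_distrib]
      exact Finset.sum_congr rfl fun j _ => by rw [hV]; ring
    have h2 : ∀ i, η i * τ i = -(2 * a - 1) * (η i * r i) + -(2 * a - 1) * p * η i ^ 2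
        + 2 * a * (∑ j, η i * η j * S j i) + 2 * a * ρ * η i ^ 2 := by
      intro i
      have h3 : ∑ j, η i * η j * S j i = η i * ∑ j, η j * S j i := by
        rw [Finset.mul_sum]
        exact Finset.sum_congr rfl fun j _ => by ring
      rw [hτ', h1, h3]
      ring
    simp only [h2, Finset.sum_add_distrib, ← Finset.mul_sum]
    simp only [hσ2, ← he, ← hρ]
    ring
  rw [hγ, hhd, hGΦ, e1, e2, e3, e4, e5]
  field_simp
  ring

theorem heleShaw_a_evolution_aux (n : ℕ) (T : ℝ) 
    (h : ℝ → (Fin n → ℝ) → ℝ) (hsol : IsHeleShawSol n T h) (t : ℝ) (ht : t ∈ Set.Icc 0 T) (x : Fin n → ℝ) :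
    (deriv (fun s => HSa n h s x) t
        - ∑ i, HSV n h t x i * pdX n (fun z => HSa n h t z) i x
        + HSa n h t x * DtN n (h t) (fun z => HSa n h t z) x
        + HSgamma n h t x = 0) ∧
      HSgamma n h t x
        = (1 + ∑ i, (pdX n (h t) i x)^2)⁻¹ *
          ( DtN n (h t) (fun z => (HSa n h t z)^2 + ∑ i, (HSV n h t z i)^2) x
            - 2 * HSa n h t x * DtN n (h t) (fun z => HSa n h t z) x
            - 2 * ∑ i, HSV n h t x i * DtN n (h t) (fun z => HSV n h t z i) x ) := by
  have hs := hsol.smooth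
  have hper := hsol.periodic
  have hsl : ContDiff ℝ (⊤ : ℕ∞) (h t) :=
    hs.comp (contDiff_const.prodMk contDiff_id : ContDiff ℝ (⊤ : ℕ∞) fun x : Fin n → ℝ => (t, x))
  obtain ⟨φ, hφ, C, hC0, hC⟩ := harmonic_exists hsl (hper t) hsl (hper t)
  have hφs := hφ.smooth
  have sY := pdE_contDiff hφs (eY n)
  have sX := fun i => pdE_contDiff hφs (eX n i)
  have hB : ∀ z, HSB n h t z = pdE n φ (eY n) (z, h t z) := fun z => Bop_eq hsl (hper t) hφ z
  have hV : ∀ z i, HSV n h t z i = pdE n φ (eX n i) (z, h t z) := fun z i => Vop_eq hsl (hper t) hφ z i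
  have ha : ∀ z, HSa n h t z = 1 - pdE n φ (eY n) (z, h t z) := fun z => by unfold HSa; rw [hB]
  have hVa : ∀ z i, pdE n φ (eX n i) (z, h t z)
      = (1 - pdE n φ (eY n) (z, h t z)) * pdX n (h t) i z := by
    intro z i
    have h1 := pdX_graph hφs hsl i z
    have h2 : (fun x => φ (x, h t x)) = h t := funext hφ.boundary
    rw [h2] at h1
    linarith
  have hhd : ∀ z, deriv (fun s => h s z) t
      = -(pdE n φ (eY n) (z, h t z) - ∑ i, pdX n (h t) i z * pdE n φ (eX n i) (z, h t z)) := by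
    intro z
    have := hsol.equation t ht z
    rw [DtN_eq hsl (hper t) hφ z] at this
    linarith
  have s1Y : ContDiff ℝ (⊤ : ℕ∞) (fun p => 1 - pdE n φ (eY n) p) := contDiff_const.sub sY
  have sYY : ContDiff ℝ (⊤ : ℕ∞) (fun p => (1 - pdE n φ (eY n) p) * (1 - pdE n φ (eY n) p)) := s1Y.mul s1Y
  have sXX : ∀ i, ContDiff ℝ (⊤ : ℕ∞) (fun p => pdE n φ (eX n i) p * pdE n φ (eX n i) p) :=
    fun i => (sX i).mul (sX i)
  have sS : ContDiff ℝ (⊤ : ℕ∞) (fun p => ∑ i, pdE n φ (eX n i) p * pdE n φ (eX n i) p) :=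
    ContDiff.sum fun i _ => sXX i
  let Q : (Fin n → ℝ) × ℝ → ℝ := fun p =>
    ((1 - pdE n φ (eY n) p) * (1 - pdE n φ (eY n) p) - (1 - pdE n φ (eY n) p))
      + ∑ i, pdE n φ (eX n i) p * pdE n φ (eX n i) p
  have sQ : ContDiff ℝ (⊤ : ℕ∞) Q := (sYY.sub s1Y).add sS
  have hQp : ZPeriodicE n Q := by
    intro z y k
    simp only [Q, (hφ.periodic.pdE _) z y k]
  have hQd : ∀ v p, pdE n Q v p = (2 * (1 - pdE n φ (eY n) p) - 1) * (- pdE n (pdE n φ (eY n)) v p)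
      + 2 * ∑ j, pdE n φ (eX n j) p * pdE n (pdE n φ (eX n j)) v p := by
    intro v p
    simp only [Q]
    rw [pdE_add (sYY.sub s1Y) sS, pdE_sub sYY s1Y, pdE_mul s1Y s1Y, pdE_sub contDiff_const sY,
      pdE_sum _ sXX, pdE_const]
    simp only [pdE_mul (sX _) (sX _), Finset.sum_add_distrib]
    ring
  have hQb : (fun z => deriv (fun s => h s z) t - deriv (fun s => h s z) t * pdE n φ (eY n) (z, h t z))
      = fun z => Q (z, h t z) := by
    funext z
    have e1 : ∑ i, pdE n φ (eX n i) (z, h t z) * pdE n φ (eX n i) (z, h t z)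
      = (1 - pdE n φ (eY n) (z, h t z)) * ∑ i, pdX n (h t) i z * pdE n φ (eX n i) (z, h t z) := by
      rw [Finset.mul_sum]
      refine Finset.sum_congr rfl fun i _ => ?_
      rw [← mul_assoc, ← hVa]
    simp only [Q]
    rw [hhd, e1]
    ring
  obtain ⟨Φ, hΦ, D, hD0, hD⟩ := harmonic_exists hsl (hper t) (graph_contDiff sQ hsl)
    (ZPeriodicE.graph hQp (hper t))
  have hΦs := hΦ.smooth
  have hΦ' := hΦ
  rw [← hQb] at hΦ'
  have htd := time_deriv hs hper t hφ hΦ' (fun p hp => (hC p hp).1) (fun p hp => (hD p hp).1) x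
  have hlapv : ∀ v, ∀ p : (Fin n → ℝ) × ℝ, p.2 < h t p.1 → lapE n (pdE n φ v) p = 0 := by
    intro v p hp
    rw [lapE_pdE hφs]
    have := pdE_congr (F := lapE n φ) (G := fun _ => (0:ℝ))
      ((nhds_below hsl.continuous hp).mono fun q hq => hφ.harmonic q hq) v
    rw [this, pdE_const]
  -- normal derivatives of the traces
  have gB : DtN n (h t) (fun z => HSB n h t z) x = pdE n (pdE n φ (eY n)) (eY n) (x, h t x)
      - ∑ i, pdX n (h t) i x * pdE n (pdE n φ (eY n)) (eX n i) (x, h t x) :=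
    DtN_trace hsl (hper t) sY (hφ.periodic.pdE _) (hlapv _) (fun p hp => (hC p hp).2.2) hB x
  have gV : ∀ i, DtN n (h t) (fun z => HSV n h t z i) x = pdE n (pdE n φ (eX n i)) (eY n) (x, h t x)
      - ∑ j, pdX n (h t) j x * pdE n (pdE n φ (eX n i)) (eX n j) (x, h t x) := fun i =>
    DtN_trace hsl (hper t) (sX i) (hφ.periodic.pdE _) (hlapv _) (fun p hp => (hC p hp).2.1 i)
      (fun z => hV z i) x
  have gA : DtN n (h t) (fun z => HSa n h t z) x = -(pdE n (pdE n φ (eY n)) (eY n) (x, h t x)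
      - ∑ i, pdX n (h t) i x * pdE n (pdE n φ (eY n)) (eX n i) (x, h t x)) := by
    rw [DtN_trace hsl (hper t) s1Y (fun z y k => by simp only [(hφ.periodic.pdE _) z y k])
      (fun p hp => by rw [lapE_sub contDiff_const sY, lapE_const, hlapv _ p hp, sub_zero]) (C := 1 + C)
      (fun p hp => (abs_sub _ _).trans (add_le_add (by simp) (hC p hp).2.2)) ha x]
    simp only [pdE_sub contDiff_const sY, pdE_const, zero_sub, mul_neg, Finset.sum_neg_distrib]
    ring
  have gAV : DtN n (h t) (fun z => (HSa n h t z)^2 + ∑ i, (HSV n h t z i)^2) x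
      = (pdE n Φ (eY n) (x, h t x) - ∑ i, pdX n (h t) i x * pdE n Φ (eX n i) (x, h t x))
        - (pdE n (pdE n φ (eY n)) (eY n) (x, h t x)
      - ∑ i, pdX n (h t) i x * pdE n (pdE n φ (eY n)) (eX n i) (x, h t x)) := by
    rw [DtN_trace (f := fun p => Φ p + (1 - pdE n φ (eY n) p)) hsl (hper t) (hΦs.add s1Y)
      (fun z y k => by simp only [(hφ.periodic.pdE _) z y k, hΦ.periodic z y k])
      (fun p hp => by rw [lapE_add hΦs s1Y, lapE_sub contDiff_const sY, lapE_const, hlapv _ p hp,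
        hΦ.harmonic p hp, sub_zero, add_zero]) (C := D + (1 + C))
      (fun p hp => (abs_add_le _ _).trans (add_le_add (hD p hp).1
        ((abs_sub _ _).trans (add_le_add (by simp) (hC p hp).2.2)))) ?_ x]
    · simp only [pdE_add hΦs s1Y, pdE_sub contDiff_const sY, pdE_const, zero_sub, mul_neg, mul_add,
        Finset.sum_neg_distrib, Finset.sum_add_distrib]
      ring
    · intro z
      rw [hΦ.boundary z, ha]
      simp only [hV, Q, sq]
      ring
  have gBV : DtN n (h t) (fun z => (HSB n h t z)^2 + ∑ i, (HSV n h t z i)^2) x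
      = (pdE n Φ (eY n) (x, h t x) - ∑ i, pdX n (h t) i x * pdE n Φ (eX n i) (x, h t x))
        + (pdE n (pdE n φ (eY n)) (eY n) (x, h t x)
      - ∑ i, pdX n (h t) i x * pdE n (pdE n φ (eY n)) (eX n i) (x, h t x)) := by
    rw [DtN_trace (f := fun p => Φ p + pdE n φ (eY n) p) hsl (hper t) (hΦs.add sY)
      (fun z y k => by simp only [(hφ.periodic.pdE _) z y k, hΦ.periodic z y k])
      (fun p hp => by rw [lapE_add hΦs sY, hlapv _ p hp,
        hΦ.harmonic p hp, add_zero]) (C := D + C)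
      (fun p hp => (abs_add_le _ _).trans (add_le_add (hD p hp).1 (hC p hp).2.2)) ?_ x]
    · simp only [pdE_add hΦs sY, mul_add, Finset.sum_add_distrib]
      ring
    · intro z
      rw [hΦ.boundary z, hB]
      simp only [hV, Q, sq]
      ring
  have hda : deriv (fun s => HSa n h s x) t
      = -(pdE n (pdE n φ (eY n)) (eY n) (x, h t x) * deriv (fun s => h s x) t
        + pdE n Φ (eY n) (x, h t x)) := by
    have := (htd.const_sub 1).deriv
    exact this
  have hdxa : ∀ i, pdX n (fun z => HSa n h t z) i x
      = -(pdE n (pdE n φ (eY n)) (eX n i) (x, h t x)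
        + pdX n (h t) i x * pdE n (pdE n φ (eY n)) (eY n) (x, h t x)) := by
    intro i
    have e : (fun z => HSa n h t z) = fun z => (fun p => 1 - pdE n φ (eY n) p) (z, h t z) := funext ha
    rw [e, pdX_graph s1Y hsl, pdE_sub contDiff_const sY, pdE_sub contDiff_const sY, pdE_const, pdE_const]
    ring
  have hτ : ∀ i, pdE n Φ (eX n i) (x, h t x) + pdX n (h t) i x * pdE n Φ (eY n) (x, h t x)
      = pdE n Q (eX n i) (x, h t x) + pdX n (h t) i x * pdE n Q (eY n) (x, h t x) := by
    intro i
    rw [← pdX_graph hΦs hsl, ← pdX_graph sQ hsl]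
    have : (fun x => Φ (x, h t x)) = fun x => Q (x, h t x) := funext hΦ.boundary
    rw [this]
  have hxy : ∀ i, pdE n (pdE n φ (eX n i)) (eY n) = pdE n (pdE n φ (eY n)) (eX n i) := fun i =>
    pdE_comm hφs _ _
  constructor
  · rw [hda, gA]
    simp only [hdxa]
    simp only [hV, ha]
    refine final_algebra (fun i => pdX n (h t) i x) (fun i => pdE n (pdE n φ (eY n)) (eX n i) (x, h t x))
      (fun i => pdE n (pdE n φ (eX n i)) (eY n) (x, h t x)
        - ∑ j, pdX n (h t) j x * pdE n (pdE n φ (eX n i)) (eX n j) (x, h t x))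
      (fun i j => pdE n (pdE n φ (eX n i)) (eX n j) (x, h t x))
      (fun i => pdE n Φ (eX n i) (x, h t x)) (fun i => pdE n φ (eX n i) (x, h t x))
      (fun i => pdE n Q (eX n i) (x, h t x) + pdX n (h t) i x * pdE n Q (eY n) (x, h t x))
      (pdE n (pdE n φ (eY n)) (eY n) (x, h t x)) (1 - pdE n φ (eY n) (x, h t x)) _ _ _
      (pdE n Φ (eY n) (x, h t x) - ∑ i, pdX n (h t) i x * pdE n Φ (eX n i) (x, h t x))
      (fun i => hVa x i) ?_ hτ ?_ ?_ rfl ?_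
    · rw [hhd]
      ring
    · intro i
      simp only [hQd, hxy, mul_add, Finset.sum_add_distrib, Finset.mul_sum]
      have e : ∀ j, 2 * (pdE n φ (eX n j) (x, h t x)
          * (pdX n (h t) i x * pdE n (pdE n φ (eY n)) (eX n j) (x, h t x)))
        = pdX n (h t) i x * (2 * (pdE n φ (eX n j) (x, h t x)
          * pdE n (pdE n φ (eY n)) (eX n j) (x, h t x))) := fun j => by ring
      simp only [e]
      ring
    · intro i
      simp only [hxy]
    · unfold HSgamma
      rw [gBV, gB, hB]
      simp only [gV]
      simp only [hV]
      ring
  · unfold HSgamma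
    rw [gBV, gAV, gB, gA, hB, ha]
    ring


/-- the Rayleigh–Taylor coefficient satisfies
∂ₜa − V·∇a + a G(h)a + γ = 0 and γ = (1+|∇h|²)⁻¹ (G(h)(a²+|V|²) − 2a G(h)a − 2V·G(h)V). -/
theorem heleShaw_a_evolution (n : ℕ) (hn : 1 ≤ n) (T : ℝ) (hT : 0 ≤ T)
    (h : ℝ → (Fin n → ℝ) → ℝ) (hsol : IsHeleShawSol n T h) :
    ∀ t ∈ Set.Icc 0 T, ∀ x,
      (deriv (fun s => HSa n h s x) t
        - (∑ i, HSV n h t x i * pdX n (fun z => HSa n h t z) i x)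
        + HSa n h t x * DtN n (h t) (fun z => HSa n h t z) x
        + HSgamma n h t x = 0) ∧
      HSgamma n h t x
        = (1 + ∑ i, (pdX n (h t) i x)^2)⁻¹ *
            ( DtN n (h t) (fun z => (HSa n h t z)^2 + ∑ i, (HSV n h t z i)^2) x
              - 2 * HSa n h t x * DtN n (h t) (fun z => HSa n h t z) x
              - 2 * ∑ i, HSV n h t x i * DtN n (h t) (fun z => HSV n h t z i) x ) := by
  intro t ht x
  exact heleShaw_a_evolution_aux n T h hsol t ht x

end
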